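/- Let f ∈ ℤ[X] be a monic squarefree polynomial of positive degree. Then there exists a constant c > 0 (depending on f) such that for all sufficiently large real X, the number of Carmichael numbers n ≤ X with the property that for every prime p dividing n, the image of f in (ZMod p)[X] splits into linear factors, is at least X^c. -/

import Mathlib

/-- A Carmichael number: a composite natural number `n > 1` such that
`a ^ (n - 1) ≡ 1 (mod n)` for every integer `a` coprime to `n`. -/
def IsCarmichael (n : ℕ) : Prop :=
  1 < n ∧ ¬ n.Prime ∧ ∀ a : ℤ, IsCoprime a (n : ℤ) → a ^ (n - 1) ≡ 1 [ZMOD (n : ℤ)]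

/-- The image of `f` in `(ZMod p)[X]` is a product of linear factors. -/
def SplitsModLinear (f : Polynomial ℤ) (p : ℕ) : Prop :=
  ∃ s : Multiset (ZMod p),
    f.map (Int.castRingHom (ZMod p)) =
      (s.map fun a => Polynomial.X - Polynomial.C a).prod

section

theorem AddChar_map_sum_aux {A : Type*} [AddCommGroup A] (ψ : AddChar A ℂ) {α : Type*}
    (s : Finset α) (g : α → A) : ψ (∑ i ∈ s, g i) = ∏ i ∈ s, ψ (g i) := by
  classical
  induction s using Finset.induction_on with
  | empty => simp
  | insert i s his ih => rw [Finset.sum_insert his, Finset.prod_insert his,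
      AddChar.map_add_eq_mul, ih]

theorem dav_aux {A : Type*} [AddCommGroup A] [Fintype A] (e : ℕ) (he : 0 < e)
    (hexp : ∀ g : A, e • g = 0) {α : Type*} [DecidableEq α] (g : α → A) (s : Finset α) :
    ∃ a : α → ℂ, (∀ i, a i ≠ 0) ∧
      ((Finset.univ.filter (fun ψ : AddChar A ℂ => ∀ i ∈ s, ψ (g i) ≠ a i)).card : ℝ) ≤
        (Fintype.card A : ℝ) * (1 - 1 / (e : ℝ)) ^ s.card := by
  classical
  induction s using Finset.induction_on with
  | empty =>
    refine ⟨fun _ => 1, fun _ => one_ne_zero, ?_⟩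
    simp [AddChar.card_eq]
  | insert i s his ih =>
    obtain ⟨a, ha, hb⟩ := ih
    set R := Finset.univ.filter (fun ψ : AddChar A ℂ => ∀ i ∈ s, ψ (g i) ≠ a i) with hR
    have hmaps : ∀ ψ ∈ R, ψ (g i) ∈ Polynomial.nthRootsFinset e (1 : ℂ) := by
      intro ψ _
      rw [Polynomial.mem_nthRootsFinset he]
      rw [← AddChar.map_nsmul_eq_pow, hexp, AddChar.map_zero_eq_one]
    have hne : (Polynomial.nthRootsFinset e (1 : ℂ)).Nonempty :=
      ⟨1, by rw [Polynomial.mem_nthRootsFinset he]; simp⟩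
    have hcard : ((Polynomial.nthRootsFinset e (1 : ℂ)).card : ℝ) ≤ e := by
      have : (Polynomial.nthRootsFinset e (1 : ℂ)).card ≤ e :=
        (Multiset.toFinset_card_le _).trans (Polynomial.card_nthRoots e 1)
      exact_mod_cast this
    have he' : (0 : ℝ) < e := by exact_mod_cast he
    obtain ⟨w, hw, hwc⟩ := Finset.exists_le_card_fiber_of_nsmul_le_card_of_maps_to
      (M := ℝ) (b := (R.card : ℝ) / e) hmaps hne (by
        rw [nsmul_eq_mul]
        calc _ ≤ (e : ℝ) * ((R.card : ℝ) / e) := by gcongr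
          _ = R.card := by field_simp)
    have hw0 : w ≠ 0 := by
      rw [Polynomial.mem_nthRootsFinset he] at hw
      intro h
      rw [h, zero_pow he.ne'] at hw
      exact zero_ne_one hw
    refine ⟨Function.update a i w, ?_, ?_⟩
    · intro j
      by_cases hj : j = i
      · subst hj; simpa using hw0
      · simpa [Function.update_of_ne hj] using ha j
    · have hset : Finset.univ.filter (fun ψ : AddChar A ℂ =>
          ∀ j ∈ insert i s, ψ (g j) ≠ Function.update a i w j) =
          R.filter (fun ψ => ¬ ψ (g i) = w) := by
        ext ψ
        simp only [Finset.mem_filter, Finset.mem_univ, true_and, Finset.mem_insert, hR,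
          forall_eq_or_imp, Function.update_self, ne_eq]
        constructor
        · rintro ⟨h1, h2⟩
          refine ⟨fun j hj => ?_, h1⟩
          have := h2 j hj
          rwa [Function.update_of_ne (by rintro rfl; exact his hj)] at this
        · rintro ⟨h1, h2⟩
          refine ⟨h2, fun j hj => ?_⟩
          rw [Function.update_of_ne (by rintro rfl; exact his hj)]
          exact h1 j hj
      rw [hset, Finset.card_insert_of_notMem his]
      have h1 := Finset.card_filter_add_card_filter_not (s := R) (fun ψ => ψ (g i) = w)
      have h1' : ((R.filter (fun ψ => ψ (g i) = w)).card : ℝ) +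
        ((R.filter (fun ψ => ¬ ψ (g i) = w)).card : ℝ) = R.card := by exact_mod_cast h1
      have h2 : ((R.filter (fun ψ => ¬ ψ (g i) = w)).card : ℝ) ≤ R.card * (1 - 1 / (e : ℝ)) := by
        have : (R.card : ℝ) * (1 - 1 / (e : ℝ)) = R.card - R.card / e := by ring
        rw [this]; linarith
      have h3 : (0 : ℝ) ≤ 1 - 1 / (e : ℝ) := by
        rw [sub_nonneg, div_le_one he']; exact_mod_cast he
      calc _ ≤ _ := h2
        _ ≤ (Fintype.card A : ℝ) * (1 - 1 / (e : ℝ)) ^ s.card * (1 - 1 / (e : ℝ)) := by gcongr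
        _ = _ := by ring

/-- Davenport constant bound. -/
theorem davenport_add {A : Type*} [AddCommGroup A] [Fintype A] (e : ℕ) (he : 0 < e)
    (hexp : ∀ g : A, e • g = 0) {α : Type*} (g : α → A) (s : Finset α)
    (hs : (e : ℝ) * Real.log (Fintype.card A) < s.card) :
    ∃ t ⊆ s, t.Nonempty ∧ ∑ i ∈ t, g i = 0 := by
  classical
  obtain ⟨a, ha, hb⟩ := dav_aux e he hexp g s
  have he' : (0 : ℝ) < e := by exact_mod_cast he
  have hA : (0 : ℝ) < Fintype.card A := by exact_mod_cast Fintype.card_pos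
  have hlt : (Fintype.card A : ℝ) * (1 - 1 / (e : ℝ)) ^ s.card < 1 := by
    have h1 : (1 - 1 / (e : ℝ)) ^ s.card ≤ Real.exp (-(s.card / e)) := by
      have h3 : (0 : ℝ) ≤ 1 - 1 / (e : ℝ) := by
        rw [sub_nonneg, div_le_one he']; exact_mod_cast he
      calc (1 - 1 / (e : ℝ)) ^ s.card ≤ (Real.exp (-(1 / (e : ℝ)))) ^ s.card := by
            gcongr; exact Real.one_sub_le_exp_neg _
        _ = _ := by rw [← Real.exp_nat_mul]; ring_nf
    have h2 : Real.log (Fintype.card A) < s.card / e := by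
      rw [lt_div_iff₀ he']; linarith
    calc _ ≤ (Fintype.card A : ℝ) * Real.exp (-(s.card / e)) := by gcongr
      _ = Real.exp (Real.log (Fintype.card A)) * Real.exp (-(s.card / e)) := by
          rw [Real.exp_log hA]
      _ = Real.exp (Real.log (Fintype.card A) - s.card / e) := by rw [← Real.exp_add]; ring_nf
      _ < 1 := by rw [Real.exp_lt_one_iff]; linarith
  have hemp : (Finset.univ.filter (fun ψ : AddChar A ℂ => ∀ i ∈ s, ψ (g i) ≠ a i)).card = 0 := by
    have := lt_of_le_of_lt hb hlt
    have h : (Finset.univ.filter (fun ψ : AddChar A ℂ => ∀ i ∈ s, ψ (g i) ≠ a i)).card < 1 := by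
      exact_mod_cast this
    omega
  rw [Finset.card_eq_zero, Finset.filter_eq_empty_iff] at hemp
  have hprod : ∀ ψ : AddChar A ℂ, ∏ i ∈ s, (a i + (- ψ (g i))) = 0 := by
    intro ψ
    have := hemp (Finset.mem_univ ψ)
    push Not at this
    obtain ⟨i, hi, h⟩ := this
    exact Finset.prod_eq_zero hi (by rw [h]; ring)
  by_contra hcon
  push Not at hcon
  have hsum : ∑ ψ : AddChar A ℂ, ∏ i ∈ s, (a i + (- ψ (g i))) = 0 :=
    Finset.sum_eq_zero fun ψ _ => hprod ψ
  simp_rw [Finset.prod_add] at hsum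
  rw [Finset.sum_comm] at hsum
  rw [Finset.sum_eq_single s] at hsum
  · simp only [Finset.sdiff_self, Finset.prod_empty, mul_one, Finset.sum_const,
      Finset.card_univ, AddChar.card_eq, nsmul_eq_mul] at hsum
    rcases mul_eq_zero.mp hsum with h | h
    · exact hA.ne' (by exact_mod_cast h)
    · rw [Finset.prod_eq_zero_iff] at h
      obtain ⟨i, _, hi⟩ := h
      exact ha i hi
  · intro t ht hts
    rw [← Finset.mul_sum]
    have hne : (s \ t).Nonempty := by
      rw [Finset.sdiff_nonempty]
      intro h
      exact hts (Finset.Subset.antisymm (Finset.mem_powerset.mp ht) h)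
    have h0 := hcon (s \ t) Finset.sdiff_subset hne
    have : ∀ ψ : AddChar A ℂ, ∏ i ∈ s \ t, (-ψ (g i)) =
        (-1) ^ (s \ t).card * ψ (∑ i ∈ s \ t, g i) := by
      intro ψ
      rw [Finset.prod_neg, AddChar_map_sum_aux]
    simp_rw [this]
    rw [← Finset.mul_sum, AddChar.sum_apply_eq_ite, if_neg h0]
    simp
  · intro h
    exact absurd (Finset.mem_powerset_self s) h

theorem davenport_mul {G : Type*} [CommGroup G] [Fintype G] (e : ℕ) (he : 0 < e)
    (hexp : ∀ g : G, g ^ e = 1) {α : Type*} (g : α → G) (s : Finset α)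
    (hs : (e : ℝ) * Real.log (Fintype.card G) < s.card) :
    ∃ t ⊆ s, t.Nonempty ∧ ∏ i ∈ t, g i = 1 := by
  have := davenport_add (A := Additive G) e he (fun x => by
    have := hexp x.toMul
    exact congrArg Additive.ofMul this) (fun i => Additive.ofMul (g i)) s (by
      simpa using hs)
  obtain ⟨t, ht, hn, h⟩ := this
  refine ⟨t, ht, hn, ?_⟩
  have h' := congrArg Additive.toMul h
  simpa using h'

end

section

theorem isCarmichael_of_prod (k L : ℕ) (hkL : k.Coprime L) (S : Finset ℕ)
    (hS : ∀ p ∈ S, p.Prime ∧ ∃ d, d ∣ L ∧ p = k * d + 1) (h2 : 2 ≤ S.card)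
    (hmod : L ∣ (∏ p ∈ S, p) - 1) : IsCarmichael (∏ p ∈ S, p) := by
  classical
  have hne : S.Nonempty := Finset.card_pos.mp (by omega)
  have hpos : 0 < ∏ p ∈ S, p := Finset.prod_pos fun p hp => (hS p hp).1.pos
  obtain ⟨p0, hp0⟩ := hne
  have hgt : 1 < ∏ p ∈ S, p :=
    lt_of_lt_of_le (hS p0 hp0).1.one_lt (Nat.le_of_dvd hpos (Finset.dvd_prod_of_mem _ hp0))
  refine ⟨hgt, ?_, ?_⟩
  · intro hprime
    have : ∀ p ∈ S, p = ∏ p ∈ S, p := fun p hp =>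
      ((Nat.prime_dvd_prime_iff_eq (hS p hp).1 hprime).mp (Finset.dvd_prod_of_mem _ hp))
    have : S.card ≤ 1 := Finset.card_le_one.mpr fun a ha b hb => (this a ha).trans (this b hb).symm
    omega
  · intro a ha
    have hk : k ∣ (∏ p ∈ S, p) - 1 := by
      rw [← Nat.modEq_iff_dvd' hpos]
      refine Nat.ModEq.symm ?_
      have : ∏ p ∈ S, p ≡ ∏ p ∈ S, 1 [MOD k] := by
        refine Nat.ModEq.prod fun p hp => ?_
        obtain ⟨_, d, _, rfl⟩ := hS p hp
        simp [Nat.ModEq, Nat.add_mod]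
      simpa using this
    have hkLd : k * L ∣ (∏ p ∈ S, p) - 1 := hkL.mul_dvd_of_dvd_of_dvd hk hmod
    refine Int.ModEq.symm ((Int.modEq_iff_dvd).mpr ?_)
    push_cast
    refine Finset.prod_dvd_of_coprime ?_ ?_
    · intro p hp q hq hpq
      exact (Nat.isCoprime_iff_coprime).mpr
        ((Nat.coprime_primes (hS p hp).1 (hS q hq).1).mpr hpq)
    · intro p hp
      obtain ⟨hpp, d, hd, hpd⟩ := hS p hp
      have hcop : IsCoprime a (p : ℤ) := by
        refine IsCoprime.of_isCoprime_of_dvd_right ha ?_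
        exact_mod_cast Finset.dvd_prod_of_mem (fun p => p) hp
      have hf := Int.ModEq.pow_card_sub_one_eq_one hpp hcop
      have hdiv : p - 1 ∣ (∏ p ∈ S, p) - 1 := by
        have : p - 1 = k * d := by omega
        rw [this]
        exact (Nat.mul_dvd_mul_left k hd).trans hkLd
      obtain ⟨c, hc⟩ := hdiv
      have : a ^ ((∏ p ∈ S, p) - 1) ≡ 1 [ZMOD p] := by
        rw [hc, pow_mul]
        simpa using hf.pow c
      exact (Int.modEq_iff_dvd).mp this.symm

theorem card_small_subsets (P : Finset ℕ) (D : ℕ) :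
    (P.powerset.filter (fun T => T.card ≤ D)).card ≤ (P.card + 1) ^ D := by
  classical
  have h1 : P.powerset.filter (fun T => T.card ≤ D) ⊆
      (Finset.range (D + 1)).biUnion (fun j => P.powersetCard j) := by
    intro T hT
    simp only [Finset.mem_filter, Finset.mem_powerset] at hT
    simp only [Finset.mem_biUnion, Finset.mem_range, Finset.mem_powersetCard]
    exact ⟨T.card, by omega, hT.1, rfl⟩
  refine (Finset.card_le_card h1).trans (Finset.card_biUnion_le.trans ?_)
  rw [add_pow]
  refine Finset.sum_le_sum fun j hj => ?_
  rw [Finset.card_powersetCard, one_pow, mul_one]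
  have : 1 ≤ D.choose j := Nat.choose_pos (by simpa [Nat.lt_succ_iff] using hj)
  calc _ ≤ P.card ^ j := Nat.choose_le_pow _ _
    _ ≤ _ := Nat.le_mul_of_pos_right _ this

theorem agp_count (good : ℕ → Prop) (k L e D t x : ℕ) (hL : 0 < L) (hkL : k.Coprime L)
    (he : 0 < e) (hexp : ∀ a : (ZMod L)ˣ, a ^ e = 1)
    (hD : (e : ℝ) * Real.log (Nat.totient L) < D) (P : Finset ℕ)
    (hP : ∀ p ∈ P, p.Prime ∧ good p ∧ p.Coprime L ∧ p ≤ x ∧ ∃ d, d ∣ L ∧ p = k * d + 1)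
    (htD : D + 2 ≤ t) :
    P.card.choose t ≤ {n : ℕ | n ≤ x ^ t ∧ IsCarmichael n ∧
      ∀ p : ℕ, p.Prime → p ∣ n → good p}.ncard * (P.card + 1) ^ D := by
  classical
  haveI : NeZero L := ⟨hL.ne'⟩
  let IsOne : Finset ℕ → Prop := fun S => ((∏ p ∈ S, p : ℕ) : ZMod L) = 1
  have hex : ∀ T : Finset ℕ, T ∈ P.powersetCard t →
      ∃ S ⊆ T, IsOne S ∧ (T \ S).card ≤ D := by
    intro T hT
    rw [Finset.mem_powersetCard] at hT
    have hne : (T.powerset.filter IsOne).Nonempty :=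
      ⟨∅, by simp [IsOne]⟩
    obtain ⟨S, hS, hmax⟩ := Finset.exists_max_image _ Finset.card hne
    simp only [Finset.mem_filter, Finset.mem_powerset] at hS
    refine ⟨S, hS.1, hS.2, ?_⟩
    by_contra hlt
    push Not at hlt
    let g : ℕ → (ZMod L)ˣ := fun p => if h : p.Coprime L then ZMod.unitOfCoprime p h else 1
    obtain ⟨R, hR, hRne, hRone⟩ := davenport_mul e he hexp g (T \ S) (by
      rw [ZMod.card_units_eq_totient]
      refine hD.trans ?_
      exact_mod_cast hlt)
    have hgR : ((∏ p ∈ R, p : ℕ) : ZMod L) = 1 := by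
      have h1 : ((∏ p ∈ R, g p : (ZMod L)ˣ) : ZMod L) = 1 := by rw [hRone]; rfl
      rw [Units.coe_prod] at h1
      rw [Nat.cast_prod, ← h1]
      refine Finset.prod_congr rfl fun p hp => ?_
      have hpT := (Finset.mem_sdiff.mp (hR hp)).1
      have := (hP p (hT.1 hpT)).2.2.1
      simp only [g]
      rw [dif_pos this]
      exact (ZMod.coe_unitOfCoprime p this).symm
    have hdisj : Disjoint S R := by
      rw [Finset.disjoint_left]
      intro a ha hb
      exact (Finset.mem_sdiff.mp (hR hb)).2 ha
    have hmem : S ∪ R ∈ T.powerset.filter IsOne := by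
      simp only [Finset.mem_filter, Finset.mem_powerset]
      refine ⟨Finset.union_subset hS.1 (hR.trans Finset.sdiff_subset), ?_⟩
      simp only [IsOne]
      rw [Finset.prod_union hdisj, Nat.cast_mul, hgR, hS.2, one_mul]
    have := hmax _ hmem
    rw [Finset.card_union_of_disjoint hdisj] at this
    have := hRne.card_pos
    omega
  choose! S hST hSone hScard using hex
  set A : Set ℕ := {n : ℕ | n ≤ x ^ t ∧ IsCarmichael n ∧
      ∀ p : ℕ, p.Prime → p ∣ n → good p} with hA
  have hAfin : A.Finite := (Set.finite_Iic (x ^ t)).subset fun n hn => hn.1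
  have hprim : ∀ T ∈ P.powersetCard t, ∀ p ∈ S T, p ∈ P := fun T hT p hp =>
    (Finset.mem_powersetCard.mp hT).1 (hST T hT hp)
  have hmemA : ∀ T ∈ P.powersetCard t, (∏ p ∈ S T, p) ∈ A := by
    intro T hT
    have hTc := (Finset.mem_powersetCard.mp hT).2
    have hpos : 0 < ∏ p ∈ S T, p := Finset.prod_pos fun p hp => (hP p (hprim T hT p hp)).1.pos
    have hSc : (S T).card ≤ t := hTc ▸ Finset.card_le_card (hST T hT)
    have hx : 1 ≤ x ∨ S T = ∅ := by
      rcases (S T).eq_empty_or_nonempty with h | ⟨p, hp⟩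
      · exact Or.inr h
      · left
        have := hP p (hprim T hT p hp)
        exact this.1.one_le.trans this.2.2.2.1
    have hc2 : 2 ≤ (S T).card := by
      have := Finset.card_sdiff_add_card_eq_card (hST T hT)
      have := hScard T hT
      omega
    refine ⟨?_, ?_, ?_⟩
    · calc ∏ p ∈ S T, p ≤ ∏ p ∈ S T, x :=
            Finset.prod_le_prod' fun p hp => (hP p (hprim T hT p hp)).2.2.2.1
        _ = x ^ (S T).card := by simp
        _ ≤ x ^ t := by
          rcases hx with h | h
          · exact Nat.pow_le_pow_right h hSc
          · rw [h] at hc2; simp at hc2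
    · refine isCarmichael_of_prod k L hkL (S T) (fun p hp => ?_) hc2 ?_
      · have := hP p (hprim T hT p hp)
        exact ⟨this.1, this.2.2.2.2⟩
      · have h1 : ((∏ p ∈ S T, p : ℕ) : ZMod L) = ((1 : ℕ) : ZMod L) := by
          rw [hSone T hT]; simp
        rw [ZMod.natCast_eq_natCast_iff] at h1
        exact (Nat.modEq_iff_dvd' hpos).mp h1.symm
    · intro q hq hqd
      obtain ⟨p, hp, hqp⟩ := (Prime.dvd_finsetProd_iff hq.prime _).mp hqd
      have := hP p (hprim T hT p hp)
      rw [(Nat.prime_dvd_prime_iff_eq hq this.1).mp hqp]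
      exact this.2.1
  have hinj : ∀ S1 S2 : Finset ℕ, (∀ p ∈ S1, p ∈ P) → (∀ p ∈ S2, p ∈ P) →
      ∏ p ∈ S1, p = ∏ p ∈ S2, p → S1 = S2 := by
    intro S1 S2 h1 h2 h
    rw [← Nat.primeFactors_prod fun p hp => (hP p (h1 p hp)).1,
      ← Nat.primeFactors_prod fun p hp => (hP p (h2 p hp)).1, h]
  rw [Set.ncard_eq_toFinset_card A hAfin, ← Finset.card_powersetCard t P]
  refine le_trans ?_ (Nat.mul_le_mul_left _ (card_small_subsets P D))
  rw [← Finset.card_product]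
  refine Finset.card_le_card_of_injOn (fun T => (∏ p ∈ S T, p, T \ S T)) ?_ ?_
  · intro T hT
    have hT' : T ∈ P.powersetCard t := hT
    simp only [Finset.coe_product, Set.mem_prod, Finset.mem_coe, Set.Finite.mem_toFinset,
      Finset.mem_filter, Finset.mem_powerset]
    exact ⟨hmemA T hT', Finset.sdiff_subset.trans (Finset.mem_powersetCard.mp hT').1,
      hScard T hT'⟩
  · intro T1 hT1 T2 hT2 h
    have hT1' : T1 ∈ P.powersetCard t := hT1
    have hT2' : T2 ∈ P.powersetCard t := hT2
    simp only [Prod.mk.injEq] at h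
    have hS := hinj _ _ (hprim T1 hT1') (hprim T2 hT2') h.1
    rw [← Finset.sdiff_union_of_subset (hST T1 hT1'), ← Finset.sdiff_union_of_subset (hST T2 hT2'),
      h.2, hS]

end

section

open scoped ComplexConjugate

noncomputable def tent (t : ℝ) : ℝ := max 0 (1 - |t|)

lemma tent_nonneg (t : ℝ) : 0 ≤ tent t := le_max_left _ _

lemma tent_le_one (t : ℝ) : tent t ≤ 1 := by
  unfold tent
  exact max_le zero_le_one (by linarith [abs_nonneg t])

lemma tent_eq_zero {t : ℝ} (h : 1 ≤ |t|) : tent t = 0 := by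
  unfold tent
  exact max_eq_left (by linarith)

lemma tent_lip (s t : ℝ) : |tent s - tent t| ≤ |s - t| := by
  unfold tent
  rw [max_comm 0 (1 - |s|), max_comm 0 (1 - |t|)]
  refine (abs_max_sub_max_le_abs _ _ _).trans ?_
  have := abs_abs_sub_abs_le t s
  rw [abs_sub_comm s t]
  refine le_trans (le_of_eq ?_) this
  congr 1
  ring

lemma tent_pos {t : ℝ} (h : tent t ≠ 0) : |t| < 1 := by
  by_contra hc
  exact h (tent_eq_zero (not_lt.mp hc))

lemma tent_integral (p q : ℝ) :
    ∫ v, (Set.Ico (p - 1) p).indicator (fun _ => (1:ℝ)) v *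
      (Set.Ico (q - 1) q).indicator (fun _ => (1:ℝ)) v = tent (p - q) := by
  have : (fun v : ℝ => (Set.Ico (p - 1) p).indicator (fun _ => (1:ℝ)) v *
      (Set.Ico (q - 1) q).indicator (fun _ => (1:ℝ)) v) =
      (Set.Ico (max (p-1) (q-1)) (min p q)).indicator (fun _ => (1:ℝ)) := by
    rw [← Set.Ico_inter_Ico]
    funext v
    by_cases h1 : v ∈ Set.Ico (p-1) p <;> by_cases h2 : v ∈ Set.Ico (q-1) q <;>
      simp [Set.indicator, h1, h2, -Set.mem_Ico]
  rw [this, MeasureTheory.integral_indicator measurableSet_Ico]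
  simp only [MeasureTheory.integral_const, smul_eq_mul, mul_one]
  rw [MeasureTheory.measureReal_restrict_apply_univ, Real.volume_real_Ico]
  unfold tent
  rw [max_comm]
  congr 1
  rcases le_total p q with h | h
  · rw [min_eq_left h, max_eq_right (by linarith), abs_of_nonpos (by linarith)]; ring
  · rw [min_eq_right h, max_eq_left (by linarith), abs_of_nonneg (by linarith)]; ring

/-- trivial large sieve by duality -/
lemma large_sieve {κ : Type*} (E : Finset κ) (c : κ → ℕ → ℂ) (B : ℝ) (s : Finset ℕ)
    (horth : ∀ i ∈ E, ∀ j ∈ E, i ≠ j → ‖∑ l ∈ s, c i l * conj (c j l)‖ ≤ B)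
    (hB : 0 ≤ B)
    (hnorm : ∀ i l, ‖c i l‖ ≤ 1) (a : ℕ → ℂ) :
    ∑ i ∈ E, ‖∑ l ∈ s, a l * c i l‖ ^ 2 ≤ (s.card + B * E.card) * ∑ l ∈ s, ‖a l‖ ^ 2 := by
  classical
  set S : κ → ℂ := fun i => ∑ l ∈ s, a l * c i l with hS
  set W : ℝ := ∑ i ∈ E, ‖S i‖ ^ 2 with hW
  have hW0 : 0 ≤ W := Finset.sum_nonneg fun i _ => by positivity
  set b : ℕ → ℂ := fun l => ∑ i ∈ E, conj (S i) * c i l with hb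
  have h1 : (W : ℂ) = ∑ l ∈ s, a l * b l := by
    simp only [hW, hb]
    push_cast
    simp only [Finset.mul_sum]
    rw [Finset.sum_comm]
    refine Finset.sum_congr rfl fun i _ => ?_
    rw [← Complex.conj_mul']
    conv_lhs => rw [hS]
    simp only [Finset.mul_sum]
    refine Finset.sum_congr rfl fun l _ => ?_
    ring
  have h2 : W ^ 2 ≤ (∑ l ∈ s, ‖a l‖ ^ 2) * ∑ l ∈ s, ‖b l‖ ^ 2 := by
    have : W ≤ ∑ l ∈ s, ‖a l‖ * ‖b l‖ := by
      calc W = ‖(W : ℂ)‖ := by rw [Complex.norm_real, Real.norm_of_nonneg hW0]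
        _ ≤ _ := by
          rw [h1]
          refine (norm_sum_le _ _).trans (le_of_eq ?_)
          simp
    calc W ^ 2 ≤ (∑ l ∈ s, ‖a l‖ * ‖b l‖) ^ 2 := by gcongr
      _ ≤ _ := Finset.sum_mul_sq_le_sq_mul_sq _ _ _
  have h3 : ∑ l ∈ s, ‖b l‖ ^ 2 ≤ (s.card + B * E.card) * W := by
    have e1 : ((∑ l ∈ s, ‖b l‖ ^ 2 : ℝ) : ℂ) =
        ∑ i ∈ E, ∑ j ∈ E, conj (S i) * S j * ∑ l ∈ s, c i l * conj (c j l) := by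
      push_cast
      simp only [Finset.mul_sum]
      have : ∀ l ∈ s, ((‖b l‖ : ℂ)) ^ 2 = ∑ i ∈ E, ∑ j ∈ E,
          conj (S i) * S j * (c i l * conj (c j l)) := by
        intro l _
        rw [← Complex.mul_conj', hb]
        simp only [map_sum, map_mul, Complex.conj_conj]
        rw [Finset.sum_mul_sum]
        refine Finset.sum_congr rfl fun i _ => Finset.sum_congr rfl fun j _ => ?_
        ring
      rw [Finset.sum_congr rfl this, Finset.sum_comm]
      refine Finset.sum_congr rfl fun i _ => ?_
      rw [Finset.sum_comm]
    have e2 : ∑ l ∈ s, ‖b l‖ ^ 2 ≤ ∑ i ∈ E, ∑ j ∈ E, ‖S i‖ * ‖S j‖ *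
        (B + if i = j then (s.card : ℝ) else 0) := by
      calc ∑ l ∈ s, ‖b l‖ ^ 2 = ‖((∑ l ∈ s, ‖b l‖ ^ 2 : ℝ) : ℂ)‖ := by
            rw [Complex.norm_real, Real.norm_of_nonneg]
            exact Finset.sum_nonneg fun i _ => by positivity
        _ ≤ _ := by
          rw [e1]
          refine (norm_sum_le _ _).trans (Finset.sum_le_sum fun i hi => ?_)
          refine (norm_sum_le _ _).trans (Finset.sum_le_sum fun j hj => ?_)
          rw [norm_mul, norm_mul, RCLike.norm_conj]
          gcongr
          split_ifs with hij
          · refine (norm_sum_le _ _).trans ?_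
            have : ∑ l ∈ s, ‖c i l * conj (c j l)‖ ≤ ∑ l ∈ s, (1:ℝ) := by
              refine Finset.sum_le_sum fun l _ => ?_
              rw [norm_mul, RCLike.norm_conj]
              exact mul_le_one₀ (hnorm _ _) (norm_nonneg _) (hnorm _ _)
            simp only [Finset.sum_const, nsmul_eq_mul, mul_one] at this
            linarith
          · rw [add_zero]
            exact horth i hi j hj hij
    have e3 : ∑ i ∈ E, ∑ j ∈ E, ‖S i‖ * ‖S j‖ * (B + if i = j then (s.card : ℝ) else 0)
        = B * (∑ i ∈ E, ‖S i‖) ^ 2 + s.card * W := by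
      have : ∀ i ∈ E, ∑ j ∈ E, ‖S i‖ * ‖S j‖ * (B + if i = j then (s.card : ℝ) else 0)
          = B * ‖S i‖ * (∑ j ∈ E, ‖S j‖) + s.card * ‖S i‖ ^ 2 := by
        intro i hi
        simp only [mul_add, Finset.sum_add_distrib, mul_ite, mul_zero, Finset.sum_ite_eq, hi,
          if_true, Finset.mul_sum]
        congr 1
        · refine Finset.sum_congr rfl fun j _ => by ring
        · ring
      rw [Finset.sum_congr rfl this, Finset.sum_add_distrib, ← Finset.sum_mul, ← Finset.mul_sum,
        ← Finset.mul_sum]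
      ring
    have e4 : (∑ i ∈ E, ‖S i‖) ^ 2 ≤ E.card * W := by
      simpa using sq_sum_le_card_mul_sum_sq (s := E) (f := fun i => ‖S i‖)
    calc _ ≤ _ := e2
      _ = _ := e3
      _ ≤ B * (E.card * W) + s.card * W := by gcongr
      _ = _ := by ring
  have hA0 : 0 ≤ ∑ l ∈ s, ‖a l‖ ^ 2 := Finset.sum_nonneg fun i _ => by positivity
  rcases hW0.eq_or_lt with h | h
  · rw [← h]; positivity
  · have : W * W ≤ ((s.card + B * E.card) * ∑ l ∈ s, ‖a l‖ ^ 2) * W := by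
      calc W * W = W ^ 2 := by ring
        _ ≤ _ := h2
        _ ≤ (∑ l ∈ s, ‖a l‖ ^ 2) * ((s.card + B * E.card) * W) := by gcongr
        _ = _ := by ring
    exact le_of_mul_le_mul_right this h

end

section

open scoped ComplexConjugate

/-- one window -/
lemma window_bound {κ : Type*} (E : Finset κ) (c : κ → ℕ → ℂ) (B : ℝ) (hB : 0 ≤ B)
    (horth : ∀ i ∈ E, ∀ j ∈ E, i ≠ j → ∀ M : ℕ, ‖∑ l ∈ Finset.Icc 1 M, c i l * conj (c j l)‖ ≤ B)
    (hnorm : ∀ i l, ‖c i l‖ ≤ 1) (α : ℕ → ℝ) (U : ℝ) (N : ℕ) (H : ℝ) (hH : 0 ≤ H)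
    (hα : ∀ a : ℕ, (a : ℝ) ≤ U → α a = 0) (hU : B * E.card ≤ U)
    (hms : ∀ M : ℕ, M ≤ N → ∑ a ∈ Finset.Icc 1 M, α a ^ 2 ≤ M * H)
    (w : ℕ → ℝ) (hw0 : ∀ a, 0 ≤ w a) (hw1 : ∀ a, w a ≤ 1) (y : ℝ) (hy : 0 ≤ y)
    (hw : ∀ a : ℕ, w a ≠ 0 → (a : ℝ) ≤ y) :
    ∑ i ∈ E, ‖∑ a ∈ Finset.Icc 1 N, ((α a * w a : ℝ) : ℂ) * c i a‖ ^ 2 ≤ 2 * y ^ 2 * H := by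
  classical
  set M : ℕ := min N ⌊y⌋₊ with hM
  have hMy : (M : ℝ) ≤ y := by
    calc (M : ℝ) ≤ ⌊y⌋₊ := by exact_mod_cast min_le_right _ _
      _ ≤ y := Nat.floor_le hy
  have hsum : ∀ i, ∑ a ∈ Finset.Icc 1 N, ((α a * w a : ℝ) : ℂ) * c i a =
      ∑ a ∈ Finset.Icc 1 M, ((α a * w a : ℝ) : ℂ) * c i a := by
    intro i
    symm
    refine Finset.sum_subset (Finset.Icc_subset_Icc_right (min_le_left _ _)) fun a ha hna => ?_
    have : w a = 0 := by
      by_contra hne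
      apply hna
      rw [Finset.mem_Icc] at ha ⊢
      exact ⟨ha.1, le_min ha.2 (Nat.le_floor (hw a hne))⟩
    simp [this]
  simp only [hsum]
  by_cases hMU : (M : ℝ) ≤ U
  · have : ∀ i ∈ E, ‖∑ a ∈ Finset.Icc 1 M, ((α a * w a : ℝ) : ℂ) * c i a‖ ^ 2 = 0 := by
      intro i _
      rw [Finset.sum_eq_zero, norm_zero]; · norm_num
      intro a ha
      have : (a : ℝ) ≤ U := le_trans (by exact_mod_cast (Finset.mem_Icc.mp ha).2) hMU
      simp [hα a this]
    rw [Finset.sum_congr rfl this]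
    simp only [Finset.sum_const_zero]
    positivity
  · push Not at hMU
    have h1 := large_sieve E c B (Finset.Icc 1 M) (fun i hi j hj hij => horth i hi j hj hij M) hB
      hnorm (fun a => ((α a * w a : ℝ) : ℂ))
    refine h1.trans ?_
    have h2 : ∑ l ∈ Finset.Icc 1 M, ‖((α l * w l : ℝ) : ℂ)‖ ^ 2 ≤ M * H := by
      refine le_trans (Finset.sum_le_sum fun a _ => ?_) (hms M (min_le_left _ _))
      rw [Complex.norm_real, Real.norm_eq_abs, sq_abs, mul_pow]
      have : w a ^ 2 ≤ 1 := pow_le_one₀ (hw0 a) (hw1 a)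
      nlinarith [sq_nonneg (α a)]
    have hc : ((Finset.Icc 1 M).card : ℝ) = M := by simp
    rw [hc]
    have h3 : (M : ℝ) + B * E.card ≤ 2 * M := by linarith
    calc _ ≤ (2 * M : ℝ) * (M * H) := by
          refine mul_le_mul h3 h2 (Finset.sum_nonneg fun _ _ => by positivity) (by positivity)
      _ = 2 * (M : ℝ)^2 * H := by ring
      _ ≤ _ := by gcongr

lemma typeII {κ : Type*} (E : Finset κ) (c : κ → ℕ → ℂ) (B : ℝ) (hB : 0 ≤ B)
    (horth : ∀ i ∈ E, ∀ j ∈ E, i ≠ j → ∀ M : ℕ, ‖∑ l ∈ Finset.Icc 1 M, c i l * conj (c j l)‖ ≤ B)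
    (hnorm : ∀ i l, ‖c i l‖ ≤ 1) (α β : ℕ → ℝ) (U : ℝ) (N : ℕ) (hN : 1 ≤ N) (H : ℝ) (hH : 0 ≤ H)
    (hα : ∀ a : ℕ, (a : ℝ) ≤ U → α a = 0) (hβ : ∀ a : ℕ, (a : ℝ) ≤ U → β a = 0)
    (hU : B * E.card ≤ U)
    (hmsα : ∀ M : ℕ, M ≤ N → ∑ a ∈ Finset.Icc 1 M, α a ^ 2 ≤ M * H)
    (hmsβ : ∀ M : ℕ, M ≤ N → ∑ a ∈ Finset.Icc 1 M, β a ^ 2 ≤ M * H)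
    (x : ℝ) (hx : 0 < x) :
    ∑ i ∈ E, ‖∑ a ∈ Finset.Icc 1 N, ∑ b ∈ Finset.Icc 1 N,
      ((α a * β b * tent (Real.log ((a * b : ℕ) / x)) : ℝ) : ℂ) * (c i a * c i b)‖ ≤
      6 * x * H * (Real.log N + 1) := by
  classical
  let wa : ℝ → ℕ → ℝ := fun v a => (Set.Ico (Real.log a - 1) (Real.log a)).indicator (fun _ => (1:ℝ)) v
  let wb : ℝ → ℕ → ℝ := fun v b => (Set.Ico ((Real.log x - Real.log b) - 1)
    (Real.log x - Real.log b)).indicator (fun _ => (1:ℝ)) v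
  let A : κ → ℝ → ℂ := fun i v => ∑ a ∈ Finset.Icc 1 N, ((α a * wa v a : ℝ) : ℂ) * c i a
  let Bf : κ → ℝ → ℂ := fun i v => ∑ b ∈ Finset.Icc 1 N, ((β b * wb v b : ℝ) : ℂ) * c i b
  have hint1 : ∀ a b : ℕ, MeasureTheory.Integrable (fun v => wa v a * wb v b) := by
    intro a b
    have h1 : MeasureTheory.Integrable (fun v => wa v a) := by
      refine (MeasureTheory.integrable_indicator_iff measurableSet_Ico).mpr ?_
      exact MeasureTheory.integrableOn_const (by simp) (by simp)
    refine h1.mul_bdd (c := 1) ?_ ?_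
    · refine Measurable.aestronglyMeasurable ?_
      exact measurable_const.indicator measurableSet_Ico
    · refine Filter.Eventually.of_forall fun v => ?_
      simp only [wb, Set.indicator]
      split_ifs <;> simp
  have hkey : ∀ a ∈ Finset.Icc 1 N, ∀ b ∈ Finset.Icc 1 N,
      ∫ v, wa v a * wb v b = tent (Real.log ((a * b : ℕ) / x)) := by
    intro a ha b hb
    rw [tent_integral]
    have ha' : (a : ℝ) ≠ 0 := by have := (Finset.mem_Icc.mp ha).1; positivity
    have hb' : (b : ℝ) ≠ 0 := by have := (Finset.mem_Icc.mp hb).1; positivity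
    congr 1
    push_cast
    rw [Real.log_div (mul_ne_zero ha' hb') hx.ne', Real.log_mul ha' hb']
    ring
  have hprod : ∀ i v, A i v * Bf i v = ∑ a ∈ Finset.Icc 1 N, ∑ b ∈ Finset.Icc 1 N,
      (((wa v a * wb v b : ℝ) : ℂ)) * ((α a * β b : ℝ) * (c i a * c i b)) := by
    intro i v
    simp only [A, Bf]
    rw [Finset.sum_mul_sum]
    refine Finset.sum_congr rfl fun a _ => Finset.sum_congr rfl fun b _ => ?_
    push_cast
    ring
  have hintc : ∀ i a b, MeasureTheory.Integrable (fun v : ℝ =>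
      (((wa v a * wb v b : ℝ) : ℂ)) * ((α a * β b : ℝ) * (c i a * c i b))) := by
    intro i a b
    exact (hint1 a b).ofReal.mul_const _
  have hAB : ∀ i, MeasureTheory.Integrable (fun v => A i v * Bf i v) := by
    intro i
    simp only [hprod]
    exact MeasureTheory.integrable_finsetSum _ fun a _ =>
      MeasureTheory.integrable_finsetSum _ fun b _ => hintc i a b
  have hI : ∀ i, ∑ a ∈ Finset.Icc 1 N, ∑ b ∈ Finset.Icc 1 N,
      ((α a * β b * tent (Real.log ((a * b : ℕ) / x)) : ℝ) : ℂ) * (c i a * c i b) =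
      ∫ v, A i v * Bf i v := by
    intro i
    simp only [hprod]
    rw [MeasureTheory.integral_finsetSum _ fun a _ =>
      MeasureTheory.integrable_finsetSum _ fun b _ => hintc i a b]
    refine Finset.sum_congr rfl fun a ha => ?_
    rw [MeasureTheory.integral_finsetSum _ fun b _ => hintc i a b]
    refine Finset.sum_congr rfl fun b hb => ?_
    rw [MeasureTheory.integral_mul_const, integral_complex_ofReal, hkey a ha b hb]
    push_cast
    ring
  have hpt : ∀ v, ∑ i ∈ E, ‖A i v * Bf i v‖ ≤
      (Set.Ico (-1) (Real.log N)).indicator (fun _ => 6 * x * H) v := by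
    intro v
    by_cases hv : v ∈ Set.Ico (-1) (Real.log N)
    · rw [Set.indicator_of_mem hv]
      have hw01 : ∀ (s : Set ℝ) , 0 ≤ s.indicator (fun _ => (1:ℝ)) v ∧
          s.indicator (fun _ => (1:ℝ)) v ≤ 1 := by
        intro s
        simp only [Set.indicator]
        split_ifs <;> simp
      have h1 := window_bound E c B hB horth hnorm α U N H hH hα hU hmsα (wa v)
        (fun a => (hw01 _).1) (fun a => (hw01 _).2) (Real.exp (v + 1)) (Real.exp_pos _).le (by
          intro a ha
          rcases Nat.eq_zero_or_pos a with h | h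
          · subst h; simp; positivity
          have := Set.mem_of_indicator_ne_zero ha
          have h2 : Real.log a ≤ v + 1 := by linarith [this.1]
          exact (Real.log_le_iff_le_exp (by exact_mod_cast h)).mp h2)
      have h2 := window_bound E c B hB horth hnorm β U N H hH hβ hU hmsβ (wb v)
        (fun a => (hw01 _).1) (fun a => (hw01 _).2) (Real.exp (Real.log x - v)) (Real.exp_pos _).le (by
          intro a ha
          rcases Nat.eq_zero_or_pos a with h | h
          · subst h; simp; positivity
          have := Set.mem_of_indicator_ne_zero ha
          have h2 : Real.log a ≤ Real.log x - v := by linarith [this.2]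
          exact (Real.log_le_iff_le_exp (by exact_mod_cast h)).mp h2)
      have h3 : (∑ i ∈ E, ‖A i v‖ * ‖Bf i v‖) ^ 2 ≤
          (2 * Real.exp (v + 1) ^ 2 * H) * (2 * Real.exp (Real.log x - v) ^ 2 * H) := by
        refine (Finset.sum_mul_sq_le_sq_mul_sq _ _ _).trans ?_
        exact mul_le_mul h1 h2 (Finset.sum_nonneg fun _ _ => by positivity) (by positivity)
      have h4 : (2 * Real.exp (v + 1) ^ 2 * H) * (2 * Real.exp (Real.log x - v) ^ 2 * H) =
          (2 * Real.exp 1 * x * H) ^ 2 := by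
        have : Real.exp (v + 1) * Real.exp (Real.log x - v) = Real.exp 1 * x := by
          rw [← Real.exp_add]
          have : v + 1 + (Real.log x - v) = 1 + Real.log x := by ring
          rw [this, Real.exp_add, Real.exp_log hx]
        calc _ = 4 * (Real.exp (v + 1) * Real.exp (Real.log x - v)) ^ 2 * H ^ 2 := by ring
          _ = _ := by rw [this]; ring
      rw [h4] at h3
      have h5 := (pow_le_pow_iff_left₀ (Finset.sum_nonneg fun _ _ => by positivity)
        (by positivity) two_ne_zero).mp h3
      simp only [norm_mul]
      refine h5.trans ?_
      have : Real.exp 1 ≤ 3 := by linarith [Real.exp_one_lt_d9]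
      have h6 : 2 * Real.exp 1 ≤ 6 := by linarith
      gcongr
    · rw [Set.indicator_of_notMem hv]
      apply le_of_eq
      refine Finset.sum_eq_zero fun i _ => ?_
      have : A i v = 0 := by
        refine Finset.sum_eq_zero fun a ha => ?_
        have ha1 := Finset.mem_Icc.mp ha
        have : wa v a = 0 := by
          refine Set.indicator_of_notMem (fun hmem => hv ⟨?_, ?_⟩) _
          · have := hmem.1
            have : 0 ≤ Real.log a := Real.log_natCast_nonneg a
            linarith [hmem.1]
          · refine lt_of_lt_of_le hmem.2 (Real.log_le_log (by exact_mod_cast ha1.1) ?_)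
            exact_mod_cast ha1.2
        simp [this]
      simp [this]
  simp only [hI]
  calc ∑ i ∈ E, ‖∫ v, A i v * Bf i v‖ ≤ ∑ i ∈ E, ∫ v, ‖A i v * Bf i v‖ :=
        Finset.sum_le_sum fun i _ => MeasureTheory.norm_integral_le_integral_norm _
    _ = ∫ v, ∑ i ∈ E, ‖A i v * Bf i v‖ :=
        (MeasureTheory.integral_finsetSum _ fun i _ => (hAB i).norm).symm
    _ ≤ ∫ v, (Set.Ico (-1) (Real.log N)).indicator (fun _ => 6 * x * H) v := by
        refine MeasureTheory.integral_mono ?_ ?_ hpt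
        · exact MeasureTheory.integrable_finsetSum _ fun i _ => (hAB i).norm
        · refine (MeasureTheory.integrable_indicator_iff measurableSet_Ico).mpr ?_
          exact MeasureTheory.integrableOn_const (by simp) enorm_ne_top
    _ = 6 * x * H * (Real.log N + 1) := by
        rw [MeasureTheory.integral_indicator measurableSet_Ico]
        simp only [MeasureTheory.integral_const, smul_eq_mul]
        rw [MeasureTheory.measureReal_restrict_apply_univ, Real.volume_real_Ico, max_eq_left]
        · ring
        · have := Real.log_natCast_nonneg N
          linarith

end

section

open scoped ComplexConjugate

structure ArithData (n : ℕ) (r mu La : ArithmeticFunction ℝ) : Prop where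
  r_le : ∀ l, r l ≤ (l.divisors.card : ℝ) ^ n
  mu_le : ∀ l, |mu l| ≤ r l
  r_one : r 1 = 1
  mu_mul : mu * r = 1
  r_mul : ∀ l, (r * La) l = r l * Real.log l
  La_nonneg : ∀ l, 0 ≤ La l
  La_pp : ∀ l, La l ≠ 0 → IsPrimePow l

lemma sum_divisorsAntidiagonal_Icc {R : Type*} [AddCommMonoid R] (h : ℕ → ℕ → R) (N : ℕ) :
    ∑ l ∈ Finset.Icc 1 N, ∑ p ∈ l.divisorsAntidiagonal, h p.1 p.2 =
    ∑ a ∈ Finset.Icc 1 N, ∑ b ∈ Finset.Icc 1 N, if a * b ≤ N then h a b else 0 := by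
  rw [← Finset.sum_product' (f := fun a b => if a * b ≤ N then h a b else 0)]
  trans ∑ n ∈ Finset.Icc 1 N, ∑ x ∈ Finset.Icc 1 N ×ˢ Finset.Icc 1 N with x.1 * x.2 = n, h x.1 x.2
  · refine Finset.sum_congr rfl fun n hn ↦ ?_
    simp only [Finset.mem_Icc] at hn
    refine Finset.sum_congr ?_ fun _ _ => rfl
    ext ⟨a, b⟩
    simp only [Nat.mem_divisorsAntidiagonal, Finset.mem_filter, Finset.mem_product, Finset.mem_Icc]
    constructor
    · rintro ⟨rfl, h0⟩
      have ha : a ≠ 0 := left_ne_zero_of_mul h0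
      have hb : b ≠ 0 := right_ne_zero_of_mul h0
      refine ⟨⟨⟨by omega, ?_⟩, ⟨by omega, ?_⟩⟩, rfl⟩
      · exact (Nat.le_mul_of_pos_right a (by omega)).trans hn.2
      · exact (Nat.le_mul_of_pos_left b (by omega)).trans hn.2
    · rintro ⟨_, rfl⟩
      exact ⟨rfl, by omega⟩
  · simp_rw [Finset.sum_filter]
    rw [Finset.sum_comm]
    refine Finset.sum_congr rfl fun x hx => ?_
    rw [Finset.sum_ite_eq]
    simp only [Finset.mem_product, Finset.mem_Icc] at hx ⊢
    have : 1 ≤ x.1 * x.2 := Nat.mul_pos hx.1.1 hx.2.1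
    simp [this]

lemma tau_mul_le (a b : ℕ) : (a * b).divisors.card ≤ a.divisors.card * b.divisors.card := by
  rw [Nat.divisors_mul]
  exact Finset.card_mul_le

lemma tau_moment (k N : ℕ) :
    ∑ l ∈ Finset.Icc 1 N, ((l.divisors.card : ℝ) ^ k / l) ≤ (1 + Real.log N) ^ (2 ^ k) := by
  induction k with
  | zero =>
    have := harmonic_le_one_add_log N
    rw [harmonic_eq_sum_Icc] at this
    simp only [pow_zero, pow_one]
    refine le_trans (le_of_eq ?_) this
    push_cast
    simp
  | succ k ih =>
    have hnn : 0 ≤ ∑ l ∈ Finset.Icc 1 N, ((l.divisors.card : ℝ) ^ k / l) :=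
      Finset.sum_nonneg fun _ _ => by positivity
    calc ∑ l ∈ Finset.Icc 1 N, ((l.divisors.card : ℝ) ^ (k+1) / l)
        = ∑ l ∈ Finset.Icc 1 N, ∑ p ∈ l.divisorsAntidiagonal,
          (((p.1 * p.2).divisors.card : ℝ) ^ k / ((p.1 * p.2 : ℕ) : ℝ)) := by
          refine Finset.sum_congr rfl fun l _ => ?_
          rw [Finset.sum_congr rfl (g := fun _ => ((l.divisors.card : ℝ) ^ k / l))]
          · rw [Finset.sum_const, nsmul_eq_mul]
            have : l.divisorsAntidiagonal.card = l.divisors.card := by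
              rw [← Nat.map_div_right_divisors, Finset.card_map]
            rw [this]
            ring
          · intro p hp
            rw [(Nat.mem_divisorsAntidiagonal.mp hp).1]
      _ = _ := sum_divisorsAntidiagonal_Icc
          (fun a b => ((a * b).divisors.card : ℝ) ^ k / ((a * b : ℕ) : ℝ)) N
      _ ≤ ∑ a ∈ Finset.Icc 1 N, ∑ b ∈ Finset.Icc 1 N,
          ((a.divisors.card : ℝ) ^ k / a) * ((b.divisors.card : ℝ) ^ k / b) := by
          refine Finset.sum_le_sum fun a _ => Finset.sum_le_sum fun b _ => ?_
          split_ifs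
          · rw [div_mul_div_comm, ← mul_pow]
            push_cast
            gcongr
            exact_mod_cast tau_mul_le a b
          · positivity
      _ = (∑ l ∈ Finset.Icc 1 N, ((l.divisors.card : ℝ) ^ k / l)) ^ 2 := by
          rw [sq, Finset.sum_mul_sum]
      _ ≤ ((1 + Real.log N) ^ (2 ^ k)) ^ 2 := by gcongr
      _ = _ := by rw [← pow_mul, pow_succ 2 k]


lemma ArithData.r_nonneg {n : ℕ} {r mu La : ArithmeticFunction ℝ} (D : ArithData n r mu La)
    (l : ℕ) : 0 ≤ r l := (abs_nonneg _).trans (D.mu_le l)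

lemma ArithData.La_le {n : ℕ} {r mu La : ArithmeticFunction ℝ} (D : ArithData n r mu La)
    (l : ℕ) : La l ≤ r l * Real.log l := by
  rcases Nat.eq_zero_or_pos l with h | h
  · subst h; simp
  rw [← D.r_mul, ArithmeticFunction.mul_apply]
  have := Finset.single_le_sum (f := fun p : ℕ × ℕ => r p.1 * La p.2)
    (s := l.divisorsAntidiagonal) (fun p _ => mul_nonneg (D.r_nonneg _) (D.La_nonneg _))
    (a := (1, l)) (by simp; omega)
  simpa [D.r_one] using this

lemma ArithData.meansq {n : ℕ} {r mu La : ArithmeticFunction ℝ} (D : ArithData n r mu La)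
    (M : ℕ) : ∑ a ∈ Finset.Icc 1 M, r a ^ 2 ≤ M * (1 + Real.log M) ^ (2 ^ (2 * n)) := by
  calc ∑ a ∈ Finset.Icc 1 M, r a ^ 2 ≤
      ∑ a ∈ Finset.Icc 1 M, M * ((a.divisors.card : ℝ) ^ (2 * n) / a) := by
        refine Finset.sum_le_sum fun a ha => ?_
        rw [Finset.mem_Icc] at ha
        have h1 : r a ^ 2 ≤ (a.divisors.card : ℝ) ^ (2 * n) := by
          rw [mul_comm 2 n, pow_mul]
          have := D.r_nonneg a
          gcongr
          exact D.r_le a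
        refine h1.trans ?_
        have ha0 : (0:ℝ) < a := by exact_mod_cast ha.1
        rw [mul_div_assoc', le_div_iff₀ ha0, mul_comm]
        gcongr
        exact ha.2
    _ ≤ _ := by
        rw [← Finset.mul_sum]
        gcongr
        exact tau_moment _ _

end

section

open scoped ComplexConjugate

def NiceG (G : ℝ → ℝ) : Prop :=
  (∀ t, |G t| ≤ 1) ∧ (∀ s t, |G s - G t| ≤ |s - t|) ∧ ∀ t, 1 ≤ |t| → G t = 0

lemma niceG_tent : NiceG tent :=
  ⟨fun t => by rw [abs_of_nonneg (tent_nonneg t)]; exact tent_le_one t, tent_lip,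
    fun _ h => tent_eq_zero h⟩

lemma tent_mul_lip_aux {s t : ℝ} (h : t ≤ s) : |s * tent s - t * tent t| ≤ s - t := by
  unfold tent
  rw [abs_le]
  rcases le_total 0 s with hs | hs <;> rcases le_total 0 t with ht | ht <;>
  [rw [abs_of_nonneg hs, abs_of_nonneg ht]; rw [abs_of_nonneg hs, abs_of_nonpos ht];
   rw [abs_of_nonpos hs, abs_of_nonneg ht]; rw [abs_of_nonpos hs, abs_of_nonpos ht]] <;>
  [rcases le_total (1 - s) 0 with h1 | h1; rcases le_total (1 - s) 0 with h1 | h1;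
   rcases le_total (1 - -s) 0 with h1 | h1; rcases le_total (1 - -s) 0 with h1 | h1] <;>
  [rcases le_total (1 - t) 0 with h2 | h2; rcases le_total (1 - t) 0 with h2 | h2;
   rcases le_total (1 - -t) 0 with h2 | h2; rcases le_total (1 - -t) 0 with h2 | h2;
   rcases le_total (1 - t) 0 with h2 | h2; rcases le_total (1 - t) 0 with h2 | h2;
   rcases le_total (1 - -t) 0 with h2 | h2; rcases le_total (1 - -t) 0 with h2 | h2] <;>
  simp only [max_eq_left h1, max_eq_right h1, max_eq_left h2, max_eq_right h2] <;>
  constructor <;> nlinarith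

lemma niceG_mul_tent : NiceG (fun t => t * tent t) := by
  refine ⟨fun t => ?_, fun s t => ?_, fun t h => by simp [tent_eq_zero h]⟩
  · by_cases h : tent t = 0
    · simp [h]
    · rw [abs_mul, abs_of_nonneg (tent_nonneg t)]
      exact mul_le_one₀ (tent_pos h).le (tent_nonneg t) (tent_le_one t)
  · rcases le_total t s with h | h
    · rw [abs_of_nonneg (sub_nonneg.mpr h)]; exact tent_mul_lip_aux h
    · rw [abs_sub_comm, abs_sub_comm s, abs_of_nonneg (sub_nonneg.mpr h)]; exact tent_mul_lip_aux h

/-- low part -/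
noncomputable def loPart (U : ℕ) (f : ArithmeticFunction ℝ) : ArithmeticFunction ℝ :=
  ⟨fun l => if l ≤ U then f l else 0, by simp⟩

lemma loPart_apply (U : ℕ) (f : ArithmeticFunction ℝ) (l : ℕ) :
    loPart U f l = if l ≤ U then f l else 0 := rfl

noncomputable def rlog (r : ArithmeticFunction ℝ) : ArithmeticFunction ℝ :=
  ⟨fun l => r l * Real.log l, by simp⟩

lemma vaughan_identity {n : ℕ} {r mu La : ArithmeticFunction ℝ} (D : ArithData n r mu La) (U : ℕ) :
    La = loPart U La + loPart U mu * rlog r - loPart U mu * (loPart U La * r)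
      + (mu - loPart U mu) * (r * (La - loPart U La)) := by
  have h1 : r * La = rlog r := by
    ext l
    exact D.r_mul l
  have h2 : mu * (r * (La - loPart U La)) = La - loPart U La := by
    rw [← mul_assoc, D.mu_mul, one_mul]
  rw [sub_mul, h2, mul_sub r, h1, mul_sub, mul_comm r]
  abel

/-- sum with convolution -/
lemma conv_sum (f g : ArithmeticFunction ℝ) (c : ℕ → ℂ) (hmul : ∀ a b, c (a * b) = c a * c b)
    (x : ℝ) (hx : 0 < x) (N : ℕ) (hN : Real.exp 1 * x ≤ N) :
    ∑ l ∈ Finset.Icc 1 N, (((f * g) l * tent (Real.log (l / x)) : ℝ) : ℂ) * c l =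
    ∑ a ∈ Finset.Icc 1 N, ∑ b ∈ Finset.Icc 1 N,
      ((f a * g b * tent (Real.log ((a * b : ℕ) / x)) : ℝ) : ℂ) * (c a * c b) := by
  have h := sum_divisorsAntidiagonal_Icc (fun a b =>
    ((f a * g b * tent (Real.log ((a * b : ℕ) / x)) : ℝ) : ℂ) * (c a * c b)) N
  calc _ = ∑ l ∈ Finset.Icc 1 N, ∑ p ∈ l.divisorsAntidiagonal,
        ((f p.1 * g p.2 * tent (Real.log ((p.1 * p.2 : ℕ) / x)) : ℝ) : ℂ) * (c p.1 * c p.2) := by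
        refine Finset.sum_congr rfl fun l _ => ?_
        rw [ArithmeticFunction.mul_apply, Finset.sum_mul]
        push_cast
        rw [Finset.sum_mul]
        refine Finset.sum_congr rfl fun p hp => ?_
        rw [← hmul]
        have := (Nat.mem_divisorsAntidiagonal.mp hp).1
        rw [this, ← this]
        push_cast
        ring
    _ = _ := h
    _ = _ := by
        refine Finset.sum_congr rfl fun a ha => Finset.sum_congr rfl fun b hb => ?_
        split_ifs with hab
        · rfl
        · have : tent (Real.log ((a * b : ℕ) / x)) = 0 := by
            apply tent_eq_zero
            refine le_trans ?_ (le_abs_self _)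
            push Not at hab
            have h2 : Real.exp 1 * x ≤ (a * b : ℕ) := hN.trans (by exact_mod_cast hab.le)
            rw [Real.le_log_iff_exp_le, le_div_iff₀ hx]
            · exact h2
            · refine div_pos (lt_of_lt_of_le ?_ h2) hx
              positivity
          rw [this]; simp

def TypeIBound (n : ℕ) (r : ArithmeticFunction ℝ) (c : ℕ → ℂ) (K : ℝ) : Prop :=
  ∀ G, NiceG G → ∀ X : ℝ, 1 ≤ X → ∀ N : ℕ, Real.exp 1 * X ≤ N →
    ‖∑ l ∈ Finset.Icc 1 N, ((r l * G (Real.log (l / X)) : ℝ) : ℂ) * c l‖ ≤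
      K * X ^ (1 - 1 / (n : ℝ))

end

section

open scoped ComplexConjugate

lemma conv_typeI_bound (f g : ArithmeticFunction ℝ) (c : ℕ → ℂ)
    (hmul : ∀ a b, c (a * b) = c a * c b) (hnorm : ∀ l, ‖c l‖ ≤ 1)
    (x : ℝ) (hx : 0 < x) (N : ℕ) (hN : Real.exp 1 * x ≤ N) (W : ℕ) (F J : ℝ) (hF : 0 ≤ F) (hJ : 0 ≤ J)
    (hf : ∀ a, |f a| ≤ F) (hf0 : ∀ a, W < a → f a = 0)
    (hg : ∀ a ∈ Finset.Icc 1 W,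
      ‖∑ b ∈ Finset.Icc 1 N, ((g b * tent (Real.log ((a * b : ℕ) / x)) : ℝ) : ℂ) * c b‖ ≤ J) :
    ‖∑ l ∈ Finset.Icc 1 N, (((f * g) l * tent (Real.log (l / x)) : ℝ) : ℂ) * c l‖ ≤ W * F * J := by
  rw [conv_sum f g c hmul x hx N hN]
  have h1 : ∀ a ∈ Finset.Icc 1 N, ‖∑ b ∈ Finset.Icc 1 N,
      ((f a * g b * tent (Real.log ((a * b : ℕ) / x)) : ℝ) : ℂ) * (c a * c b)‖ ≤
      if a ∈ Finset.Icc 1 W then F * J else 0 := by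
    intro a ha
    have e : ∑ b ∈ Finset.Icc 1 N,
      ((f a * g b * tent (Real.log ((a * b : ℕ) / x)) : ℝ) : ℂ) * (c a * c b) =
      (f a : ℂ) * c a *
        ∑ b ∈ Finset.Icc 1 N, ((g b * tent (Real.log ((a * b : ℕ) / x)) : ℝ) : ℂ) * c b := by
      rw [Finset.mul_sum]
      refine Finset.sum_congr rfl fun b _ => ?_
      push_cast
      ring
    rw [e]
    split_ifs with h
    · rw [norm_mul, norm_mul, Complex.norm_real, Real.norm_eq_abs]
      refine mul_le_mul ?_ (hg a h) (norm_nonneg _) hF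
      calc |f a| * ‖c a‖ ≤ F * 1 := by
            refine mul_le_mul (hf a) (hnorm a) (norm_nonneg _) hF
        _ = F := mul_one F
    · rw [hf0 a]
      · simp
      · simp only [Finset.mem_Icc, not_and, not_le] at h ha
        exact h ha.1
  refine (norm_sum_le _ _).trans ((Finset.sum_le_sum h1).trans ?_)
  rw [← Finset.sum_filter, Finset.sum_const, nsmul_eq_mul, mul_assoc]
  have hc : ((Finset.Icc 1 N).filter (· ∈ Finset.Icc 1 W)).card ≤ W := by
    refine (Finset.card_le_card (t := Finset.Icc 1 W) ?_).trans (by simp)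
    intro a ha
    exact (Finset.mem_filter.mp ha).2
  have : (((Finset.Icc 1 N).filter (· ∈ Finset.Icc 1 W)).card : ℝ) ≤ W := by exact_mod_cast hc
  exact mul_le_mul_of_nonneg_right this (by positivity)

lemma ArithData.r_le_pow {n : ℕ} {r mu La : ArithmeticFunction ℝ} (D : ArithData n r mu La)
    (l : ℕ) : r l ≤ (l : ℝ) ^ n := by
  refine (D.r_le l).trans ?_
  gcongr
  exact_mod_cast Nat.card_divisors_le_self l

lemma typeI_inner {n : ℕ} (hn : 1 ≤ n) {r mu La : ArithmeticFunction ℝ}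
    (_D : ArithData n r mu La) (c : ℕ → ℂ)
    (K : ℝ) (hK : 0 ≤ K) (hI : TypeIBound n r c K) (x : ℝ) (hx : 1 ≤ x) (N : ℕ)
    (hN : Real.exp 1 * x ≤ N) (a : ℕ) (ha : 1 ≤ a) (hax : (a : ℝ) ≤ x) :
    ‖∑ b ∈ Finset.Icc 1 N, ((r b * tent (Real.log ((a * b : ℕ) / x)) : ℝ) : ℂ) * c b‖
      ≤ K * x ^ (1 - 1 / (n : ℝ)) ∧
    ‖∑ b ∈ Finset.Icc 1 N, ((rlog r b * tent (Real.log ((a * b : ℕ) / x)) : ℝ) : ℂ) * c b‖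
      ≤ (Real.log x + 1) * (K * x ^ (1 - 1 / (n : ℝ))) := by
  have ha0 : (0:ℝ) < a := by exact_mod_cast ha
  have ha1 : (1:ℝ) ≤ a := by exact_mod_cast ha
  have hx0 : 0 < x := by linarith
  set X : ℝ := x / a with hX
  have hX1 : 1 ≤ X := by rw [hX, le_div_iff₀ ha0]; linarith
  have hXx : X ≤ x := div_le_self hx0.le ha1
  have hNX : Real.exp 1 * X ≤ N := le_trans (by gcongr) hN
  have harg : ∀ b : ℕ, ((a * b : ℕ) : ℝ) / x = b / X := by
    intro b
    rw [hX]
    push_cast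
    field_simp
  have hexp : 0 ≤ 1 - 1 / (n : ℝ) := by
    have : (1:ℝ) ≤ n := by exact_mod_cast hn
    have : 1 / (n:ℝ) ≤ 1 := by rw [div_le_one (by linarith)]; exact this
    linarith
  have hpow : X ^ (1 - 1 / (n : ℝ)) ≤ x ^ (1 - 1 / (n : ℝ)) :=
    Real.rpow_le_rpow (by linarith) hXx hexp
  have h1 := hI tent niceG_tent X hX1 N hNX
  have h2 := hI _ niceG_mul_tent X hX1 N hNX
  have hJ : K * X ^ (1 - 1 / (n : ℝ)) ≤ K * x ^ (1 - 1 / (n : ℝ)) := by gcongr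
  refine ⟨?_, ?_⟩
  · simp only [harg]
    exact h1.trans hJ
  · simp only [harg]
    have e : ∑ b ∈ Finset.Icc 1 N, ((rlog r b * tent (Real.log (b / X)) : ℝ) : ℂ) * c b =
        (Real.log X : ℂ) * ∑ b ∈ Finset.Icc 1 N, ((r b * tent (Real.log (b / X)) : ℝ) : ℂ) * c b +
        ∑ b ∈ Finset.Icc 1 N,
          ((r b * (Real.log (b / X) * tent (Real.log (b / X))) : ℝ) : ℂ) * c b := by
      rw [Finset.mul_sum, ← Finset.sum_add_distrib]
      refine Finset.sum_congr rfl fun b hb => ?_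
      have hb0 : (b:ℝ) ≠ 0 := by have := (Finset.mem_Icc.mp hb).1; positivity
      have : rlog r b = r b * Real.log b := rfl
      rw [this]
      have h3 : Real.log b = Real.log X + Real.log (b / X) := by
        rw [Real.log_div hb0 (by linarith)]; ring
      conv_lhs => rw [h3]
      push_cast
      ring
    rw [e]
    refine (norm_add_le _ _).trans ?_
    rw [norm_mul, Complex.norm_real, Real.norm_of_nonneg (Real.log_nonneg hX1), add_mul, one_mul]
    refine add_le_add ?_ (h2.trans hJ)
    have : Real.log X ≤ Real.log x := Real.log_le_log (by linarith) hXx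
    exact mul_le_mul this (h1.trans hJ) (norm_nonneg _) (Real.log_nonneg hx)

lemma vaughan_single {n : ℕ} (hn : 1 ≤ n) {r mu La : ArithmeticFunction ℝ}
    (D : ArithData n r mu La) (c : ℕ → ℂ)
    (hmul : ∀ a b, c (a * b) = c a * c b) (hnorm : ∀ l, ‖c l‖ ≤ 1)
    (K : ℝ) (hK : 0 ≤ K) (hI : TypeIBound n r c K) (U : ℕ) (hU : 1 ≤ U)
    (x : ℝ) (hx : 1 ≤ x) (hUx : (U:ℝ)^2 ≤ x) (heU : Real.exp 1 * U ≤ x) (N : ℕ)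
    (hN : Real.exp 1 * x ≤ N) :
    ‖∑ l ∈ Finset.Icc 1 N, ((La l * tent (Real.log (l / x)) : ℝ) : ℂ) * c l‖ ≤
      K * x ^ (1 - 1 / (n : ℝ)) * U ^ (2 * n + 4) * (Real.log x + 2) +
      ‖∑ a ∈ Finset.Icc 1 N, ∑ b ∈ Finset.Icc 1 N,
        (((mu - loPart U mu) a * (r * (La - loPart U La)) b *
          tent (Real.log ((a * b : ℕ) / x)) : ℝ) : ℂ) * (c a * c b)‖ := by
  have hx0 : 0 < x := by linarith
  set J : ℝ := K * x ^ (1 - 1 / (n : ℝ)) with hJdef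
  have hJ : 0 ≤ J := by positivity
  have hlog : 0 ≤ Real.log x := Real.log_nonneg hx
  have hU1 : (1:ℝ) ≤ U := by exact_mod_cast hU
  set S : ArithmeticFunction ℝ → ℂ := fun f =>
    ∑ l ∈ Finset.Icc 1 N, ((f l * tent (Real.log (l / x)) : ℝ) : ℂ) * c l with hS
  have hadd : ∀ f g, S (f + g) = S f + S g := by
    intro f g
    simp only [hS]
    rw [← Finset.sum_add_distrib]
    refine Finset.sum_congr rfl fun l _ => ?_
    rw [ArithmeticFunction.add_apply]
    push_cast
    ring
  have hsub : ∀ f g, S (f - g) = S f - S g := by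
    intro f g
    rw [eq_sub_iff_add_eq, ← hadd, sub_add_cancel]
  have h0 : S (loPart U La) = 0 := by
    refine Finset.sum_eq_zero fun l hl => ?_
    rw [loPart_apply]
    split_ifs with h
    · have hl1 : (0:ℝ) < l := by exact_mod_cast (Finset.mem_Icc.mp hl).1
      have : tent (Real.log (l / x)) = 0 := by
        apply tent_eq_zero
        refine le_trans ?_ (neg_le_abs _)
        rw [le_neg, Real.log_le_iff_le_exp (by positivity), div_le_iff₀ hx0, Real.exp_neg]
        rw [inv_mul_eq_div, le_div_iff₀ (Real.exp_pos 1), mul_comm]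
        refine le_trans ?_ heU
        have : (l:ℝ) ≤ U := by exact_mod_cast h
        gcongr
      simp [this]
    · simp
  have hmuF : ∀ a, |loPart U mu a| ≤ (U:ℝ)^n := by
    intro a
    rw [loPart_apply]
    split_ifs with h
    · refine (D.mu_le a).trans ((D.r_le_pow a).trans ?_)
      gcongr
    · simp
  have h2 : ‖S (loPart U mu * rlog r)‖ ≤ U * U ^ n * ((Real.log x + 1) * J) := by
    refine conv_typeI_bound _ _ c hmul hnorm x hx0 N hN U _ _ (by positivity) (by positivity) hmuF
      (fun a ha => by rw [loPart_apply, if_neg (by omega)]) fun a ha => ?_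
    rw [Finset.mem_Icc] at ha
    have hax : (a:ℝ) ≤ x := by
      have : (a:ℝ) ≤ U := by exact_mod_cast ha.2
      nlinarith
    exact (typeI_inner hn D c K hK hI x hx N hN a ha.1 hax).2
  have h3 : ‖S (loPart U mu * (loPart U La * r))‖ ≤ (U ^ 2 : ℕ) * U ^ (2 * n + 2) * J := by
    rw [← mul_assoc]
    have hLa0 : ∀ b, 0 ≤ loPart U La b ∧ loPart U La b ≤ La b := by
      intro b
      rw [loPart_apply]
      split_ifs
      · exact ⟨D.La_nonneg b, le_rfl⟩
      · exact ⟨le_rfl, D.La_nonneg b⟩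
    have hz : ∀ a, U ^ 2 < a → (loPart U mu * loPart U La) a = 0 := by
      intro a ha
      rw [ArithmeticFunction.mul_apply]
      refine Finset.sum_eq_zero fun p hp => ?_
      have hp1 := (Nat.mem_divisorsAntidiagonal.mp hp).1
      rw [loPart_apply, loPart_apply]
      split_ifs with h4 h5 <;> simp
      exfalso
      have : p.1 * p.2 ≤ U * U := Nat.mul_le_mul h4 h5
      nlinarith
    refine conv_typeI_bound _ _ c hmul hnorm x hx0 N hN (U ^ 2) _ _ (by positivity) hJ ?_ hz ?_
    · intro a
      by_cases haU : U ^ 2 < a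
      · rw [hz a haU]; simp
      · push Not at haU
        have haU' : (a:ℝ) ≤ U ^ 2 := by exact_mod_cast haU
        have e1 : |(loPart U mu * loPart U La) a| ≤ (r * La) a := by
          rw [ArithmeticFunction.mul_apply, ArithmeticFunction.mul_apply]
          refine (Finset.abs_sum_le_sum_abs _ _).trans (Finset.sum_le_sum fun p _ => ?_)
          rw [abs_mul, abs_of_nonneg (hLa0 p.2).1]
          refine mul_le_mul ?_ (hLa0 p.2).2 (hLa0 p.2).1 (D.r_nonneg _)
          rw [loPart_apply]
          split_ifs
          · exact D.mu_le _
          · simpa using D.r_nonneg _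
        rw [D.r_mul] at e1
        refine e1.trans ?_
        calc r a * Real.log a ≤ (a:ℝ)^n * a := by
              refine mul_le_mul (D.r_le_pow a) ?_ (Real.log_natCast_nonneg a) (by positivity)
              exact Real.log_le_self (by positivity)
          _ = (a:ℝ)^(n+1) := by ring
          _ ≤ ((U:ℝ)^2)^(n+1) := by gcongr
          _ = _ := by rw [← pow_mul]; congr 1; 
    · intro a ha
      rw [Finset.mem_Icc] at ha
      have hax : (a:ℝ) ≤ x := le_trans (by exact_mod_cast ha.2) hUx
      exact (typeI_inner hn D c K hK hI x hx N hN a ha.1 hax).1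
  have hid : S La = S (loPart U mu * rlog r) - S (loPart U mu * (loPart U La * r)) +
      S ((mu - loPart U mu) * (r * (La - loPart U La))) := by
    conv_lhs => rw [vaughan_identity D U]
    rw [hadd, hsub, hadd, h0, zero_add]
  have h4 : S ((mu - loPart U mu) * (r * (La - loPart U La))) =
    ∑ a ∈ Finset.Icc 1 N, ∑ b ∈ Finset.Icc 1 N,
        (((mu - loPart U mu) a * (r * (La - loPart U La)) b *
          tent (Real.log ((a * b : ℕ) / x)) : ℝ) : ℂ) * (c a * c b) :=
    conv_sum _ _ c hmul x hx0 N hN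
  change ‖S La‖ ≤ _
  rw [← h4, hid]
  refine (norm_add_le _ _).trans (add_le_add_left ((norm_sub_le _ _).trans ?_) _)
  refine (add_le_add h2 h3).trans ?_
  have e5 : (U:ℝ) * U ^ n ≤ U ^ (2 * n + 4) := by
    rw [← pow_succ']
    exact pow_le_pow_right₀ hU1 (by omega)
  have e6 : ((U ^ 2 : ℕ) : ℝ) * U ^ (2 * n + 2) = U ^ (2 * n + 4) := by
    push_cast; rw [← pow_add]; congr 1; omega
  rw [e6]
  calc _ ≤ (U:ℝ) ^ (2 * n + 4) * ((Real.log x + 1) * J) + U ^ (2 * n + 4) * J := by gcongr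
    _ = _ := by ring

lemma sub_loPart_apply (U : ℕ) (f : ArithmeticFunction ℝ) (l : ℕ) :
    (f - loPart U f) l = if l ≤ U then 0 else f l := by
  rw [sub_eq_add_neg, ArithmeticFunction.add_apply, ArithmeticFunction.neg_apply, loPart_apply]
  split_ifs <;> simp

lemma vaughan_bound {n : ℕ} (hn : 1 ≤ n) {r mu La : ArithmeticFunction ℝ}
    (D : ArithData n r mu La) {κ : Type*} (E : Finset κ) (c : κ → ℕ → ℂ)
    (hmul : ∀ i a b, c i (a * b) = c i a * c i b) (hnorm : ∀ i l, ‖c i l‖ ≤ 1)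
    (K : ℝ) (hK : 0 ≤ K) (hI : ∀ i ∈ E, TypeIBound n r (c i) K) (U : ℕ) (hU : 1 ≤ U)
    (B : ℝ) (hB : 0 ≤ B)
    (horth : ∀ i ∈ E, ∀ j ∈ E, i ≠ j → ∀ M : ℕ, ‖∑ l ∈ Finset.Icc 1 M, c i l * conj (c j l)‖ ≤ B)
    (hBU : B * E.card ≤ U)
    (x : ℝ) (hx : 1 ≤ x) (hUx : (U:ℝ)^2 ≤ x) (heU : Real.exp 1 * U ≤ x) (N : ℕ)
    (hN : Real.exp 1 * x ≤ N) :
    ∑ i ∈ E, ‖∑ l ∈ Finset.Icc 1 N, ((La l * tent (Real.log (l / x)) : ℝ) : ℂ) * c i l‖ ≤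
      E.card * (K * x ^ (1 - 1 / (n : ℝ)) * U ^ (2 * n + 4) * (Real.log x + 2)) +
      6 * x * (1 + Real.log N) ^ (2 ^ (2 * n) + 3) := by
  have hx0 : 0 < x := by linarith
  have hlogN : 0 ≤ Real.log N := Real.log_natCast_nonneg N
  have hNpos : 1 ≤ N := by
    have : (0:ℝ) < N := lt_of_lt_of_le (by positivity) hN
    exact_mod_cast this
  set H : ℝ := (1 + Real.log N) ^ (2 ^ (2 * n) + 2) with hH
  have hH0 : 0 ≤ H := by positivity
  have hmono : ∀ M : ℕ, M ≤ N → Real.log M ≤ Real.log N := by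
    intro M hM
    rcases Nat.eq_zero_or_pos M with h | h
    · subst h; simpa using hlogN
    · exact Real.log_le_log (by exact_mod_cast h) (by exact_mod_cast hM)
  have hms : ∀ M : ℕ, M ≤ N → (∑ a ∈ Finset.Icc 1 M, r a ^ 2) * (1 + Real.log N) ^ 2 ≤ M * H := by
    intro M hM
    have h1 := D.meansq M
    have h2 : (1 + Real.log M) ^ (2 ^ (2 * n)) ≤ (1 + Real.log N) ^ (2 ^ (2 * n)) := by
      have := hmono M hM
      have := Real.log_natCast_nonneg M
      gcongr
    calc _ ≤ (M * (1 + Real.log N) ^ (2 ^ (2 * n))) * (1 + Real.log N) ^ 2 := by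
          gcongr
          exact h1.trans (by gcongr)
      _ = _ := by rw [hH, pow_add]; ring
  have h2 := typeII E c B hB horth hnorm (fun a => (mu - loPart U mu) a)
    (fun b => (r * (La - loPart U La)) b) U N hNpos H hH0 ?_ ?_ hBU ?_ ?_ x hx0
  · refine (Finset.sum_le_sum fun i hi => vaughan_single hn D (c i) (hmul i) (hnorm i) K hK (hI i hi)
      U hU x hx hUx heU N hN).trans ?_
    rw [Finset.sum_add_distrib, Finset.sum_const, nsmul_eq_mul]
    gcongr
    refine h2.trans (le_of_eq ?_)
    rw [hH]; ring
  · intro a ha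
    have ha' : a ≤ U := by exact_mod_cast ha
    simp [sub_loPart_apply, ha']
  · intro b hb
    have hb' : b ≤ U := by exact_mod_cast hb
    rcases Nat.eq_zero_or_pos b with h | h
    · subst h; simp
    simp only [ArithmeticFunction.mul_apply]
    refine Finset.sum_eq_zero fun p hp => ?_
    have : p.2 ≤ b := Nat.le_of_dvd h (Dvd.intro_left _ (Nat.mem_divisorsAntidiagonal.mp hp).1)
    simp [sub_loPart_apply, this.trans hb']
  · intro M hM
    refine le_trans ?_ (hms M hM)
    rw [Finset.sum_mul]
    refine Finset.sum_le_sum fun a _ => ?_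
    have h1 : |(mu - loPart U mu) a| ≤ r a := by
      simp only [sub_loPart_apply]
      split_ifs
      · simpa using D.r_nonneg a
      · simpa using D.mu_le a
    have h2 : (mu - loPart U mu) a ^ 2 ≤ r a ^ 2 := sq_le_sq' (by linarith [neg_abs_le ((mu - loPart U mu) a)]) ((le_abs_self _).trans h1)
    have h3 : (1:ℝ) ≤ (1 + Real.log N) ^ 2 := one_le_pow₀ (by linarith)
    exact h2.trans (le_mul_of_one_le_right (sq_nonneg _) h3)
  · intro M hM
    refine le_trans ?_ (hms M hM)
    rw [Finset.sum_mul]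
    refine Finset.sum_le_sum fun b hb => ?_
    have hb1 := Finset.mem_Icc.mp hb
    have hq : ∀ l, 0 ≤ (La - loPart U La) l ∧ (La - loPart U La) l ≤ La l := by
      intro l
      simp only [sub_loPart_apply]
      split_ifs
      · simpa using D.La_nonneg l
      · simpa using D.La_nonneg l
    have h0 : 0 ≤ (r * (La - loPart U La)) b := by
      rw [ArithmeticFunction.mul_apply]
      exact Finset.sum_nonneg fun p _ => mul_nonneg (D.r_nonneg _) (hq _).1
    have h1 : (r * (La - loPart U La)) b ≤ r b * (1 + Real.log N) := by
      calc _ ≤ (r * La) b := by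
            rw [ArithmeticFunction.mul_apply, ArithmeticFunction.mul_apply]
            exact Finset.sum_le_sum fun p _ => mul_le_mul_of_nonneg_left (hq _).2 (D.r_nonneg _)
        _ = r b * Real.log b := D.r_mul b
        _ ≤ _ := by
            have := hmono b (hb1.2.trans hM)
            have := D.r_nonneg b
            gcongr
            linarith
    rw [← mul_pow]
    gcongr

end

section

open scoped ComplexConjugate

lemma periodic_shift (g : ℕ → ℂ) (P : ℕ) (hper : ∀ l, g (l + P) = g l) (k : ℕ) :
    ∑ j ∈ Finset.range P, g (k + j) = ∑ j ∈ Finset.range P, g j := by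
  induction k with
  | zero => simp
  | succ k ih =>
    rw [← ih]
    have h1 := Finset.sum_range_succ (fun j => g (k + j)) P
    have h2 := Finset.sum_range_succ' (fun j => g (k + j)) P
    rw [h1] at h2
    simp only [add_zero, hper] at h2
    have h3 : ∀ j, k + 1 + j = k + (j + 1) := fun j => by ring
    simp only [h3]
    exact (add_right_cancel h2).symm

lemma periodic_bound (g : ℕ → ℂ) (hg : ∀ l, ‖g l‖ ≤ 1) (P : ℕ) (hP : 0 < P)
    (hper : ∀ l, g (l + P) = g l) (h0 : ∑ j ∈ Finset.range P, g j = 0) (M : ℕ) :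
    ‖∑ l ∈ Finset.Icc 1 M, g l‖ ≤ P := by
  have hrw : ∀ M, ∑ l ∈ Finset.Icc 1 M, g l = ∑ j ∈ Finset.range M, g (1 + j) := by
    intro M
    rw [Finset.range_eq_Ico]
    have := Finset.sum_Ico_add' (fun j => g j) 0 M 1
    simp only [add_comm 1]
    rw [this]
    rfl
  induction M using Nat.strong_induction_on with
  | _ M ih =>
    by_cases hM : M < P
    · refine (norm_sum_le _ _).trans ?_
      refine (Finset.sum_le_sum fun l _ => hg l).trans ?_
      simp
      exact_mod_cast hM.le
    · push Not at hM
      have h := ih (M - P) (by omega)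
      rw [hrw] at h ⊢
      have e : M = (M - P) + P := by omega
      rw [e, Finset.sum_range_add]
      have h2 := periodic_shift g P hper (1 + (M - P))
      simp only [← add_assoc]
      rw [h2, h0, add_zero]
      exact h

lemma periodic_sum_zero (g : ℕ → ℂ) (hmul : ∀ a b, g (a * b) = g a * g b) (P : ℕ) (hP : 0 < P)
    (hper : ∀ l, g (l + P) = g l) (δ : ℕ) (hδ : δ.Coprime P) (hω : g δ ≠ 1) :
    ∑ j ∈ Finset.range P, g j = 0 := by
  have hne : NeZero P := ⟨hP.ne'⟩
  have hmod : ∀ l, g (l % P) = g l := fun l => Function.Periodic.map_mod_nat hper l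
  have e1 : ∑ j ∈ Finset.range P, g j = ∑ a : ZMod P, g a.val := by
    symm
    refine Finset.sum_bij (fun a _ => a.val) (fun a _ => Finset.mem_range.mpr a.val_lt)
      (fun a _ b _ h => ZMod.val_injective P h) (fun j hj => ⟨(j : ZMod P), Finset.mem_univ _, ?_⟩)
      fun _ _ => rfl
    rw [ZMod.val_natCast, Nat.mod_eq_of_lt (Finset.mem_range.mp hj)]
  have e2 : ∑ a : ZMod P, g a.val = g δ * ∑ a : ZMod P, g a.val := by
    rw [Finset.mul_sum]
    symm
    refine Fintype.sum_equiv (Units.mulLeft (ZMod.unitOfCoprime δ hδ)) _ _ fun a => ?_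
    rw [Units.mulLeft_apply, ZMod.coe_unitOfCoprime, ← hmul, ZMod.val_mul, hmod]
    rw [hmul, hmul, ZMod.val_natCast, hmod]
  rw [e1]
  have : (1 - g δ) * ∑ a : ZMod P, g a.val = 0 := by rw [sub_mul, one_mul, ← e2, sub_self]
  rcases mul_eq_zero.mp this with h | h
  · exact absurd (sub_eq_zero.mp h).symm hω
  · exact h

open Classical in
/-- the twisting function attached to a tuple of characters -/
noncomputable def chi {ι : Type*} [Fintype ι] (q : ι → ℕ) (ψ : (i : ι) → DirichletCharacter ℂ (q i)) (l : ℕ) : ℂ :=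
  ∏ i, if ψ i = 1 then 1 else ψ i (l : ZMod (q i))

open Classical in
noncomputable def condu {ι : Type*} [Fintype ι] (q : ι → ℕ) (ψ : (i : ι) → DirichletCharacter ℂ (q i)) : ℕ :=
  ∏ i, if ψ i = 1 then 1 else q i

lemma chi_mul {ι : Type*} [Fintype ι] (q : ι → ℕ) (ψ : (i : ι) → DirichletCharacter ℂ (q i)) (a b : ℕ) :
    chi q ψ (a * b) = chi q ψ a * chi q ψ b := by
  unfold chi
  rw [← Finset.prod_mul_distrib]
  refine Finset.prod_congr rfl fun i _ => ?_
  split_ifs <;> simp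

lemma chi_norm_le {ι : Type*} [Fintype ι] (q : ι → ℕ) (ψ : (i : ι) → DirichletCharacter ℂ (q i)) (a : ℕ) : ‖chi q ψ a‖ ≤ 1 := by
  unfold chi
  rw [norm_prod]
  refine Finset.prod_le_one (fun _ _ => norm_nonneg _) fun i _ => ?_
  split_ifs
  · simp
  · exact DirichletCharacter.norm_le_one _ _

open Classical in
lemma condu_pos {ι : Type*} [Fintype ι] (q : ι → ℕ) [∀ i, Fact (q i).Prime]
    (ψ : (i : ι) → DirichletCharacter ℂ (q i)) : 0 < condu q ψ := by
  unfold condu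
  refine Finset.prod_pos fun i _ => ?_
  split_ifs
  · exact one_pos
  · exact (Fact.out : (q i).Prime).pos

open Classical in
lemma chi_periodic {ι : Type*} [Fintype ι] (q : ι → ℕ)
    (ψ : (i : ι) → DirichletCharacter ℂ (q i)) (P : ℕ) (hP : condu q ψ ∣ P) (l : ℕ) :
    chi q ψ (l + P) = chi q ψ l := by
  unfold chi
  refine Finset.prod_congr rfl fun i _ => ?_
  split_ifs with h
  · rfl
  · have h1 : q i ∣ condu q ψ := by
      unfold condu
      have := Finset.dvd_prod_of_mem (fun i => if ψ i = 1 then 1 else q i) (Finset.mem_univ i)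
      simpa [h] using this
    have h2 : (P : ZMod (q i)) = 0 := (ZMod.natCast_eq_zero_iff _ _).mpr (h1.trans hP)
    push_cast
    rw [h2, add_zero]

lemma exists_delta {ι : Type*} [Fintype ι] [DecidableEq ι] (q : ι → ℕ) [∀ i, Fact (q i).Prime]
    (hq : Function.Injective q) (i₀ : ι) (c : (ZMod (q i₀))ˣ) :
    ∃ δ : ℕ, (δ : ZMod (q i₀)) = c ∧ (∀ j, j ≠ i₀ → (δ : ZMod (q j)) = 1) ∧
      ∀ j, δ.Coprime (q j) := by
  have hco : (q i₀).Coprime (∏ j ∈ Finset.univ.erase i₀, q j) := by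
    refine Nat.Coprime.prod_right fun j hj => ?_
    have : q i₀ ≠ q j := fun h => (Finset.mem_erase.mp hj).1 (hq h).symm
    exact (Nat.coprime_primes Fact.out Fact.out).mpr this
  obtain ⟨δ, h1, h2⟩ := Nat.chineseRemainder hco (c : ZMod (q i₀)).val 1
  have e1 : (δ : ZMod (q i₀)) = c := by
    have := (ZMod.natCast_eq_natCast_iff _ _ _).mpr h1
    simpa using this
  have e2 : ∀ j, j ≠ i₀ → (δ : ZMod (q j)) = 1 := by
    intro j hj
    have hd : q j ∣ ∏ j ∈ Finset.univ.erase i₀, q j :=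
      Finset.dvd_prod_of_mem _ (Finset.mem_erase.mpr ⟨hj, Finset.mem_univ _⟩)
    have := (ZMod.natCast_eq_natCast_iff _ _ _).mpr (h2.of_dvd hd)
    simpa using this
  refine ⟨δ, e1, e2, fun j => ?_⟩
  rw [← ZMod.isUnit_iff_coprime]
  by_cases hj : j = i₀
  · subst hj; rw [e1]; exact c.isUnit
  · rw [e2 j hj]; exact isUnit_one

lemma chi_orth {ι : Type*} [Fintype ι] [DecidableEq ι] (q : ι → ℕ) [∀ i, Fact (q i).Prime]
    (hq : Function.Injective q) (ψ ψ' : (i : ι) → DirichletCharacter ℂ (q i)) (hne : ψ ≠ ψ')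
    (M : ℕ) :
    ‖∑ l ∈ Finset.Icc 1 M, chi q ψ l * conj (chi q ψ' l)‖ ≤ condu q ψ * condu q ψ' := by
  classical
  obtain ⟨i₀, hi₀⟩ := Function.ne_iff.mp hne
  obtain ⟨c, hc⟩ : ∃ c : (ZMod (q i₀))ˣ, ψ i₀ c ≠ ψ' i₀ c := by
    by_contra h
    push Not at h
    exact hi₀ (MulChar.ext h)
  obtain ⟨δ, h1, h2, h3⟩ := exists_delta q hq i₀ c
  have hval : ∀ ψ : (i : ι) → DirichletCharacter ℂ (q i), chi q ψ δ = ψ i₀ c := by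
    intro ψ
    unfold chi
    rw [Finset.prod_eq_single i₀]
    · split_ifs with h
      · rw [h]; simp
      · rw [h1]
    · intro j _ hj
      rw [h2 j hj]
      simp
    · simp
  have hP : 0 < condu q ψ * condu q ψ' := Nat.mul_pos (condu_pos q ψ) (condu_pos q ψ')
  have hmul : ∀ a b, chi q ψ (a * b) * conj (chi q ψ' (a * b)) =
      chi q ψ a * conj (chi q ψ' a) * (chi q ψ b * conj (chi q ψ' b)) := by
    intro a b
    rw [chi_mul, chi_mul, map_mul]; ring
  have hper : ∀ l, chi q ψ (l + condu q ψ * condu q ψ') *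
      conj (chi q ψ' (l + condu q ψ * condu q ψ')) = chi q ψ l * conj (chi q ψ' l) := by
    intro l
    rw [chi_periodic q ψ _ (dvd_mul_right _ _), chi_periodic q ψ' _ (dvd_mul_left _ _)]
  have hcop : ∀ ψ : (i : ι) → DirichletCharacter ℂ (q i), δ.Coprime (condu q ψ) := by
    intro ψ
    unfold condu
    refine Nat.Coprime.prod_right fun i _ => ?_
    split_ifs
    · simp
    · exact h3 i
  have h0 := periodic_sum_zero (fun l => chi q ψ l * conj (chi q ψ' l)) hmul _ hP hper δ
    ((hcop ψ).mul_right (hcop ψ')) (by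
      rw [hval, hval]
      intro h
      apply hc
      have hn : ‖ψ' i₀ c‖ = 1 := DirichletCharacter.unit_norm_eq_one _ _
      have : conj (ψ' i₀ c) * ψ' i₀ c = 1 := by
        rw [Complex.conj_mul', hn]; simp
      calc ψ i₀ c = ψ i₀ c * (conj (ψ' i₀ c) * ψ' i₀ c) := by rw [this, mul_one]
        _ = ψ' i₀ c := by rw [← mul_assoc, h, one_mul])
  have := periodic_bound (fun l => chi q ψ l * conj (chi q ψ' l)) (fun l => by
    rw [norm_mul, RCLike.norm_conj]
    exact mul_le_one₀ (chi_norm_le q ψ l) (norm_nonneg _) (chi_norm_le q ψ' l)) _ hP hper h0 M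
  exact_mod_cast this

open Classical in
/-- characters supported on `S` -/
noncomputable def psiOn {ι : Type*} [Fintype ι] (q : ι → ℕ) [∀ i, Fact (q i).Prime] (S : Finset ι) :
    Finset ((i : ι) → DirichletCharacter ℂ (q i)) :=
  Fintype.piFinset fun i => if i ∈ S then Finset.univ else {1}

open Classical in
lemma sum_psiOn {ι : Type*} [Fintype ι] (q : ι → ℕ) [∀ i, Fact (q i).Prime]
    (S : Finset ι) (l : ℕ) :
    ∑ ψ ∈ psiOn q S, chi q ψ l =
      ((∏ i ∈ S, ((if (l : ZMod (q i)) = 1 then ((q i : ℝ) - 1) else 0) +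
        if (l : ZMod (q i)) = 0 then 1 else 0) : ℝ) : ℂ) := by
  unfold psiOn chi
  have hpu := (Finset.prod_univ_sum
    (fun i => (if i ∈ S then Finset.univ else {1} : Finset (DirichletCharacter ℂ (q i))))
    (fun i (ψ : DirichletCharacter ℂ (q i)) => if ψ = 1 then (1:ℂ) else ψ (l : ZMod (q i)))).symm
  refine Eq.trans (b := ∏ i, ∑ j ∈ (if i ∈ S then Finset.univ else {1} :
    Finset (DirichletCharacter ℂ (q i))), if j = 1 then (1:ℂ) else j (l : ZMod (q i)))
    (by convert hpu) ?_
  push_cast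
  rw [← Finset.prod_subset (Finset.subset_univ S)]
  · refine Finset.prod_congr rfl fun i hi => ?_
    rw [if_pos hi]
    have h1 : ∀ ψ : DirichletCharacter ℂ (q i), (if ψ = 1 then (1:ℂ) else ψ (l : ZMod (q i))) =
        ψ (l : ZMod (q i)) + if ψ = 1 then (if (l : ZMod (q i)) = 0 then 1 else 0) else 0 := by
      intro ψ
      split_ifs with h h0
      · rw [h0, MulChar.map_zero]; simp
      · rw [h, MulChar.one_apply (isUnit_iff_ne_zero.mpr h0)]; simp
      · simp
    simp only [h1]
    rw [Finset.sum_add_distrib, DirichletCharacter.sum_characters_eq, Finset.sum_ite_eq']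
    simp only [Finset.mem_univ, if_true]
    congr 1
    · split_ifs
      · rw [Nat.totient_prime Fact.out, Nat.cast_sub (Fact.out : (q i).Prime).one_le]
        simp
      · rfl
    · split_ifs <;> simp
  · intro i _ hi
    rw [if_neg hi]
    simp

lemma card_psiOn {ι : Type*} [Fintype ι] (q : ι → ℕ) [∀ i, Fact (q i).Prime] (z : ℕ)
    (hz : ∀ i, q i ≤ z) (S : Finset ι) : (psiOn q S).card ≤ z ^ S.card := by
  classical
  unfold psiOn
  rw [Fintype.card_piFinset, ← Finset.prod_subset (Finset.subset_univ S)]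
  · rw [← Finset.prod_const]
    refine Finset.prod_le_prod' fun i hi => ?_
    rw [if_pos hi, Finset.card_univ, ← Nat.card_eq_fintype_card,
      DirichletCharacter.card_eq_totient_of_hasEnoughRootsOfUnity]
    exact (Nat.totient_le _).trans (hz i)
  · intro i _ hi
    rw [if_neg hi]; simp

lemma mem_psiOn {ι : Type*} [Fintype ι] (q : ι → ℕ) [∀ i, Fact (q i).Prime] (S : Finset ι)
    (ψ : (i : ι) → DirichletCharacter ℂ (q i)) :
    ψ ∈ psiOn q S ↔ ∀ i, i ∉ S → ψ i = 1 := by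
  classical
  unfold psiOn
  rw [Fintype.mem_piFinset]
  refine forall_congr' fun i => ?_
  by_cases h : i ∈ S <;> simp [h]

lemma condu_le {ι : Type*} [Fintype ι] (q : ι → ℕ) [∀ i, Fact (q i).Prime] (z : ℕ)
    (hz : ∀ i, q i ≤ z) (S : Finset ι) (ψ : (i : ι) → DirichletCharacter ℂ (q i))
    (hψ : ψ ∈ psiOn q S) : condu q ψ ≤ z ^ S.card := by
  classical
  rw [mem_psiOn] at hψ
  unfold condu
  rw [← Finset.prod_subset (Finset.subset_univ S)]
  · rw [← Finset.prod_const]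
    refine Finset.prod_le_prod' fun i hi => ?_
    split_ifs
    · exact (Fact.out : (q i).Prime).one_le.trans (hz i)
    · exact hz i
  · intro i _ hi
    rw [if_pos (hψ i hi)]

end

section

open scoped ComplexConjugate

/-- the local weight -/
noncomputable def wS {ι : Type*} (q : ι → ℕ) (S : Finset ι) (l : ℕ) : ℝ :=
  ∏ i ∈ S, ((if (l : ZMod (q i)) = 1 then ((q i : ℝ) - 1) else 0) +
        if (l : ZMod (q i)) = 0 then 1 else 0)

open Classical in
noncomputable def psiE {ι : Type*} [Fintype ι] (q : ι → ℕ) [∀ i, Fact (q i).Prime] (u : ℕ) :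
    Finset ((i : ι) → DirichletCharacter ℂ (q i)) :=
  ((Finset.powersetCard u Finset.univ).biUnion (psiOn q)).erase 1

lemma card_supersets {ι : Type*} [Fintype ι] [DecidableEq ι] (i₀ : ι) (u : ℕ) (hu : 1 ≤ u) :
    ((Finset.powersetCard u (Finset.univ : Finset ι)).filter (i₀ ∈ ·)).card * Fintype.card ι =
      u * (Fintype.card ι).choose u := by
  have h : ((Finset.powersetCard u (Finset.univ : Finset ι)).filter (i₀ ∈ ·)).card =
      (Fintype.card ι - 1).choose (u - 1) := by
    have : (Finset.powersetCard u (Finset.univ : Finset ι)).filter (i₀ ∈ ·) =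
        (Finset.powersetCard (u - 1) (Finset.univ.erase i₀)).image (insert i₀) := by
      ext S
      simp only [Finset.mem_filter, Finset.mem_powersetCard, Finset.subset_univ, true_and,
        Finset.mem_image]
      constructor
      · rintro ⟨h1, h2⟩
        refine ⟨S.erase i₀, ⟨Finset.erase_subset_erase _ (Finset.subset_univ _), ?_⟩,
          Finset.insert_erase h2⟩
        rw [Finset.card_erase_of_mem h2, h1]
      · rintro ⟨T, ⟨h1, h2⟩, rfl⟩
        refine ⟨?_, Finset.mem_insert_self _ _⟩
        rw [Finset.card_insert_of_notMem fun hm => (Finset.mem_erase.mp (h1 hm)).1 rfl, h2]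
        omega
    rw [this, Finset.card_image_of_injOn, Finset.card_powersetCard,
      Finset.card_erase_of_mem (Finset.mem_univ _), Finset.card_univ]
    intro S hS T hT hST
    have hS' : i₀ ∉ S := fun hm => (Finset.mem_erase.mp
      ((Finset.mem_powersetCard.mp hS).1 hm)).1 rfl
    have hT' : i₀ ∉ T := fun hm => (Finset.mem_erase.mp
      ((Finset.mem_powersetCard.mp hT).1 hm)).1 rfl
    have := congrArg (Finset.erase · i₀) hST
    simpa [Finset.erase_insert hS', Finset.erase_insert hT'] using this
  rw [h]
  have hpos : 0 < Fintype.card ι := Fintype.card_pos_iff.mpr ⟨i₀⟩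
  obtain ⟨m, hm⟩ : ∃ m, Fintype.card ι = m + 1 := ⟨Fintype.card ι - 1, by omega⟩
  obtain ⟨v, rfl⟩ : ∃ v, u = v + 1 := ⟨u - 1, by omega⟩
  rw [hm]
  simp only [Nat.add_sub_cancel]
  have := Nat.add_one_mul_choose_eq m v
  nlinarith

lemma main_expand {ι : Type*} [Fintype ι] [DecidableEq ι] (q : ι → ℕ) [∀ i, Fact (q i).Prime]
    (u : ℕ) (hu : 1 ≤ u) (N : ℕ) (a : ℕ → ℝ) :
    ((Fintype.card ι).choose u : ℝ) * (∑ l ∈ Finset.Icc 1 N, a l -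
      (u / Fintype.card ι : ℝ) * ∑ ψ ∈ psiE q u, ‖∑ l ∈ Finset.Icc 1 N, (a l : ℂ) * chi q ψ l‖) ≤
    ∑ S ∈ Finset.powersetCard u (Finset.univ : Finset ι), ∑ l ∈ Finset.Icc 1 N, a l * wS q S l := by
  classical
  set T : ((i : ι) → DirichletCharacter ℂ (q i)) → ℂ := fun ψ =>
    ∑ l ∈ Finset.Icc 1 N, (a l : ℂ) * chi q ψ l with hT
  set PS := Finset.powersetCard u (Finset.univ : Finset ι) with hPS
  have hT1 : T 1 = ((∑ l ∈ Finset.Icc 1 N, a l : ℝ) : ℂ) := by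
    simp [hT, chi]
  have h1 : ∀ S, ((∑ l ∈ Finset.Icc 1 N, a l * wS q S l : ℝ) : ℂ) = ∑ ψ ∈ psiOn q S, T ψ := by
    intro S
    simp only [hT]
    rw [Finset.sum_comm]
    push_cast
    refine Finset.sum_congr rfl fun l _ => ?_
    rw [← Finset.mul_sum, sum_psiOn]
    rfl
  have hone : ∀ S, (1 : (i : ι) → DirichletCharacter ℂ (q i)) ∈ psiOn q S := by
    intro S; rw [mem_psiOn]; intro i _; rfl
  have h2 : ∀ S, ∑ l ∈ Finset.Icc 1 N, a l - ∑ ψ ∈ (psiOn q S).erase 1, ‖T ψ‖ ≤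
      ∑ l ∈ Finset.Icc 1 N, a l * wS q S l := by
    intro S
    have e := h1 S
    rw [← Finset.add_sum_erase _ _ (hone S), hT1] at e
    have e2 : ((∑ l ∈ Finset.Icc 1 N, a l - ∑ l ∈ Finset.Icc 1 N, a l * wS q S l : ℝ) : ℂ) =
        - ∑ ψ ∈ (psiOn q S).erase 1, T ψ := by
      rw [Complex.ofReal_sub, e]; ring
    have e3 : ∑ l ∈ Finset.Icc 1 N, a l - ∑ l ∈ Finset.Icc 1 N, a l * wS q S l ≤
        ∑ ψ ∈ (psiOn q S).erase 1, ‖T ψ‖ := by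
      refine (le_abs_self _).trans ?_
      rw [← Real.norm_eq_abs, ← Complex.norm_real, e2, norm_neg]
      exact norm_sum_le _ _
    linarith
  have h3 : ∑ S ∈ PS, ∑ ψ ∈ (psiOn q S).erase 1, ‖T ψ‖ ≤
      ((Fintype.card ι).choose u : ℝ) * ((u / Fintype.card ι : ℝ) * ∑ ψ ∈ psiE q u, ‖T ψ‖) := by
    have e1 : ∀ S ∈ PS, ∑ ψ ∈ (psiOn q S).erase 1, ‖T ψ‖ =
        ∑ ψ ∈ psiE q u, if ψ ∈ psiOn q S then ‖T ψ‖ else 0 := by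
      intro S hS
      rw [← Finset.sum_filter]
      refine Finset.sum_congr ?_ fun _ _ => rfl
      ext ψ
      simp only [psiE, Finset.mem_erase, Finset.mem_filter, Finset.mem_biUnion]
      constructor
      · rintro ⟨h, h'⟩
        exact ⟨⟨h, S, hS, h'⟩, h'⟩
      · rintro ⟨⟨h, _⟩, h'⟩
        exact ⟨h, h'⟩
    rw [Finset.sum_congr rfl e1, Finset.sum_comm, ← mul_assoc, Finset.mul_sum]
    refine Finset.sum_le_sum fun ψ hψ => ?_
    rw [← Finset.sum_filter, Finset.sum_const, nsmul_eq_mul]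
    refine mul_le_mul_of_nonneg_right ?_ (norm_nonneg _)
    have hψ1 : ψ ≠ 1 := (Finset.mem_erase.mp hψ).1
    obtain ⟨i₀, hi₀⟩ := Function.ne_iff.mp hψ1
    have hpos : 0 < Fintype.card ι := Fintype.card_pos_iff.mpr ⟨i₀⟩
    have e2 : (PS.filter fun S => ψ ∈ psiOn q S).card ≤ (PS.filter (i₀ ∈ ·)).card := by
      refine Finset.card_le_card fun S hS => ?_
      rw [Finset.mem_filter] at hS ⊢
      refine ⟨hS.1, ?_⟩
      by_contra h
      exact hi₀ ((mem_psiOn q S ψ).mp hS.2 i₀ h)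
    have e3 := card_supersets i₀ u hu
    rw [← mul_div_assoc, le_div_iff₀ (by exact_mod_cast hpos)]
    have : (PS.filter fun S => ψ ∈ psiOn q S).card * Fintype.card ι ≤
        (Fintype.card ι).choose u * u := by
      rw [mul_comm _ u, ← e3]
      exact Nat.mul_le_mul_right _ e2
    exact_mod_cast this
  have h4 : ∑ S ∈ PS, (∑ l ∈ Finset.Icc 1 N, a l - ∑ ψ ∈ (psiOn q S).erase 1, ‖T ψ‖) ≤
      ∑ S ∈ PS, ∑ l ∈ Finset.Icc 1 N, a l * wS q S l := Finset.sum_le_sum fun S _ => h2 S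
  rw [Finset.sum_sub_distrib, Finset.sum_const, nsmul_eq_mul, hPS, Finset.card_powersetCard,
    Finset.card_univ] at h4
  linarith

lemma card_psiE {ι : Type*} [Fintype ι] [DecidableEq ι] (q : ι → ℕ) [∀ i, Fact (q i).Prime]
    (hq : Function.Injective q) (z : ℕ) (hz : ∀ i, q i ≤ z) (u : ℕ) :
    (psiE q u).card ≤ z ^ (2 * u) := by
  classical
  unfold psiE
  refine (Finset.card_erase_le).trans (Finset.card_biUnion_le.trans ?_)
  have h1 : ∀ S ∈ Finset.powersetCard u (Finset.univ : Finset ι), (psiOn q S).card ≤ z ^ u := by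
    intro S hS
    have := card_psiOn q z hz S
    rwa [(Finset.mem_powersetCard.mp hS).2] at this
  refine (Finset.sum_le_card_nsmul _ _ _ h1).trans ?_
  rw [Finset.card_powersetCard, smul_eq_mul, two_mul, pow_add]
  refine Nat.mul_le_mul_right _ ((Nat.choose_le_pow _ _).trans ?_)
  refine Nat.pow_le_pow_left ?_ _
  calc Finset.univ.card = (Finset.univ.image q).card := (Finset.card_image_of_injective _ hq).symm
    _ ≤ (Finset.Icc 1 z).card := by
        refine Finset.card_le_card fun a ha => ?_
        obtain ⟨i, _, rfl⟩ := Finset.mem_image.mp ha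
        exact Finset.mem_Icc.mpr ⟨(Fact.out : (q i).Prime).one_le, hz i⟩
    _ = z := by simp

/-- the type I hypothesis for the family -/
def FamTypeI {ι : Type*} [Fintype ι] (q : ι → ℕ) (n : ℕ) (r : ArithmeticFunction ℝ) (C1 : ℝ) : Prop :=
  ∀ ψ : (i : ι) → DirichletCharacter ℂ (q i), ψ ≠ 1 → TypeIBound n r (chi q ψ) (C1 * condu q ψ)

lemma main_error {n : ℕ} (hn : 1 ≤ n) {r mu La : ArithmeticFunction ℝ}
    (D : ArithData n r mu La) (C1 : ℝ) (hC1 : 0 ≤ C1)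
    {ι : Type*} [Fintype ι] [DecidableEq ι] (q : ι → ℕ) [∀ i, Fact (q i).Prime]
    (hq : Function.Injective q) (hI : FamTypeI q n r C1) (z : ℕ) (hz2 : 3 ≤ z) (hz : ∀ i, q i ≤ z)
    (u : ℕ) (hu : 1 ≤ u) (x : ℝ) (hx : (z : ℝ) ^ (n * (16 * n + 38) * u) ≤ x) (N : ℕ)
    (hN : Real.exp 1 * x ≤ N) (hN' : (N:ℝ) ≤ 4 * x) :
    ∑ ψ ∈ psiE q u, ‖∑ l ∈ Finset.Icc 1 N, ((La l * tent (Real.log (l / x)) : ℝ) : ℂ) * chi q ψ l‖ ≤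
      (C1 * (2 * n + 2) + 6) * x * (Real.log x + 3) ^ (2 ^ (2 * n) + 3) := by
  have hz1 : (1:ℝ) ≤ z := by exact_mod_cast (by omega : 1 ≤ z)
  have hz3 : (3:ℝ) ≤ z := by exact_mod_cast hz2
  have hn1 : (1:ℝ) ≤ n := by exact_mod_cast hn
  set Z : ℝ := (z:ℝ) ^ u with hZ
  have hZ1 : 1 ≤ Z := one_le_pow₀ hz1
  have hzZ : (z:ℝ) ≤ Z := le_self_pow₀ hz1 (by omega)
  have hx' : Z ^ (n * (16 * n + 38)) ≤ x := by
    rw [hZ, ← pow_mul]; rwa [mul_comm u]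
  have hx1 : 1 ≤ x := (one_le_pow₀ hZ1).trans hx'
  have hx0 : 0 < x := by linarith
  have hlog : 0 ≤ Real.log x := Real.log_nonneg hx1
  have hcond : ∀ ψ ∈ psiE q u, ψ ≠ 1 ∧ (condu q ψ : ℝ) ≤ Z := by
    classical
    intro ψ hψ
    simp only [psiE, Finset.mem_erase, Finset.mem_biUnion] at hψ
    obtain ⟨h, S, hS, h'⟩ := hψ
    refine ⟨h, ?_⟩
    have := condu_le q z hz S ψ h'
    rw [(Finset.mem_powersetCard.mp hS).2] at this
    rw [hZ]
    exact_mod_cast this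
  have hEc : ((psiE q u).card : ℝ) ≤ Z ^ 2 := by
    have := card_psiE q hq z hz u
    rw [hZ, ← pow_mul, mul_comm u]
    exact_mod_cast this
  have hUc : ((z ^ (4 * u) : ℕ) : ℝ) = Z ^ 4 := by
    push_cast; rw [hZ, ← pow_mul, mul_comm u]
  have hv := vaughan_bound hn D (psiE q u) (fun ψ => chi q ψ) (fun ψ => chi_mul q ψ)
    (fun ψ => chi_norm_le q ψ) (C1 * Z) (by positivity) (by
      intro ψ hψ G hG X hX N hN
      refine (hI ψ (hcond ψ hψ).1 G hG X hX N hN).trans ?_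
      have := (hcond ψ hψ).2
      gcongr) (z ^ (4 * u)) (Nat.one_le_pow _ _ (by omega)) (Z ^ 2) (by positivity) (by
      intro ψ hψ ψ' hψ' hne M
      refine (chi_orth q hq ψ ψ' hne M).trans ?_
      rw [sq]
      exact mul_le_mul (hcond ψ hψ).2 (hcond ψ' hψ').2 (by positivity) (by positivity)) (by
      rw [hUc]
      calc Z ^ 2 * (psiE q u).card ≤ Z ^ 2 * Z ^ 2 := by gcongr
        _ = _ := by ring) x hx1 (by
      rw [hUc, ← pow_mul]
      exact (pow_le_pow_right₀ hZ1 (by nlinarith)).trans hx') (by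
      rw [hUc]
      have : Real.exp 1 ≤ Z := by linarith [Real.exp_one_lt_d9]
      calc Real.exp 1 * Z ^ 4 ≤ Z * Z ^ 4 := by gcongr
        _ = Z ^ 5 := by ring
        _ ≤ _ := (pow_le_pow_right₀ hZ1 (by nlinarith)).trans hx') N hN
  refine hv.trans ?_
  rw [hUc]
  have hpw : Z ^ (8 * n + 19) ≤ x ^ (1 / (2 * n : ℝ)) := by
    have h1 : (Z ^ (8 * n + 19)) ^ (2 * n) ≤ x := by
      rw [← pow_mul]
      refine le_trans (le_of_eq ?_) hx'
      congr 1; ring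
    calc Z ^ (8 * n + 19) = ((Z ^ (8 * n + 19)) ^ (2 * n)) ^ (1 / (2 * n : ℝ)) := by
          rw [← Real.rpow_natCast (Z ^ (8 * n + 19)) (2 * n), ← Real.rpow_mul (by positivity)]
          push_cast
          rw [mul_one_div_cancel (by positivity), Real.rpow_one]
      _ ≤ _ := by gcongr
  have hlogx : Real.log x + 2 ≤ (2 * n + 2) * x ^ (1 / (2 * n : ℝ)) := by
    have h1 := Real.log_le_rpow_div hx0.le (ε := 1 / (2 * n : ℝ)) (by positivity)
    have h2 : x ^ (1 / (2 * n : ℝ)) / (1 / (2 * n : ℝ)) = 2 * n * x ^ (1 / (2 * n : ℝ)) := by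
      field_simp
    have h3 : 1 ≤ x ^ (1 / (2 * n : ℝ)) := Real.one_le_rpow hx1 (by positivity)
    rw [h2] at h1
    nlinarith
  have hterm1 : ((psiE q u).card : ℝ) * (C1 * Z * x ^ (1 - 1 / (n : ℝ)) * (Z ^ 4) ^ (2 * n + 4) *
      (Real.log x + 2)) ≤ C1 * (2 * n + 2) * x := by
    calc _ ≤ Z ^ 2 * (C1 * Z * x ^ (1 - 1 / (n : ℝ)) * (Z ^ 4) ^ (2 * n + 4) *
          ((2 * n + 2) * x ^ (1 / (2 * n : ℝ)))) := by gcongr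
      _ = C1 * (2 * n + 2) * (x ^ (1 - 1 / (n : ℝ)) * x ^ (1 / (2 * n : ℝ)) * Z ^ (8 * n + 19)) := by
          have aux : ∀ W : ℝ, W ^ (8 * n + 19) = W ^ 2 * W * (W ^ 4) ^ (2 * n + 4) := fun W => by
            rw [← pow_mul, ← pow_succ, ← pow_add]; congr 1; ring
          rw [aux Z]; ring
      _ ≤ C1 * (2 * n + 2) * (x ^ (1 - 1 / (n : ℝ)) * x ^ (1 / (2 * n : ℝ)) * x ^ (1 / (2 * n : ℝ))) := by
          gcongr
      _ = C1 * (2 * n + 2) * x := by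
          rw [← Real.rpow_add hx0, ← Real.rpow_add hx0]
          have : 1 - 1 / (n:ℝ) + 1 / (2 * n) + 1 / (2 * n) = 1 := by field_simp; ring
          rw [this, Real.rpow_one]
  have hlogN : 1 + Real.log N ≤ Real.log x + 3 := by
    have hNpos : (0:ℝ) < N := lt_of_lt_of_le (by positivity) hN
    have h1 : Real.log N ≤ Real.log (4 * x) := Real.log_le_log hNpos hN'
    rw [Real.log_mul (by norm_num) hx0.ne'] at h1
    have h4 : Real.log 4 ≤ 2 := by
      rw [Real.log_le_iff_le_exp (by norm_num)]
      have : Real.exp 2 = Real.exp 1 * Real.exp 1 := by rw [← Real.exp_add]; norm_num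
      rw [this]
      nlinarith [Real.exp_one_gt_d9]
    linarith
  have hlN0 : 0 ≤ Real.log N := Real.log_natCast_nonneg N
  have hA : 1 ≤ (Real.log x + 3) ^ (2 ^ (2 * n) + 3) := one_le_pow₀ (by linarith)
  calc _ ≤ C1 * (2 * n + 2) * x + 6 * x * (Real.log x + 3) ^ (2 ^ (2 * n) + 3) := by
        gcongr
    _ ≤ C1 * (2 * n + 2) * x * (Real.log x + 3) ^ (2 ^ (2 * n) + 3) +
        6 * x * (Real.log x + 3) ^ (2 ^ (2 * n) + 3) := by
        refine add_le_add (le_mul_of_one_le_right (by positivity) hA) le_rfl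
    _ = _ := by ring

end

section

lemma nonprime_sum {n : ℕ} {r mu La : ArithmeticFunction ℝ} (D : ArithData n r mu La) (N : ℕ) :
    ∑ l ∈ (Finset.Icc 1 N).filter (fun l => ¬ l.Prime), La l ≤
      (Nat.sqrt N * (Nat.log 2 N + 1) : ℝ) * ((Nat.log 2 N + 1 : ℝ) ^ n * Real.log N) := by
  classical
  have hlogN : 0 ≤ Real.log N := Real.log_natCast_nonneg N
  set B : ℝ := (Nat.log 2 N + 1 : ℝ) ^ n * Real.log N
  have hB : 0 ≤ B := by positivity
  have key : ∀ l ∈ ((Finset.Icc 1 N).filter (fun l => ¬ l.Prime)).filter (fun l => La l ≠ 0),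
      ∃ p k : ℕ, p ∈ Finset.Icc 1 (Nat.sqrt N) ∧ k ∈ Finset.range (Nat.log 2 N + 1) ∧ p ^ k = l ∧
        p.Prime := by
    intro l hl
    simp only [Finset.mem_filter, Finset.mem_Icc] at hl
    obtain ⟨⟨⟨h1, h2⟩, h3⟩, h4⟩ := hl
    obtain ⟨p, k, hp, hk, rfl⟩ := (isPrimePow_nat_iff _).mp (D.La_pp l h4)
    have hk2 : 2 ≤ k := by
      by_contra hc
      have : k = 1 := by omega
      subst this
      simp at h3; exact h3 hp
    refine ⟨p, k, ?_, ?_, rfl, hp⟩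
    · rw [Finset.mem_Icc, Nat.le_sqrt']
      exact ⟨hp.one_le, (Nat.pow_le_pow_right hp.pos hk2).trans h2⟩
    · rw [Finset.mem_range, Nat.lt_succ_iff]
      exact Nat.le_log_of_pow_le (by norm_num) ((Nat.pow_le_pow_left hp.two_le k).trans h2)
  rw [← Finset.sum_filter_ne_zero]
  have hcard : (((Finset.Icc 1 N).filter (fun l => ¬ l.Prime)).filter (fun l => La l ≠ 0)).card ≤
      Nat.sqrt N * (Nat.log 2 N + 1) := by
    calc _ ≤ ((Finset.Icc 1 (Nat.sqrt N) ×ˢ Finset.range (Nat.log 2 N + 1)).image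
          (fun x => x.1 ^ x.2)).card := by
          refine Finset.card_le_card fun l hl => ?_
          obtain ⟨p, k, h1, h2, h3, -⟩ := key l hl
          exact Finset.mem_image.mpr ⟨(p, k), Finset.mem_product.mpr ⟨h1, h2⟩, h3⟩
      _ ≤ _ := Finset.card_image_le
      _ = _ := by simp
  calc _ ≤ ((((Finset.Icc 1 N).filter (fun l => ¬ l.Prime)).filter (fun l => La l ≠ 0)).card) • B := by
        refine Finset.sum_le_card_nsmul _ _ _ fun l hl => ?_
        obtain ⟨p, k, h1, h2, h3, hp⟩ := key l hl
        simp only [Finset.mem_filter, Finset.mem_Icc] at hl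
        refine (D.La_le l).trans ?_
        have hl1 : (1:ℝ) ≤ l := by exact_mod_cast hl.1.1.1
        have h7 : Real.log l ≤ Real.log N := Real.log_le_log (by linarith) (by exact_mod_cast hl.1.1.2)
        have h5 : (l.divisors.card : ℝ) ≤ Nat.log 2 N + 1 := by
          rw [← h3, Nat.divisors_prime_pow hp, Finset.card_map, Finset.card_range]
          rw [Finset.mem_range] at h2
          exact_mod_cast h2
        have h6 : r l ≤ (Nat.log 2 N + 1 : ℝ) ^ n := (D.r_le l).trans (by gcongr)
        exact mul_le_mul h6 h7 (Real.log_nonneg hl1) (by positivity)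
    _ ≤ _ := by
        rw [nsmul_eq_mul]
        gcongr
        exact_mod_cast hcard

lemma wS_nonneg {ι : Type*} (q : ι → ℕ) [∀ i, Fact (q i).Prime] (S : Finset ι) (l : ℕ) :
    0 ≤ wS q S l := by
  refine Finset.prod_nonneg fun i _ => ?_
  have : (1:ℝ) ≤ q i := by exact_mod_cast (Fact.out : (q i).Prime).one_le
  split_ifs <;> linarith

lemma wS_le {ι : Type*} (q : ι → ℕ) [∀ i, Fact (q i).Prime] (S : Finset ι) (l : ℕ) :
    wS q S l ≤ ∏ i ∈ S, (q i : ℝ) := by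
  refine Finset.prod_le_prod (fun i _ => ?_) fun i _ => ?_
  · have : (1:ℝ) ≤ q i := by exact_mod_cast (Fact.out : (q i).Prime).one_le
    split_ifs <;> linarith
  · have : (1:ℝ) ≤ q i := by exact_mod_cast (Fact.out : (q i).Prime).one_le
    have h01 : (0 : ZMod (q i)) ≠ 1 := zero_ne_one
    split_ifs with h1 h2 h2
    · rw [h1] at h2; exact absurd h2.symm h01
    all_goals linarith

lemma wS_prime {ι : Type*} [DecidableEq ι] (q : ι → ℕ) [∀ i, Fact (q i).Prime]
    (hq : Function.Injective q) (S : Finset ι)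
    (p : ℕ) (hp : p.Prime) (hlt : ∀ i, q i < p) (hw : wS q S p ≠ 0) :
    ∏ i ∈ S, q i ∣ p - 1 := by
  refine Finset.prod_dvd_of_isRelPrime ?_ ?_
  · intro i hi j hj hij
    exact Nat.coprime_iff_isRelPrime.mp ((Nat.coprime_primes Fact.out Fact.out).mpr (hq.ne hij))
  · intro i hi
    have h := Finset.prod_ne_zero_iff.mp hw i hi
    have h0 : (p : ZMod (q i)) ≠ 0 := by
      rw [Ne, ZMod.natCast_eq_zero_iff]
      intro hd
      rcases (Nat.dvd_prime hp).mp hd with h | h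
      · exact (Fact.out : (q i).Prime).one_lt.ne' h
      · exact (hlt i).ne h
    rw [if_neg h0, add_zero] at h
    have h1 : (p : ZMod (q i)) = 1 := by
      by_contra hc
      simp [hc] at h
    rw [← ZMod.natCast_eq_zero_iff, Nat.cast_sub hp.one_le, h1]
    simp

end

section

lemma card_cong_le (N d : ℕ) :
    (((Finset.Icc 1 N).filter (fun l => 2 ≤ l ∧ d ∣ l - 1)).card : ℝ) ≤ N / d := by
  have h : ((Finset.Icc 1 N).filter (fun l => 2 ≤ l ∧ d ∣ l - 1)).card ≤
      ((Finset.Ioc 0 N).filter (fun x => d ∣ x)).card := by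
    refine Finset.card_le_card_of_injOn (fun l => l - 1) ?_ ?_
    · intro l hl
      simp only [Finset.coe_filter, Finset.mem_Icc, Set.mem_ofPred_eq, Finset.mem_Ioc] at hl ⊢
      refine ⟨by omega, hl.2.2⟩
    · intro l hl l' hl' h
      simp only [Finset.coe_filter, Finset.mem_Icc, Set.mem_ofPred_eq] at hl hl' h
      omega
  rw [Nat.Ioc_filter_dvd_card_eq_div] at h
  calc _ ≤ ((N / d : ℕ) : ℝ) := by exact_mod_cast h
    _ ≤ _ := Nat.cast_div_le

open Classical in
noncomputable def goodP {ι : Type*} (q : ι → ℕ) (a : ℕ → ℝ) (N : ℕ) (S : Finset ι) : Finset ℕ :=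
  (Finset.Icc 1 N).filter fun p => p.Prime ∧ a p ≠ 0 ∧ (∏ i ∈ S, q i) ∣ p - 1 ∧
    ∀ i, ¬ q i ∣ (p - 1) / ∏ i ∈ S, q i

lemma mem_goodP {ι : Type*} (q : ι → ℕ) (a : ℕ → ℝ) (N : ℕ) (S : Finset ι) (p : ℕ) :
    p ∈ goodP q a N S ↔ p ∈ Finset.Icc 1 N ∧ p.Prime ∧ a p ≠ 0 ∧ (∏ i ∈ S, q i) ∣ p - 1 ∧
    ∀ i, ¬ q i ∣ (p - 1) / ∏ i ∈ S, q i := by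
  classical
  unfold goodP
  rw [Finset.mem_filter]

lemma inner_split {n : ℕ} {r mu La : ArithmeticFunction ℝ}
    (D : ArithData n r mu La) {ι : Type*} [Fintype ι] [DecidableEq ι] (q : ι → ℕ)
    [∀ i, Fact (q i).Prime] (hq : Function.Injective q) (z : ℕ) (hz : ∀ i, q i ≤ z)
    (hz9 : ∀ i, z ≤ 9 * q i) (hz0 : 0 < z) (N : ℕ)
    (a : ℕ → ℝ) (ha0 : ∀ l, 0 ≤ a l) (haL : ∀ l, a l ≤ La l) (haz : ∀ l, a l ≠ 0 → z < l)
    (u : ℕ) (S : Finset ι) (hS : S.card = u) :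
    ∑ l ∈ Finset.Icc 1 N, a l * wS q S l ≤
      (z:ℝ) ^ u * ∑ l ∈ (Finset.Icc 1 N).filter (fun l => ¬ l.Prime), La l +
      2 ^ n * Real.log N * (Fintype.card ι * (9 * N / z)) +
      2 ^ n * Real.log N * z ^ u * (goodP q a N S).card := by
  classical
  set d := ∏ i ∈ S, q i with hd
  have hd0 : 0 < d := Finset.prod_pos fun i _ => (Fact.out : (q i).Prime).pos
  have hwd : ∀ l, wS q S l ≤ d := fun l => by
    have := wS_le q S l
    rw [hd]; push_cast; exact this
  have hdz : (d:ℝ) ≤ z ^ u := by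
    rw [hd, ← hS, ← Finset.prod_const]
    push_cast
    exact Finset.prod_le_prod (fun i _ => by positivity) fun i _ => by exact_mod_cast hz i
  have hlogN : 0 ≤ Real.log N := Real.log_natCast_nonneg N
  have hprime : ∀ l ∈ Finset.Icc 1 N, l.Prime → a l ≤ 2 ^ n * Real.log N := by
    intro l hl hp
    rw [Finset.mem_Icc] at hl
    have hl1 : (1:ℝ) ≤ l := by exact_mod_cast hl.1
    refine (haL l).trans ((D.La_le l).trans ?_)
    have h1 := D.r_le l
    rw [hp.divisors, Finset.card_pair hp.one_lt.ne] at h1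
    refine mul_le_mul (by exact_mod_cast h1) ?_ (Real.log_nonneg hl1) (by positivity)
    exact Real.log_le_log (by linarith) (by exact_mod_cast hl.2)
  have hpt : ∀ l ∈ Finset.Icc 1 N, a l * wS q S l ≤ (if ¬ l.Prime then (z:ℝ) ^ u * La l else 0) +
      (∑ i, if 2 ≤ l ∧ q i * d ∣ l - 1 then 2 ^ n * Real.log N * d else 0) +
      (if l ∈ goodP q a N S then 2 ^ n * Real.log N * z ^ u else 0) := by
    intro l hl
    have n1 : 0 ≤ (if ¬ l.Prime then (z:ℝ) ^ u * La l else 0) := by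
      have := D.La_nonneg l
      split_ifs <;> positivity
    have n2 : ∀ i ∈ (Finset.univ : Finset ι),
        0 ≤ (if 2 ≤ l ∧ q i * d ∣ l - 1 then 2 ^ n * Real.log N * d else 0) := by
      intro i _
      split_ifs <;> positivity
    have n2' := Finset.sum_nonneg n2
    have n3 : 0 ≤ (if l ∈ goodP q a N S then 2 ^ n * Real.log N * z ^ u else 0) := by
      split_ifs <;> positivity
    by_cases hp : l.Prime
    swap
    · rw [if_pos hp] at n1 ⊢
      have : a l * wS q S l ≤ (z:ℝ) ^ u * La l := by
        rw [mul_comm]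
        exact mul_le_mul ((hwd l).trans hdz) (haL l) (ha0 l) (by positivity)
      linarith
    by_cases hal : a l = 0
    · rw [hal, zero_mul]; positivity
    by_cases hw : wS q S l = 0
    · rw [hw, mul_zero]; positivity
    have hdv : d ∣ l - 1 := wS_prime q hq S l hp (fun i => (hz i).trans_lt (haz l hal)) hw
    by_cases hg : l ∈ goodP q a N S
    · rw [if_pos hg] at n3 ⊢
      have : a l * wS q S l ≤ 2 ^ n * Real.log N * z ^ u :=
        mul_le_mul (hprime l hl hp) ((hwd l).trans hdz) (wS_nonneg q S l) (by positivity)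
      linarith
    · have : ∃ i, q i ∣ (l - 1) / d := by
        by_contra hc
        push Not at hc
        exact hg ((mem_goodP q a N S l).mpr ⟨hl, hp, hal, hdv, hc⟩)
      obtain ⟨i, hi⟩ := this
      have hi' : q i * d ∣ l - 1 := by
        rw [mul_comm]
        exact Nat.mul_dvd_of_dvd_div hdv hi
      have h1 := Finset.single_le_sum n2 (Finset.mem_univ i)
      rw [if_pos ⟨hp.two_le, hi'⟩] at h1
      have : a l * wS q S l ≤ 2 ^ n * Real.log N * d :=
        mul_le_mul (hprime l hl hp) (hwd l) (wS_nonneg q S l) (by positivity)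
      linarith
  refine (Finset.sum_le_sum hpt).trans ?_
  rw [Finset.sum_add_distrib, Finset.sum_add_distrib]
  refine add_le_add (add_le_add ?_ ?_) ?_
  · rw [← Finset.sum_filter, Finset.mul_sum]
  · rw [Finset.sum_comm]
    have : ∀ i ∈ (Finset.univ : Finset ι), ∑ l ∈ Finset.Icc 1 N,
        (if 2 ≤ l ∧ q i * d ∣ l - 1 then 2 ^ n * Real.log N * d else 0) ≤
        2 ^ n * Real.log N * (9 * N / z) := by
      intro i _
      rw [← Finset.sum_filter, Finset.sum_const, nsmul_eq_mul]
      have h1 := card_cong_le N (q i * d)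
      have hq0 : (0:ℝ) < q i := by exact_mod_cast (Fact.out : (q i).Prime).pos
      have hz0' : (0:ℝ) < z := by exact_mod_cast hz0
      have hd0' : (0:ℝ) < d := by exact_mod_cast hd0
      have h9 : (z:ℝ) ≤ 9 * q i := by exact_mod_cast hz9 i
      calc _ ≤ (N / (q i * d : ℕ) : ℝ) * (2 ^ n * Real.log N * d) := by gcongr
        _ = 2 ^ n * Real.log N * (N / q i) := by push_cast; field_simp
        _ ≤ _ := by
          refine mul_le_mul_of_nonneg_left ?_ (by positivity)
          rw [div_le_div_iff₀ hq0 hz0']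
          nlinarith [(Nat.cast_nonneg N : (0:ℝ) ≤ N)]
    refine (Finset.sum_le_sum this).trans (le_of_eq ?_)
    rw [Finset.sum_const, nsmul_eq_mul, Finset.card_univ]; ring
  · rw [← Finset.sum_filter, Finset.sum_const, nsmul_eq_mul, mul_comm]
    gcongr
    intro l hl
    exact (Finset.mem_filter.mp hl).2

set_option maxHeartbeats 2000000 in
lemma main_pairs {n : ℕ} (hn : 1 ≤ n) {r mu La : ArithmeticFunction ℝ}
    (D : ArithData n r mu La) (C1 : ℝ) (hC1 : 0 ≤ C1) (c0 : ℝ) (hc0 : 0 < c0)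
    {ι : Type*} [Fintype ι] [DecidableEq ι] (q : ι → ℕ) [∀ i, Fact (q i).Prime]
    (hq : Function.Injective q) (hI : FamTypeI q n r C1) (z : ℕ) (hz2 : 3 ≤ z) (hz : ∀ i, q i ≤ z)
    (hz9 : ∀ i, z ≤ 9 * q i)
    (u : ℕ) (hu : 1 ≤ u) (hum : u ≤ Fintype.card ι)
    (x : ℝ) (hx : (z : ℝ) ^ (n * (16 * n + 38) * u) ≤ x) (N : ℕ)
    (hN : Real.exp 1 * x ≤ N) (hN' : (N:ℝ) ≤ 4 * x)
    (hsum : c0 * x ≤ ∑ l ∈ Finset.Icc 1 N, La l * tent (Real.log (l / x)))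
    (h1 : 4 * (C1 * (2 * n + 2) + 6) * u * (Real.log x + 3) ^ (2 ^ (2 * n) + 3) ≤
      c0 * Fintype.card ι)
    (h2 : (z:ℝ) ^ u * (2 * Real.sqrt x * (2 * (Real.log x + 3)) ^ (n + 2)) ≤ c0 / 8 * x)
    (h3 : 2 ^ n * (Real.log x + 3) * 36 * Fintype.card ι ≤ c0 / 8 * z) :
    ∃ k : ℕ, 1 ≤ k ∧ ∃ P : Finset ℕ, (∀ p ∈ P, p.Prime ∧ La p ≠ 0 ∧ x / Real.exp 1 < p ∧
      (p:ℝ) < Real.exp 1 * x ∧ z < p ∧ ∃ S : Finset ι, p = k * ∏ i ∈ S, q i + 1) ∧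
      (∀ i, ¬ q i ∣ k) ∧
      c0 * ((Fintype.card ι).choose u : ℝ) ≤ 8 * 2 ^ n * 9 ^ u * (Real.log x + 3) * P.card := by
  classical
  set m := Fintype.card ι with hm
  set a : ℕ → ℝ := fun l => La l * tent (Real.log (l / x)) with ha
  have hz0 : 0 < z := by omega
  have hz1 : (1:ℝ) ≤ z := by exact_mod_cast (by omega : 1 ≤ z)
  have hz3 : (3:ℝ) ≤ z := by exact_mod_cast hz2
  have hm0 : (0:ℝ) < m := by exact_mod_cast (by omega : 0 < m)
  have hzx : (z:ℝ) ^ 2 ≤ x := by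
    refine le_trans (pow_le_pow_right₀ hz1 ?_) hx
    calc 2 ≤ 1 * (16 * 1 + 38) * 1 := by norm_num
      _ ≤ _ := by gcongr
  have hx9 : 9 ≤ x := by nlinarith
  have hx0 : 0 < x := by linarith
  have hlog : 0 ≤ Real.log x := Real.log_nonneg (by linarith)
  have he : Real.exp 1 < 3 := by linarith [Real.exp_one_lt_d9]
  have he0 : 0 < Real.exp 1 := Real.exp_pos 1
  have ha0 : ∀ l, 0 ≤ a l := fun l => mul_nonneg (D.La_nonneg l) (tent_nonneg _)
  have haL : ∀ l, a l ≤ La l := fun l => mul_le_of_le_one_right (D.La_nonneg l) (tent_le_one _)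
  have harange : ∀ l : ℕ, a l ≠ 0 → La l ≠ 0 ∧ x / Real.exp 1 < l ∧ (l:ℝ) < Real.exp 1 * x := by
    intro l hl
    have hL := left_ne_zero_of_mul hl
    have ht := tent_pos (right_ne_zero_of_mul hl)
    have hl0 : l ≠ 0 := by rintro rfl; simp at hL
    have hl0' : (0:ℝ) < l := by exact_mod_cast Nat.pos_of_ne_zero hl0
    rw [abs_lt, Real.log_div hl0'.ne' hx0.ne'] at ht
    refine ⟨hL, ?_, ?_⟩
    · rw [← Real.exp_log hl0']
      nth_rw 1 [← Real.exp_log hx0]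
      rw [← Real.exp_sub]
      exact Real.exp_lt_exp.mpr (by linarith)
    · rw [← Real.exp_log hl0']
      nth_rw 1 [← Real.exp_log hx0]
      rw [← Real.exp_add]
      exact Real.exp_lt_exp.mpr (by linarith)
  have haz : ∀ l, a l ≠ 0 → z < l := by
    intro l hl
    have h := (harange l hl).2.1
    rw [div_lt_iff₀ he0] at h
    have : (z:ℝ) < l := by nlinarith
    exact_mod_cast this
  have hNpos : (0:ℝ) < N := lt_of_lt_of_le (by positivity) hN
  have hlogN : Real.log N ≤ Real.log x + 2 := by
    have h1 : Real.log N ≤ Real.log (4 * x) := Real.log_le_log hNpos hN'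
    rw [Real.log_mul (by norm_num) hx0.ne'] at h1
    have h4 : Real.log 4 ≤ 2 := by
      rw [Real.log_le_iff_le_exp (by norm_num)]
      have : Real.exp 2 = Real.exp 1 * Real.exp 1 := by rw [← Real.exp_add]; norm_num
      rw [this]
      nlinarith [Real.exp_one_gt_d9]
    linarith
  have hlN0 : 0 ≤ Real.log N := Real.log_natCast_nonneg N
  have hlog2 : (Nat.log 2 N + 1 : ℝ) ≤ 2 * (Real.log x + 3) := by
    have h : (Nat.log 2 N : ℝ) ≤ Real.logb 2 N := by
      exact_mod_cast Real.natLog_le_logb N 2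
    have h' : Real.logb 2 N ≤ 2 * Real.log N := by
      rw [Real.logb, div_le_iff₀ (Real.log_pos (by norm_num))]
      nlinarith [Real.log_two_gt_d9]
    linarith
  have hnonprime : (z:ℝ) ^ u * ∑ l ∈ (Finset.Icc 1 N).filter (fun l => ¬ l.Prime), La l ≤
      c0 / 8 * x := by
    refine le_trans ?_ h2
    refine mul_le_mul_of_nonneg_left ((nonprime_sum D N).trans ?_) (by positivity)
    have hs : (Nat.sqrt N : ℝ) ≤ 2 * Real.sqrt x := by
      calc (Nat.sqrt N : ℝ) ≤ Real.sqrt N := Real.nat_sqrt_le_real_sqrt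
        _ ≤ Real.sqrt (4 * x) := Real.sqrt_le_sqrt hN'
        _ = 2 * Real.sqrt x := by
          rw [Real.sqrt_mul (by norm_num), show (4:ℝ) = 2 ^ 2 by norm_num,
            Real.sqrt_sq (by norm_num)]
    set w := 2 * (Real.log x + 3)
    have : Real.log N ≤ w := by simp only [w]; linarith
    calc _ ≤ (2 * Real.sqrt x * w) * (w ^ n * w) := by gcongr
      _ = _ := by ring
  have hbad : 2 ^ n * Real.log N * (m * (9 * N / z)) ≤ c0 / 8 * x := by
    calc 2 ^ n * Real.log N * (m * (9 * N / z)) ≤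
        2 ^ n * (Real.log x + 3) * (m * (9 * (4 * x) / z)) := by
          gcongr; linarith
      _ = (2 ^ n * (Real.log x + 3) * 36 * m) * x / z := by ring
      _ ≤ (c0 / 8 * z) * x / z := by gcongr
      _ = _ := by field_simp
  have hexp := main_expand q u hu N a
  have herr := main_error hn D C1 hC1 q hq hI z hz2 hz u hu x hx N hN hN'
  set 𝒮 := Finset.powersetCard u (Finset.univ : Finset ι) with h𝒮
  have h𝒮c : (𝒮.card : ℝ) = m.choose u := by
    rw [h𝒮, Finset.card_powersetCard, Finset.card_univ]
  set M : ℝ := (m.choose u : ℝ) with hM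
  have hM0 : 0 ≤ M := by positivity
  have hsmall : (u / m : ℝ) * ∑ ψ ∈ psiE q u,
      ‖∑ l ∈ Finset.Icc 1 N, (a l : ℂ) * chi q ψ l‖ ≤ c0 / 4 * x := by
    refine (mul_le_mul_of_nonneg_left herr (by positivity)).trans ?_
    rw [div_mul_eq_mul_div, div_le_iff₀ hm0]
    nlinarith [mul_le_mul_of_nonneg_right h1 hx0.le]
  have hlow : M * (3 / 4 * c0 * x) ≤ ∑ S ∈ 𝒮, ∑ l ∈ Finset.Icc 1 N, a l * wS q S l := by
    refine le_trans (mul_le_mul_of_nonneg_left ?_ hM0) hexp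
    linarith
  have hup : ∑ S ∈ 𝒮, ∑ l ∈ Finset.Icc 1 N, a l * wS q S l ≤
      M * (c0 / 4 * x) + 2 ^ n * Real.log N * z ^ u * ∑ S ∈ 𝒮, ((goodP q a N S).card : ℝ) := by
    calc _ ≤ ∑ S ∈ 𝒮, (c0 / 4 * x + 2 ^ n * Real.log N * z ^ u * (goodP q a N S).card) := by
          refine Finset.sum_le_sum fun S hS => ?_
          have := inner_split D q hq z hz hz9 hz0 N a ha0 haL haz u S
            (Finset.mem_powersetCard.mp hS).2
          linarith
      _ = _ := by
          rw [Finset.sum_add_distrib, Finset.sum_const, nsmul_eq_mul, h𝒮c, ← Finset.mul_sum]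
  -- the good pairs
  set Gp : Finset ((_ : Finset ι) × ℕ) := 𝒮.sigma (fun S => goodP q a N S) with hGp
  have hGc : (Gp.card : ℝ) = ∑ S ∈ 𝒮, ((goodP q a N S).card : ℝ) := by
    rw [hGp, Finset.card_sigma]; push_cast; rfl
  rw [← hGc] at hup
  have hGlow : M * (c0 / 2 * x) ≤ 2 ^ n * Real.log N * z ^ u * Gp.card := by linarith
  set Kb : ℕ := N * 9 ^ u / z ^ u with hKb
  have hdlow : ∀ S ∈ 𝒮, z ^ u ≤ 9 ^ u * ∏ i ∈ S, q i := by
    intro S hS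
    rw [← (Finset.mem_powersetCard.mp hS).2, ← Finset.prod_const, ← Finset.prod_const,
      ← Finset.prod_mul_distrib]
    exact Finset.prod_le_prod (fun _ _ => Nat.zero_le _) fun i _ => hz9 i
  have hdpos : ∀ S : Finset ι, 0 < ∏ i ∈ S, q i := fun S =>
    Finset.prod_pos fun i _ => (Fact.out : (q i).Prime).pos
  have hmaps : ∀ g ∈ Gp, (g.2 - 1) / ∏ i ∈ g.1, q i ∈ Finset.Icc 1 Kb := by
    rintro ⟨S, p⟩ hg
    rw [hGp, Finset.mem_sigma] at hg
    obtain ⟨hS, hp⟩ := hg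
    simp only at hS hp ⊢
    obtain ⟨hp1, hpp, hap, hdv, hgd⟩ := (mem_goodP q a N S p).mp hp
    rw [Finset.mem_Icc] at hp1 ⊢
    have := hpp.two_le
    refine ⟨Nat.div_pos (Nat.le_of_dvd (by omega) hdv) (hdpos S), ?_⟩
    rw [hKb, Nat.le_div_iff_mul_le (by positivity)]
    calc (p - 1) / (∏ i ∈ S, q i) * z ^ u ≤
        (p - 1) / (∏ i ∈ S, q i) * (9 ^ u * ∏ i ∈ S, q i) := by gcongr; exact hdlow S hS
      _ = (p - 1) / (∏ i ∈ S, q i) * (∏ i ∈ S, q i) * 9 ^ u := by ring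
      _ = (p - 1) * 9 ^ u := by rw [Nat.div_mul_cancel hdv]
      _ ≤ N * 9 ^ u := by gcongr; omega
  have hMpos : 0 < M := by rw [hM]; exact_mod_cast Nat.choose_pos hum
  have hGne : Gp.Nonempty := by
    rw [Finset.nonempty_iff_ne_empty]
    intro h
    rw [h] at hGlow
    have : 0 < M * (c0 / 2 * x) := by positivity
    simp at hGlow; linarith
  have hKne : (Finset.Icc 1 Kb).Nonempty := by
    obtain ⟨g, hg⟩ := hGne
    exact ⟨_, hmaps g hg⟩
  obtain ⟨k, hk, hfib⟩ := Finset.exists_le_card_fiber_of_nsmul_le_card_of_maps_to (M := ℝ) (b := (Gp.card : ℝ) / Kb)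
    hmaps hKne (by
      rw [nsmul_eq_mul, Nat.card_Icc, Nat.add_sub_cancel]
      have : (Kb:ℝ) ≠ 0 := by
        have := Finset.nonempty_Icc.mp hKne
        exact_mod_cast (by omega : Kb ≠ 0)
      field_simp
      exact le_rfl)
  rw [Finset.mem_Icc] at hk
  set F := Gp.filter (fun g => (g.2 - 1) / ∏ i ∈ g.1, q i = k) with hF
  have hFp : ∀ g ∈ F, g.2.Prime ∧ a g.2 ≠ 0 ∧ g.2 = k * ∏ i ∈ g.1, q i + 1 ∧ ∀ i, ¬ q i ∣ k := by
    rintro ⟨S, p⟩ hg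
    rw [hF, Finset.mem_filter, hGp, Finset.mem_sigma] at hg
    obtain ⟨⟨hS, hp⟩, hk'⟩ := hg
    simp only at hS hp hk' ⊢
    obtain ⟨hp1, hpp, hap, hdv, hgd⟩ := (mem_goodP q a N S p).mp hp
    rw [hk'] at hgd
    refine ⟨hpp, hap, ?_, hgd⟩
    rw [← hk', Nat.div_mul_cancel hdv]
    have := hpp.one_le
    omega
  have hKpos : (0:ℝ) < Kb := by exact_mod_cast (by omega : 0 < Kb)
  have hFne : F.Nonempty := by
    rw [← Finset.card_pos]
    have : 0 < (Gp.card : ℝ) / Kb := by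
      have : (0:ℝ) < Gp.card := by exact_mod_cast Finset.card_pos.mpr hGne
      positivity
    exact_mod_cast this.trans_le hfib
  have hinj : Set.InjOn (fun g : (_ : Finset ι) × ℕ => g.2) F := by
    rintro ⟨S, p⟩ hg ⟨S', p'⟩ hg' h
    simp only at h
    subst h
    have e1 := (hFp _ hg).2.2.1
    have e2 := (hFp _ hg').2.2.1
    simp only at e1 e2
    have e3 : ∏ i ∈ S, q i = ∏ i ∈ S', q i := by
      have : k * ∏ i ∈ S, q i = k * ∏ i ∈ S', q i := by omega
      exact Nat.eq_of_mul_eq_mul_left (by omega) this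
    have : S = S' := by
      have aux : ∀ S : Finset ι, ∀ i, i ∈ S ↔ q i ∣ ∏ i ∈ S, q i := by
        intro S i
        refine ⟨fun h => Finset.dvd_prod_of_mem _ h, fun h => ?_⟩
        obtain ⟨j, hj, hd⟩ := (Prime.dvd_finsetProd_iff (Fact.out : (q i).Prime).prime _).mp h
        rw [hq ((Nat.prime_dvd_prime_iff_eq Fact.out Fact.out).mp hd)]
        exact hj
      ext i
      rw [aux S, aux S', e3]
    rw [this]
  refine ⟨k, hk.1, F.image (fun g => g.2), ?_, ?_, ?_⟩
  · intro p hp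
    obtain ⟨g, hg, rfl⟩ := Finset.mem_image.mp hp
    obtain ⟨f1, f2, f3, f4⟩ := hFp g hg
    obtain ⟨g1, g2, g3⟩ := harange _ f2
    exact ⟨f1, g1, g2, g3, haz _ f2, g.1, f3⟩
  · obtain ⟨g, hg⟩ := hFne
    exact (hFp g hg).2.2.2
  · rw [Finset.card_image_of_injOn hinj]
    have hKup : (Kb:ℝ) * z ^ u ≤ 4 * x * 9 ^ u := by
      have : Kb * z ^ u ≤ N * 9 ^ u := Nat.div_mul_le_self _ _
      calc (Kb:ℝ) * z ^ u ≤ N * 9 ^ u := by exact_mod_cast this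
        _ ≤ _ := by gcongr
    have hfib' : (Gp.card : ℝ) ≤ F.card * Kb := by
      rwa [div_le_iff₀ hKpos] at hfib
    have : M * (c0 / 2 * x) ≤ (2 ^ n * (Real.log x + 3) * (4 * 9 ^ u) * F.card) * x := by
      calc M * (c0 / 2 * x) ≤ 2 ^ n * Real.log N * z ^ u * Gp.card := hGlow
        _ ≤ 2 ^ n * (Real.log x + 3) * z ^ u * (F.card * Kb) := by
            gcongr; linarith
        _ = 2 ^ n * (Real.log x + 3) * F.card * (Kb * z ^ u) := by ring
        _ ≤ 2 ^ n * (Real.log x + 3) * F.card * (4 * x * 9 ^ u) := by gcongr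
        _ = _ := by ring
    have h' : M * (c0 / 2) ≤ 2 ^ n * (Real.log x + 3) * (4 * 9 ^ u) * F.card := by
      refine le_of_mul_le_mul_right ?_ hx0
      linarith
    linarith

end

section

structure FieldData (n : ℕ) (r mu La : ArithmeticFunction ℝ) (good : ℕ → Prop)
    (C1 Δ0 κ c0 : ℝ) : Prop where
  hn : 1 ≤ n
  ad : ArithData n r mu La
  C1_nonneg : 0 ≤ C1
  typeI : ∀ Q : Finset ℕ, (∀ q ∈ Q, q.Prime ∧ La q ≠ 0 ∧ Δ0 < q) →
    FamTypeI (fun i : Q => (i : ℕ)) n r C1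
  κ_pos : 0 < κ
  κ_le : κ ≤ 1
  c0_pos : 0 < c0
  scale : ∃ T0 : ℝ, ∀ T ≥ T0, ∃ x : ℝ, T ^ κ ≤ x ∧ x ≤ T ∧ ∀ N : ℕ, Real.exp 1 * x ≤ N →
    c0 * x ≤ ∑ l ∈ Finset.Icc 1 N, La l * tent (Real.log (l / x))
  good_of : ∀ p : ℕ, p.Prime → La p ≠ 0 → good p

lemma log_pow_le_rpow (a b : ℝ) (k : ℕ) (ε : ℝ) (hε : 0 < ε) :
    ∀ᶠ x : ℝ in Filter.atTop, a * (b * (Real.log x + 3)) ^ k ≤ x ^ ε := by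
  have h1 : (fun x : ℝ => (Real.log x + 3)) =O[Filter.atTop] Real.log := by
    refine (Asymptotics.isBigO_refl _ _).add ?_
    exact (Real.isLittleO_const_log_atTop (c := 3)).isBigO
  have h2 : (fun x : ℝ => a * (b * (Real.log x + 3)) ^ k) =O[Filter.atTop]
      (fun x => Real.log x ^ k) := by
    refine Asymptotics.IsBigO.const_mul_left ?_ a
    exact (h1.const_mul_left b).pow k
  have h3 : (fun x : ℝ => Real.log x ^ k) =o[Filter.atTop] (fun x => x ^ ε) := by
    have := isLittleO_log_rpow_rpow_atTop (k : ℝ) hε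
    simpa [Real.rpow_natCast] using this
  have h4 := (h2.trans_isLittleO h3).bound (c := 1) (by norm_num)
  filter_upwards [h4, Filter.eventually_ge_atTop 0] with x hx hx0
  rw [Real.norm_of_nonneg (Real.rpow_nonneg hx0 ε), one_mul] at hx
  exact (le_abs_self _).trans hx

set_option maxHeartbeats 2000000 in
lemma apply_pairs {n : ℕ} {r mu La : ArithmeticFunction ℝ} {good : ℕ → Prop}
    {C1 Δ0 κ c0 : ℝ} (F : FieldData n r mu La good C1 Δ0 κ c0) :
    ∃ B : ℕ, 1 ≤ B ∧ ∃ y0 : ℝ, ∀ y ≥ y0, ∀ Q : Finset ℕ,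
      (∀ q ∈ Q, q.Prime ∧ La q ≠ 0 ∧ y / Real.exp 1 < q ∧ (q:ℝ) < Real.exp 1 * y) →
      ∀ u : ℕ, 1 ≤ u → u ≤ Q.card →
      B * u * (u * Real.log y) ^ (2 ^ (2 * n) + 3) ≤ Q.card →
      B * u * Real.log y * Q.card ≤ y →
      ∃ k : ℕ, 1 ≤ k ∧ ∃ x : ℝ, y ^ u ≤ x ∧ x ≤ y ^ (B * u) ∧ ∃ P : Finset ℕ,
      (∀ p ∈ P, p.Prime ∧ La p ≠ 0 ∧ x / Real.exp 1 < p ∧ (p:ℝ) < Real.exp 1 * x ∧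
        (∀ q ∈ Q, q < p) ∧ ∃ d, d ∣ ∏ q ∈ Q, q ∧ p = k * d + 1) ∧ (∀ q ∈ Q, ¬ q ∣ k) ∧
      ((Q.card.choose u : ℕ) : ℝ) ≤ B * 9 ^ u * u * Real.log y * P.card := by
  obtain ⟨hn, ad, hC1, typeI, hκ, hκ1, hc0, ⟨T0, scale⟩, -⟩ := F
  set A := 2 ^ (2 * n) + 3 with hA
  set A0 := n * (16 * n + 38) with hA0
  set E := C1 * (2 * n + 2) + 6 with hE
  have hE0 : 0 ≤ E := by positivity
  have hA0' : 54 ≤ A0 := by nlinarith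
  obtain ⟨B0, hB0⟩ := exists_nat_ge (2 * A0 / κ)
  have hB0' : 1 ≤ B0 := by
    have : (1:ℝ) ≤ 2 * A0 / κ := by
      rw [le_div_iff₀ hκ]
      have : (54:ℝ) ≤ A0 := by exact_mod_cast hA0'
      linarith
    exact_mod_cast this.trans hB0
  set Bl : ℝ := B0 + 3 with hBl
  obtain ⟨B, hB⟩ := exists_nat_ge (max (max (B0:ℝ) (4 * E * Bl ^ A / c0))
    (max (2 ^ n * 36 * Bl * 8 / c0) (8 * 2 ^ n * Bl / c0)))
  simp only [max_le_iff] at hB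
  obtain ⟨⟨hBB0, hBh1⟩, hBh3, hBf⟩ := hB
  have hBB0' : B0 ≤ B := by exact_mod_cast hBB0
  obtain ⟨x0, hx0⟩ := Filter.eventually_atTop.mp
    (log_pow_le_rpow (16 / c0) 2 (n + 2) (1 / 4) (by norm_num))
  refine ⟨B, by omega, max (max 9 T0) (max x0 (Real.exp 1 * Δ0)), ?_⟩
  intro y hy Q hQ u hu huQ hi hii
  simp only [ge_iff_le, max_le_iff] at hy
  obtain ⟨⟨hy9, hyT⟩, hyx, hyΔ⟩ := hy
  have he := Real.exp_one_lt_d9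
  have he2 := Real.exp_one_gt_d9
  have he0 : 0 < Real.exp 1 := Real.exp_pos 1
  have hy0 : 0 < y := by linarith
  have hly : 1 ≤ Real.log y := by
    rw [Real.le_log_iff_exp_le hy0]; linarith
  set z := ⌊Real.exp 1 * y⌋₊ with hz
  have hzle : (z:ℝ) ≤ Real.exp 1 * y := Nat.floor_le (by positivity)
  have hzlt : Real.exp 1 * y < z + 1 := Nat.lt_floor_add_one _
  have hyz : y ≤ z := by nlinarith
  have hzy : (z:ℝ) ≤ y ^ 2 := by nlinarith
  have hz3 : (3:ℝ) ≤ z := by linarith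
  have hu' : (1:ℝ) ≤ u := by exact_mod_cast hu
  -- the scale
  set T : ℝ := (z:ℝ) ^ ((A0 * u : ℝ) / κ) with hT
  have hA0r : (54:ℝ) ≤ A0 := by exact_mod_cast hA0'
  have hexpo : 1 ≤ (A0 * u : ℝ) / κ := by
    rw [le_div_iff₀ hκ]; nlinarith
  have hTz : (z:ℝ) ≤ T := by
    calc (z:ℝ) = (z:ℝ) ^ (1:ℝ) := by rw [Real.rpow_one]
      _ ≤ T := Real.rpow_le_rpow_of_exponent_le (by linarith) hexpo
  obtain ⟨x, hx1, hx2, hxs⟩ := scale T (by linarith)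
  have hTκ : T ^ κ = (z:ℝ) ^ (A0 * u) := by
    rw [hT, ← Real.rpow_mul (by linarith), div_mul_cancel₀ _ hκ.ne', ← Real.rpow_natCast]
    push_cast; rfl
  rw [hTκ] at hx1
  have hzx : (z:ℝ) ≤ x := by
    refine le_trans (le_self_pow₀ (by linarith) ?_) hx1
    positivity
  have hxpos : 0 < x := by linarith
  have hxle : x ≤ y ^ (B0 * u) := by
    calc x ≤ T := hx2
      _ ≤ (y ^ 2) ^ ((A0 * u : ℝ) / κ) := by rw [hT]; gcongr
      _ = y ^ ((2 * A0 / κ) * u) := by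
        rw [← Real.rpow_natCast, ← Real.rpow_mul hy0.le]; congr 1; push_cast; ring
      _ ≤ y ^ ((B0 * u : ℕ) : ℝ) := by
        apply Real.rpow_le_rpow_of_exponent_le (by linarith)
        push_cast; gcongr
      _ = _ := Real.rpow_natCast _ _
  have hΛ : Real.log x + 3 ≤ Bl * (u * Real.log y) := by
    have : Real.log x ≤ Real.log (y ^ (B0 * u)) := Real.log_le_log hxpos hxle
    rw [Real.log_pow] at this
    push_cast at this
    have : 1 ≤ u * Real.log y := one_le_mul_of_one_le_of_one_le hu' hly
    rw [hBl]; nlinarith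
  have hlx : 0 ≤ Real.log x := Real.log_nonneg (by linarith)
  have hN : (⌈Real.exp 1 * x⌉₊ : ℝ) ≤ 4 * x := by
    have := Nat.ceil_lt_add_one (show 0 ≤ Real.exp 1 * x by positivity)
    nlinarith
  have hfact : ∀ i : Q, Fact (i : ℕ).Prime := fun i => ⟨(hQ i i.2).1⟩
  have hBpos : (0:ℝ) < B := by exact_mod_cast (by omega : 0 < B)
  have huly : 0 ≤ u * Real.log y := by positivity
  obtain ⟨k, hk, P, hP, hkQ, hcount⟩ := main_pairs hn ad C1 hC1 c0 hc0 (fun i : Q => (i : ℕ))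
    Subtype.val_injective (typeI Q fun q hq => ⟨(hQ q hq).1, (hQ q hq).2.1, by
      have h1 := (hQ q hq).2.2.1
      rw [div_lt_iff₀ he0] at h1
      have : Real.exp 1 * Δ0 < Real.exp 1 * q := by linarith
      exact lt_of_mul_lt_mul_left this he0.le⟩) z (by exact_mod_cast hz3)
    (fun i => Nat.le_floor (hQ i i.2).2.2.2.le) (fun i => by
      have h1 := (hQ i i.2).2.2.1
      rw [div_lt_iff₀ he0] at h1
      have : (z:ℝ) ≤ 9 * (i:ℕ) := by nlinarith
      exact_mod_cast this) u hu (by simpa using huQ) x hx1 ⌈Real.exp 1 * x⌉₊ (Nat.le_ceil _) hN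
    (hxs _ (Nat.le_ceil _)) (by
      rw [Fintype.card_coe]
      calc 4 * E * u * (Real.log x + 3) ^ A ≤ 4 * E * u * (Bl * (u * Real.log y)) ^ A := by gcongr
        _ = (4 * E * Bl ^ A) * (u * (u * Real.log y) ^ A) := by rw [mul_pow]; ring
        _ ≤ (c0 * B) * (u * (u * Real.log y) ^ A) := by
            rw [div_le_iff₀ hc0] at hBh1
            exact mul_le_mul_of_nonneg_right (by linarith) (by positivity)
        _ = c0 * (B * u * (u * Real.log y) ^ A) := by ring
        _ ≤ _ := by gcongr) (by
      have h := hx0 x (by linarith)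
      have hzq : (z:ℝ) ^ u ≤ x ^ (1 / 4 : ℝ) := by
        have h4 : ((z:ℝ) ^ u) ^ 4 ≤ x := by
          refine le_trans ?_ hx1
          rw [← pow_mul]
          exact pow_le_pow_right₀ (by linarith) (by nlinarith)
        calc (z:ℝ) ^ u = (((z:ℝ) ^ u) ^ 4) ^ (1 / 4 : ℝ) := by
              rw [← Real.rpow_natCast ((z:ℝ) ^ u) 4, ← Real.rpow_mul (by positivity)]
              norm_num
          _ ≤ _ := by gcongr
      calc (z:ℝ) ^ u * (2 * Real.sqrt x * (2 * (Real.log x + 3)) ^ (n + 2))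
          ≤ x ^ (1 / 4 : ℝ) * (2 * Real.sqrt x * (2 * (Real.log x + 3)) ^ (n + 2)) := by gcongr
        _ = (c0 / 8) * (x ^ (1 / 4 : ℝ) * Real.sqrt x) *
            (16 / c0 * (2 * (Real.log x + 3)) ^ (n + 2)) := by field_simp; ring
        _ ≤ (c0 / 8) * (x ^ (1 / 4 : ℝ) * Real.sqrt x) * x ^ (1 / 4 : ℝ) := by gcongr
        _ = c0 / 8 * x := by
            rw [Real.sqrt_eq_rpow, mul_assoc, ← Real.rpow_add hxpos, ← Real.rpow_add hxpos]
            norm_num) (by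
      rw [Fintype.card_coe]
      rw [div_le_iff₀ hc0] at hBh3
      calc 2 ^ n * (Real.log x + 3) * 36 * Q.card ≤
          2 ^ n * (Bl * (u * Real.log y)) * 36 * Q.card := by gcongr
        _ = (2 ^ n * 36 * Bl * 8) / 8 * (u * Real.log y * Q.card) := by ring
        _ ≤ (B * c0) / 8 * (u * Real.log y * Q.card) := by gcongr
        _ = c0 / 8 * (B * u * Real.log y * Q.card) := by ring
        _ ≤ c0 / 8 * z := by gcongr; linarith)
  refine ⟨k, hk, x, ?_, ?_, P, ?_, ?_, ?_⟩
  · refine le_trans ?_ hx1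
    calc y ^ u ≤ (z:ℝ) ^ u := by gcongr
      _ ≤ _ := pow_le_pow_right₀ (by linarith) (by nlinarith)
  · refine hxle.trans (pow_le_pow_right₀ (by linarith) ?_)
    gcongr
  · intro p hp
    obtain ⟨h1, h2, h3, h4, h5, S, h6⟩ := hP p hp
    refine ⟨h1, h2, h3, h4, fun q hq => lt_of_le_of_lt (Nat.le_floor (hQ q hq).2.2.2.le) h5,
      ∏ i ∈ S, (i : ℕ), ?_, h6⟩
    rw [← Finset.prod_coe_sort Q]
    exact Finset.prod_dvd_prod_of_subset _ _ _ (Finset.subset_univ S)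
  · intro q hq
    exact hkQ ⟨q, hq⟩
  · rw [Fintype.card_coe] at hcount
    rw [div_le_iff₀ hc0] at hBf
    refine le_of_mul_le_mul_left ?_ hc0
    calc c0 * ((Q.card.choose u : ℕ) : ℝ) ≤ 8 * 2 ^ n * 9 ^ u * (Real.log x + 3) * P.card := hcount
      _ ≤ 8 * 2 ^ n * 9 ^ u * (Bl * (u * Real.log y)) * P.card := by gcongr
      _ = (8 * 2 ^ n * Bl) * (9 ^ u * u * Real.log y * P.card) := by ring
      _ ≤ (B * c0) * (9 ^ u * u * Real.log y * P.card) := by gcongr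
      _ = _ := by ring

end

section

lemma log_N_le (x : ℝ) (hx : 1 ≤ x) (N : ℕ) (hN0 : (0:ℝ) < N) (hN' : (N:ℝ) ≤ 4 * x) :
    Real.log N ≤ Real.log x + 2 := by
  have h1 : Real.log N ≤ Real.log (4 * x) := Real.log_le_log hN0 hN'
  rw [Real.log_mul (by norm_num) (by linarith)] at h1
  have h4 : Real.log 4 ≤ 2 := by
    rw [Real.log_le_iff_le_exp (by norm_num)]
    have : Real.exp 2 = Real.exp 1 * Real.exp 1 := by rw [← Real.exp_add]; norm_num
    rw [this]
    nlinarith [Real.exp_one_gt_d9]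
  linarith

lemma nonprime_bound {n : ℕ} {r mu La : ArithmeticFunction ℝ} (D : ArithData n r mu La)
    (x : ℝ) (hx : 1 ≤ x) (N : ℕ) (hN0 : (0:ℝ) < N) (hN' : (N:ℝ) ≤ 4 * x) :
    ∑ l ∈ (Finset.Icc 1 N).filter (fun l => ¬ l.Prime), La l ≤
      2 * Real.sqrt x * (2 * (Real.log x + 3)) ^ (n + 2) := by
  have hlogN := log_N_le x hx N hN0 hN'
  have hlN0 : 0 ≤ Real.log N := Real.log_natCast_nonneg N
  have hlog : 0 ≤ Real.log x := Real.log_nonneg hx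
  have hlog2 : (Nat.log 2 N + 1 : ℝ) ≤ 2 * (Real.log x + 3) := by
    have h : (Nat.log 2 N : ℝ) ≤ Real.logb 2 N := by
      exact_mod_cast Real.natLog_le_logb N 2
    have h' : Real.logb 2 N ≤ 2 * Real.log N := by
      rw [Real.logb, div_le_iff₀ (Real.log_pos (by norm_num))]
      nlinarith [Real.log_two_gt_d9]
    linarith
  refine (nonprime_sum D N).trans ?_
  have hs : (Nat.sqrt N : ℝ) ≤ 2 * Real.sqrt x := by
    calc (Nat.sqrt N : ℝ) ≤ Real.sqrt N := Real.nat_sqrt_le_real_sqrt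
      _ ≤ Real.sqrt (4 * x) := Real.sqrt_le_sqrt hN'
      _ = 2 * Real.sqrt x := by
        rw [Real.sqrt_mul (by norm_num), show (4:ℝ) = 2 ^ 2 by norm_num,
          Real.sqrt_sq (by norm_num)]
  set w := 2 * (Real.log x + 3)
  have : Real.log N ≤ w := by simp only [w]; linarith
  calc _ ≤ (2 * Real.sqrt x * w) * (w ^ n * w) := by gcongr
    _ = _ := by ring

lemma tent_log_range {x : ℝ} (hx0 : 0 < x) {l : ℕ} (hl0 : l ≠ 0)
    (h : tent (Real.log (l / x)) ≠ 0) : x / Real.exp 1 < l ∧ (l:ℝ) < Real.exp 1 * x := by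
  have ht := tent_pos h
  have hl0' : (0:ℝ) < l := by exact_mod_cast Nat.pos_of_ne_zero hl0
  rw [abs_lt, Real.log_div hl0'.ne' hx0.ne'] at ht
  refine ⟨?_, ?_⟩
  · rw [← Real.exp_log hl0']
    nth_rw 1 [← Real.exp_log hx0]
    rw [← Real.exp_sub]
    exact Real.exp_lt_exp.mpr (by linarith)
  · rw [← Real.exp_log hl0']
    nth_rw 1 [← Real.exp_log hx0]
    rw [← Real.exp_add]
    exact Real.exp_lt_exp.mpr (by linarith)

lemma many_primes {n : ℕ} {r mu La : ArithmeticFunction ℝ}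
    (D : ArithData n r mu La) {c0 : ℝ} (hc0 : 0 < c0) :
    ∃ y0 : ℝ, ∀ y ≥ y0, (∀ N : ℕ, Real.exp 1 * y ≤ N →
      c0 * y ≤ ∑ l ∈ Finset.Icc 1 N, La l * tent (Real.log (l / y))) →
      ∃ Q : Finset ℕ, Q.card = ⌊Real.sqrt y⌋₊ ∧
      ∀ q ∈ Q, q.Prime ∧ La q ≠ 0 ∧ y / Real.exp 1 < q ∧ (q:ℝ) < Real.exp 1 * y := by
  classical
  obtain ⟨x0, hx0⟩ := Filter.eventually_atTop.mp
    (log_pow_le_rpow (4 / c0) 2 (n + 2) (1 / 2) (by norm_num))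
  obtain ⟨x1, hx1⟩ := Filter.eventually_atTop.mp
    (log_pow_le_rpow (2 * 2 ^ n / c0) 1 1 (1 / 2) (by norm_num))
  refine ⟨max 9 (max x0 x1), fun y hy hsum => ?_⟩
  simp only [ge_iff_le, max_le_iff] at hy
  have h0 := hx0 y hy.2.1
  have h1 := hx1 y hy.2.2
  rw [← Real.sqrt_eq_rpow] at h0 h1
  have hy0 : 0 < y := by linarith
  set N := ⌈Real.exp 1 * y⌉₊ with hN
  have hN1 : Real.exp 1 * y ≤ N := Nat.le_ceil _
  have hNpos : (0:ℝ) < N := lt_of_lt_of_le (by positivity) hN1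
  have hN4 : (N : ℝ) ≤ 4 * y := by
    have := Nat.ceil_lt_add_one (show 0 ≤ Real.exp 1 * y by positivity)
    nlinarith [Real.exp_one_lt_d9]
  have hlog : 0 ≤ Real.log y := Real.log_nonneg (by linarith)
  have hlogN := log_N_le y (by linarith) N hNpos hN4
  have hnp := nonprime_bound D y (by linarith) N hNpos hN4
  set a : ℕ → ℝ := fun l => La l * tent (Real.log (l / y)) with ha
  set Q := (Finset.Icc 1 N).filter (fun l => l.Prime ∧ a l ≠ 0) with hQ
  have hsq : 0 ≤ Real.sqrt y := Real.sqrt_nonneg y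
  have hss : Real.sqrt y * Real.sqrt y = y := Real.mul_self_sqrt hy0.le
  have hnp2 : ∑ l ∈ (Finset.Icc 1 N).filter (fun l => ¬ l.Prime), a l ≤ c0 / 2 * y := by
    calc _ ≤ ∑ l ∈ (Finset.Icc 1 N).filter (fun l => ¬ l.Prime), La l :=
          Finset.sum_le_sum fun l _ => mul_le_of_le_one_right (D.La_nonneg l) (tent_le_one _)
      _ ≤ _ := hnp
      _ = (c0 / 2) * Real.sqrt y * (4 / c0 * (2 * (Real.log y + 3)) ^ (n + 2)) := by
          field_simp; ring
      _ ≤ (c0 / 2) * Real.sqrt y * Real.sqrt y := by gcongr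
      _ = _ := by rw [mul_assoc, hss]
  have hpr : ∑ l ∈ (Finset.Icc 1 N).filter (fun l => l.Prime), a l ≤
      Q.card * (2 ^ n * (Real.log y + 3)) := by
    rw [← Finset.sum_filter_ne_zero, Finset.filter_filter, ← hQ, ← nsmul_eq_mul]
    refine Finset.sum_le_card_nsmul _ _ _ fun l hl => ?_
    rw [hQ, Finset.mem_filter, Finset.mem_Icc] at hl
    obtain ⟨⟨h1, h2⟩, hp, -⟩ := hl
    have hl1 : (1:ℝ) ≤ l := by exact_mod_cast h1
    refine (mul_le_of_le_one_right (D.La_nonneg l) (tent_le_one _)).trans ((D.La_le l).trans ?_)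
    have h1 := D.r_le l
    rw [hp.divisors, Finset.card_pair hp.one_lt.ne] at h1
    refine mul_le_mul (by exact_mod_cast h1) ?_ (Real.log_nonneg hl1) (by positivity)
    have := Real.log_le_log (by linarith) (show (l:ℝ) ≤ N by exact_mod_cast h2)
    linarith
  have hs := hsum N hN1
  rw [← Finset.sum_filter_add_sum_filter_not _ (fun l => l.Prime)] at hs
  have hcard : Real.sqrt y ≤ Q.card := by
    have h2 : c0 / 2 * y ≤ Q.card * (2 ^ n * (Real.log y + 3)) := by linarith
    have h3 : 2 ^ n * (Real.log y + 3) ≤ c0 / 2 * Real.sqrt y := by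
      rw [pow_one, one_mul, div_mul_eq_mul_div, div_le_iff₀ hc0] at h1
      linarith
    have h4 : c0 / 2 * y ≤ Q.card * (c0 / 2 * Real.sqrt y) := h2.trans (by gcongr)
    have h5 : (c0 / 2 * Real.sqrt y) * Real.sqrt y ≤ (c0 / 2 * Real.sqrt y) * Q.card := by
      nlinarith
    exact le_of_mul_le_mul_left h5 (by positivity)
  obtain ⟨Q', hQ', hc⟩ := Finset.exists_subset_card_eq (s := Q) (n := ⌊Real.sqrt y⌋₊)
    (Nat.floor_le_of_le hcard)
  refine ⟨Q', hc, fun q hq => ?_⟩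
  have := hQ' hq
  rw [hQ, Finset.mem_filter, Finset.mem_Icc] at this
  obtain ⟨⟨h1, h2⟩, hp, h3⟩ := this
  exact ⟨hp, left_ne_zero_of_mul h3, tent_log_range hy0 (by omega) (right_ne_zero_of_mul h3)⟩

lemma choose_lower (m t : ℕ) (ht : 1 ≤ t) (h : 2 * t ≤ m) :
    ((m : ℝ) / (2 * t)) ^ t ≤ m.choose t := by
  have h1 := Nat.pow_le_choose (α := ℝ) t m
  refine le_trans ?_ h1
  have hf : ((t.factorial : ℕ) : ℝ) ≤ (t:ℝ) ^ t := by exact_mod_cast Nat.factorial_le_pow t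
  have hf0 : (0:ℝ) < t.factorial := by exact_mod_cast t.factorial_pos
  have ht0 : (0:ℝ) < t := by exact_mod_cast ht
  have hm : (m:ℝ) / 2 ≤ ((m + 1 - t : ℕ) : ℝ) := by
    rw [Nat.cast_sub (by omega)]
    push_cast
    have : (2 * t : ℝ) ≤ m := by exact_mod_cast h
    linarith
  calc ((m : ℝ) / (2 * t)) ^ t = ((m:ℝ) / 2) ^ t / t ^ t := by
        rw [← div_pow]; congr 1; field_simp
    _ ≤ ((m + 1 - t : ℕ) : ℝ) ^ t / t.factorial := by gcongr
    _ = _ := by norm_cast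

end

section

lemma unit_pow_eq_one (Q : Finset ℕ) (hQ : ∀ q ∈ Q, q.Prime) (e : ℕ)
    (he : ∀ q ∈ Q, q - 1 ∣ e) (L : ℕ) (hL : L = ∏ q ∈ Q, q) (a : (ZMod L)ˣ) : a ^ e = 1 := by
  have hLpos : 0 < L := hL ▸ Finset.prod_pos fun q hq => (hQ q hq).pos
  have : NeZero L := ⟨hLpos.ne'⟩
  have hcop : (a : ZMod L).val.Coprime L := ZMod.val_coe_unit_coprime a
  set v := (a : ZMod L).val with hv
  have hdvd : (L : ℤ) ∣ (v:ℤ) ^ e - 1 := by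
    rw [hL]
    push_cast
    refine Finset.prod_dvd_of_isRelPrime ?_ ?_
    · intro p hp q hq hpq
      refine IsCoprime.isRelPrime ?_
      rw [Nat.isCoprime_iff_coprime]
      exact (Nat.coprime_primes (hQ p hp) (hQ q hq)).mpr hpq
    · intro q hq
      have : Fact q.Prime := ⟨hQ q hq⟩
      have hvq : (v : ZMod q) ≠ 0 := by
        rw [Ne, ZMod.natCast_eq_zero_iff]
        intro hd
        have := Nat.dvd_gcd hd (Finset.dvd_prod_of_mem (fun q => q) hq)
        rw [← hL] at this
        rw [hcop] at this
        exact (hQ q hq).one_lt.ne' (Nat.dvd_one.mp this)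
      obtain ⟨c, hc⟩ := he q hq
      rw [← ZMod.intCast_zmod_eq_zero_iff_dvd]
      push_cast
      rw [hc, pow_mul, ZMod.pow_card_sub_one_eq_one hvq, one_pow, sub_self]
  have h1 : ((v:ℤ) ^ e - 1 : ZMod L) = 0 := by
    have := (ZMod.intCast_zmod_eq_zero_iff_dvd ((v:ℤ) ^ e - 1) L).mpr hdvd
    push_cast at this
    simpa using this
  ext
  push_cast
  have h2 : ((v : ℕ) : ZMod L) = a := by rw [hv, ZMod.natCast_val, ZMod.cast_id', id]
  rw [← h2]
  simpa [sub_eq_zero] using h1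

set_option maxHeartbeats 2000000 in
lemma step_one {n : ℕ} {r mu La : ArithmeticFunction ℝ} {good : ℕ → Prop}
    {C1 Δ0 κ c0 : ℝ} (F : FieldData n r mu La good C1 Δ0 κ c0) (W : ℕ) :
    ∃ B : ℕ, ∀ᶠ Y : ℕ in Filter.atTop, ∃ e : ℕ, 1 ≤ e ∧ (e:ℝ) ≤ Real.exp Y ∧
      ∃ x : ℝ, (Y:ℝ) ^ (3 * W) ≤ x ∧ x ≤ (Y:ℝ) ^ B ∧ ∃ Q : Finset ℕ, Q.card = Y ^ W ∧
      ∀ q ∈ Q, q.Prime ∧ La q ≠ 0 ∧ x / Real.exp 1 < q ∧ (q:ℝ) < Real.exp 1 * x ∧ q - 1 ∣ e := by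
  obtain ⟨B, hB, y0, hpairs⟩ := apply_pairs F
  obtain ⟨y1, hprimes⟩ := many_primes F.ad F.c0_pos
  obtain ⟨T0, hscale⟩ := F.scale
  have hκ := F.κ_pos
  have hκ1 := F.κ_le
  set A := 2 ^ (2 * n) + 3 with hA
  obtain ⟨u0', hu0'⟩ := exists_nat_ge (3 * W / κ)
  obtain ⟨u, hu, huW⟩ : ∃ u : ℕ, 1 ≤ u ∧ (3 * W : ℝ) ≤ κ * u := by
    refine ⟨u0' + 1, by omega, ?_⟩
    rw [div_le_iff₀ hκ] at hu0'
    push_cast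
    nlinarith
  have hu' : (1:ℝ) ≤ u := by exact_mod_cast hu
  have hB' : (1:ℝ) ≤ B := by exact_mod_cast hB
  -- conditions on y
  have hev := (((((log_pow_le_rpow (2 * (B * u)) u A (1 / 2) (by norm_num)).and
    (log_pow_le_rpow (B * u) 1 1 (1 / 2) (by norm_num))).and
    (log_pow_le_rpow ((4 * u) ^ u * B * 9 ^ u * u) 1 1 (u / 6) (by positivity))).and
    (Filter.eventually_ge_atTop (max y0 y1))).and
    (Filter.eventually_ge_atTop (max 9 ((4 * u : ℝ) ^ 2))))
  have hYκ : Filter.Tendsto (fun Y : ℕ => (Y:ℝ) ^ κ) Filter.atTop Filter.atTop :=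
    (tendsto_rpow_atTop hκ).comp tendsto_natCast_atTop_atTop
  obtain ⟨yb, hyb⟩ := Filter.eventually_atTop.mp hev
  refine ⟨B * u, ?_⟩
  filter_upwards [hYκ.eventually_ge_atTop yb,
    tendsto_natCast_atTop_atTop.eventually (log_pow_le_rpow (2 + B * u) 1 1 (1 / 2) (by norm_num)),
    tendsto_natCast_atTop_atTop.eventually (Filter.eventually_ge_atTop T0),
    Filter.eventually_ge_atTop 1] with Y hY1 hY2 hY3 hY4
  have hYr : (1:ℝ) ≤ Y := by exact_mod_cast hY4
  obtain ⟨y, hyκ, hyY, hsum⟩ := hscale Y hY3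
  obtain ⟨⟨⟨⟨c1, c2⟩, c3⟩, c4⟩, c5⟩ := hyb y (hY1.trans hyκ)
  simp only [max_le_iff] at c4 c5
  rw [← Real.sqrt_eq_rpow] at c1 c2 hY2
  rw [pow_one, one_mul] at c2 c3 hY2
  obtain ⟨Q0, hQ0c, hQ0⟩ := hprimes y c4.2 hsum
  have hy0 : 0 < y := by linarith
  have hly : 0 ≤ Real.log y := Real.log_nonneg (by linarith)
  have hsq : (4 * u : ℝ) ≤ Real.sqrt y := Real.le_sqrt_of_sq_le c5.2
  have hm1 : (Q0.card : ℝ) ≤ Real.sqrt y := by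
    rw [hQ0c]; exact Nat.floor_le (Real.sqrt_nonneg _)
  have hm2 : Real.sqrt y / 2 ≤ Q0.card := by
    have := Nat.lt_floor_add_one (Real.sqrt y)
    rw [hQ0c]; linarith
  have hss : Real.sqrt y * Real.sqrt y = y := Real.mul_self_sqrt hy0.le
  have h2u : 2 * u ≤ Q0.card := by
    have : (2 * u : ℝ) ≤ Q0.card := by linarith
    exact_mod_cast this
  obtain ⟨k, hk, x, hx1, hx2, P, hP, hkQ, hcount⟩ := hpairs y c4.1 Q0 hQ0 u hu (by omega) (by
      calc B * u * (u * Real.log y) ^ A ≤ B * u * (u * (Real.log y + 3)) ^ A := by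
            gcongr; linarith
        _ ≤ Real.sqrt y / 2 := by linarith
        _ ≤ _ := hm2) (by
      calc B * u * Real.log y * Q0.card ≤ B * u * (Real.log y + 3) * Real.sqrt y := by
            gcongr; linarith
        _ ≤ Real.sqrt y * Real.sqrt y := by gcongr
        _ = y := hss)
  have hxY : x ≤ (Y:ℝ) ^ (B * u) := hx2.trans (by gcongr)
  have hyu : ∀ s : ℝ, 0 ≤ s → (Y:ℝ) ^ (κ * s) ≤ y ^ s := by
    intro s hs
    rw [Real.rpow_mul (by positivity)]
    exact Real.rpow_le_rpow (by positivity) hyκ hs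
  have hPcard : (Y:ℝ) ^ W ≤ P.card := by
    have hcl := choose_lower Q0.card u hu h2u
    have h3 : (y ^ (u / 2 : ℝ)) / (4 * u) ^ u ≤ ((Q0.card : ℝ) / (2 * u)) ^ u := by
      calc (y ^ (u / 2 : ℝ)) / (4 * u) ^ u = (Real.sqrt y / (4 * u)) ^ u := by
            rw [div_pow, Real.sqrt_eq_rpow, ← Real.rpow_natCast (y ^ (1 / 2 : ℝ)),
              ← Real.rpow_mul hy0.le]
            congr 2; ring
        _ = ((Real.sqrt y / 2) / (2 * u)) ^ u := by congr 1; field_simp; norm_num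
        _ ≤ _ := by gcongr
    have h4 : (y ^ (u / 2 : ℝ)) ≤ (4 * u) ^ u * (B * 9 ^ u * u * Real.log y * P.card) := by
      have := h3.trans (hcl.trans hcount)
      rw [div_le_iff₀ (by positivity)] at this
      linarith
    have h5 : y ^ (u / 3 : ℝ) * y ^ (u / 6 : ℝ) ≤ P.card * y ^ (u / 6 : ℝ) := by
      calc y ^ (u / 3 : ℝ) * y ^ (u / 6 : ℝ) = y ^ (u / 2 : ℝ) := by
            rw [← Real.rpow_add hy0]; congr 1; ring
        _ ≤ _ := h4
        _ = P.card * ((4 * u) ^ u * B * 9 ^ u * u * Real.log y) := by ring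
        _ ≤ P.card * ((4 * u) ^ u * B * 9 ^ u * u * (Real.log y + 3)) := by gcongr; linarith
        _ ≤ _ := by gcongr
    have h6 := le_of_mul_le_mul_right h5 (by positivity)
    refine le_trans ?_ h6
    refine le_trans ?_ (hyu (u / 3) (by positivity))
    rw [← Real.rpow_natCast]
    exact Real.rpow_le_rpow_of_exponent_le hYr (by linarith)
  obtain ⟨Q, hQP, hQc⟩ := Finset.exists_subset_card_eq (s := P) (n := Y ^ W)
    (by exact_mod_cast hPcard)
  have hd0 : 0 < ∏ q ∈ Q0, q := Finset.prod_pos fun q hq => (hQ0 q hq).1.pos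
  refine ⟨k * ∏ q ∈ Q0, q, Nat.mul_pos hk hd0, ?_, x, ?_, hxY, Q, hQc, ?_⟩
  · obtain ⟨p, hp⟩ : P.Nonempty := by
      rw [← Finset.card_pos]
      have : (0:ℝ) < P.card := lt_of_lt_of_le (by positivity) hPcard
      exact_mod_cast this
    obtain ⟨-, -, -, hpx, -, d, hd, hpd⟩ := hP p hp
    have hd1 : 1 ≤ d := Nat.pos_of_dvd_of_pos hd hd0
    have hkp : (k:ℝ) ≤ p := by
      have : k ≤ p := by rw [hpd]; nlinarith
      exact_mod_cast this
    have hYpos : (0:ℝ) < Y := by linarith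
    have e1 : (k:ℝ) ≤ Real.exp (1 + (B * u) * Real.log Y) := by
      calc (k:ℝ) ≤ Real.exp 1 * (Y:ℝ) ^ (B * u) := hkp.trans (hpx.le.trans (by gcongr))
        _ = _ := by
          rw [Real.exp_add, mul_comm (B * u : ℝ), Real.exp_mul, Real.exp_log hYpos,
            ← Real.rpow_natCast]
          push_cast; rfl
    have hlY : 0 ≤ Real.log Y := Real.log_nonneg hYr
    have e2 : ((∏ q ∈ Q0, q : ℕ) : ℝ) ≤ Real.exp ((1 + Real.log Y) * Real.sqrt Y) := by
      push_cast
      calc ∏ q ∈ Q0, (q:ℝ) ≤ ∏ q ∈ Q0, Real.exp (1 + Real.log Y) := by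
            refine Finset.prod_le_prod (fun q _ => by positivity) fun q hq => ?_
            rw [Real.exp_add, Real.exp_log hYpos]
            exact (hQ0 q hq).2.2.2.le.trans (by gcongr)
        _ = Real.exp ((1 + Real.log Y) * Q0.card) := by
            rw [Finset.prod_const, ← Real.exp_nat_mul, mul_comm]
        _ ≤ _ := by
            have : Real.sqrt y ≤ Real.sqrt Y := Real.sqrt_le_sqrt hyY
            gcongr; linarith
    push_cast at e2 ⊢
    refine (mul_le_mul e1 e2 (by positivity) (by positivity)).trans ?_
    rw [← Real.exp_add]
    refine Real.exp_le_exp.mpr ?_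
    have hs1 : 1 ≤ Real.sqrt Y := by
      rw [Real.one_le_sqrt]; exact hYr
    have hsY : Real.sqrt Y * Real.sqrt Y = Y := Real.mul_self_sqrt (by linarith)
    have hBu : 0 ≤ (B * u : ℝ) := by positivity
    calc 1 + B * u * Real.log Y + (1 + Real.log Y) * Real.sqrt Y ≤
        (1 + B * u * Real.log Y) * Real.sqrt Y + (1 + Real.log Y) * Real.sqrt Y := by
          have : 0 ≤ 1 + B * u * Real.log Y := by positivity
          nlinarith
      _ ≤ ((2 + B * u) * (Real.log Y + 3)) * Real.sqrt Y := by
          rw [← add_mul]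
          gcongr
          nlinarith
      _ ≤ Real.sqrt Y * Real.sqrt Y := by gcongr
      _ = Y := hsY
  · refine le_trans ?_ hx1
    have := hyu u (by positivity)
    rw [Real.rpow_natCast] at this
    refine le_trans ?_ this
    rw [← Real.rpow_natCast]
    exact Real.rpow_le_rpow_of_exponent_le hYr (by push_cast; exact huW)
  · intro q hq
    obtain ⟨h1, h2, h3, h4, -, d, hd, hpd⟩ := hP q (hQP hq)
    refine ⟨h1, h2, h3, h4, ?_⟩
    rw [hpd, Nat.add_sub_cancel]
    exact Nat.mul_dvd_mul_left k hd

end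

section

set_option maxHeartbeats 2000000 in
lemma step_two {n : ℕ} {r mu La : ArithmeticFunction ℝ} {good : ℕ → Prop}
    {C1 Δ0 κ c0 : ℝ} (F : FieldData n r mu La good C1 Δ0 κ c0) :
    ∃ B : ℕ, 1 ≤ B ∧ ∀ᶠ Y : ℕ in Filter.atTop, ∃ k L e D xx : ℕ, ∃ P : Finset ℕ,
      0 < L ∧ k.Coprime L ∧ 0 < e ∧ (∀ a : (ZMod L)ˣ, a ^ e = 1) ∧
      (e:ℝ) * Real.log (Nat.totient L) < D ∧ (D:ℝ) ≤ Real.exp (2 * Y) ∧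
      (∀ p ∈ P, p.Prime ∧ good p ∧ p.Coprime L ∧ p ≤ xx ∧ ∃ d, d ∣ L ∧ p = k * d + 1) ∧
      2 ≤ xx ∧ (xx:ℝ) ≤ (Y:ℝ) ^ (B * Y) ∧ (Y:ℝ) ^ Y ≤ P.card := by
  obtain ⟨B, hB, y0, hpairs⟩ := apply_pairs F
  set A := 2 ^ (2 * n) + 3 with hA
  set W := 2 * A + 4 with hW
  have hW6 : 6 ≤ W := by
    have hA3 : 3 ≤ A := Nat.le_add_left _ _
    have : 2 * 1 + 4 ≤ 2 * A + 4 := by gcongr; exact le_trans (by norm_num) hA3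
    exact this
  obtain ⟨B1, hstep⟩ := step_one F W
  have hB' : (1:ℝ) ≤ B := by exact_mod_cast hB
  refine ⟨B1 * B * 2 + 1, by omega, ?_⟩
  have hexpo : ∀ᶠ Y : ℕ in Filter.atTop, (Y:ℝ) ^ (W + 2) + 1 ≤ Real.exp Y := by
    have h1 := (tendsto_natCast_atTop_atTop (R := ℝ)).eventually
      ((Real.isLittleO_pow_exp_atTop (n := W + 3)).bound (c := 1) (by norm_num))
    filter_upwards [h1, Filter.eventually_ge_atTop 2] with Y hY hY2
    have hY2' : (2:ℝ) ≤ Y := by exact_mod_cast hY2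
    rw [one_mul, Real.norm_of_nonneg (by positivity), Real.norm_of_nonneg (by positivity)] at hY
    refine le_trans ?_ hY
    rw [pow_succ _ (W + 2)]
    have : 1 ≤ (Y:ℝ) ^ (W + 2) := one_le_pow₀ (by linarith)
    nlinarith
  filter_upwards [hstep, Filter.eventually_ge_atTop ⌈y0⌉₊, Filter.eventually_ge_atTop (B + 9),
    (tendsto_natCast_atTop_atTop (R := ℝ)).eventually
      (log_pow_le_rpow (B1 + 1) 1 1 1 (by norm_num)), hexpo] with Y h1 h2 h3 h4 h5
  obtain ⟨e, he, heY, x, hx1, hx2, Q, hQc, hQ⟩ := h1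
  rw [pow_one, one_mul, Real.rpow_one] at h4
  have hYB : (B:ℝ) + 9 ≤ Y := by exact_mod_cast h3
  have hY1 : (1:ℝ) ≤ Y := by linarith
  have hYx : (Y:ℝ) ≤ x := by
    refine le_trans (le_self_pow₀ hY1 ?_) hx1
    omega
  have hx0 : 0 < x := by linarith
  have hly : 0 ≤ Real.log Y := Real.log_nonneg hY1
  have hlx0 : 0 ≤ Real.log x := Real.log_nonneg (by linarith)
  have hlx : Real.log x + 1 ≤ Y := by
    have := Real.log_le_log hx0 hx2
    rw [Real.log_pow] at this
    nlinarith [(Nat.cast_nonneg B1 : (0:ℝ) ≤ B1)]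
  have hQcr : (Q.card : ℝ) = (Y:ℝ) ^ W := by rw [hQc]; push_cast; rfl
  obtain ⟨k, hk, x2, hx21, hx22, P, hP, hkQ, hcount⟩ := hpairs x
    ((Nat.ceil_le.mp h2).trans hYx) Q (fun q hq => ⟨(hQ q hq).1, (hQ q hq).2.1, (hQ q hq).2.2.1,
      (hQ q hq).2.2.2.1⟩) Y (by omega) (by rw [hQc]; exact Nat.le_self_pow (by omega) Y) (by
      rw [hQcr]
      calc B * Y * (Y * Real.log x) ^ A ≤ Y * Y * (Y * Y) ^ A := by
            gcongr <;> linarith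
        _ = (Y:ℝ) ^ (2 * A + 2) := by rw [← sq, ← pow_mul]; ring
        _ ≤ (Y:ℝ) ^ W := pow_le_pow_right₀ hY1 (by omega)) (by
      rw [hQcr]
      calc B * Y * Real.log x * (Y:ℝ) ^ W ≤ Y * Y * Y * (Y:ℝ) ^ W := by
            gcongr <;> linarith
        _ = (Y:ℝ) ^ (W + 3) := by ring
        _ ≤ (Y:ℝ) ^ (3 * W) := pow_le_pow_right₀ hY1 (by omega)
        _ ≤ x := hx1)
  set L := ∏ q ∈ Q, q with hL
  have hLpos : 0 < L := Finset.prod_pos fun q hq => (hQ q hq).1.pos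
  have hx2Y : x ≤ x2 := by
    refine le_trans (le_self_pow₀ (by linarith) ?_) hx21
    omega
  have hL1 : (1:ℝ) ≤ L := by exact_mod_cast hLpos
  have hlogL : Real.log (Nat.totient L) ≤ (Y:ℝ) ^ (W + 1) := by
    have ht : (Nat.totient L : ℝ) ≤ L := by exact_mod_cast Nat.totient_le L
    have ht0 : (0:ℝ) < Nat.totient L := by exact_mod_cast Nat.totient_pos.mpr hLpos
    refine (Real.log_le_log ht0 ht).trans ?_
    rw [hL]
    push_cast
    rw [Real.log_prod fun q hq => by exact_mod_cast (hQ q hq).1.ne_zero]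
    calc ∑ q ∈ Q, Real.log q ≤ ∑ q ∈ Q, (Y:ℝ) := by
          refine Finset.sum_le_sum fun q hq => ?_
          have hq0 : (0:ℝ) < q := by exact_mod_cast (hQ q hq).1.pos
          have := Real.log_le_log hq0 (hQ q hq).2.2.2.1.le
          rw [Real.log_mul (Real.exp_pos 1).ne' hx0.ne', Real.log_exp] at this
          linarith
      _ = _ := by rw [Finset.sum_const, nsmul_eq_mul, hQcr]; ring
  have hfloor := Nat.lt_floor_add_one ((e:ℝ) * (Y:ℝ) ^ (W + 1))
  refine ⟨k, L, e, ⌊(e:ℝ) * (Y:ℝ) ^ (W + 1)⌋₊ + 1, ⌊Real.exp 1 * x2⌋₊, P, hLpos, ?_, he, ?_, ?_, ?_,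
    ?_, ?_, ?_, ?_⟩
  · rw [hL]
    refine Nat.Coprime.prod_right fun q hq => ?_
    rw [Nat.coprime_comm]
    exact (Nat.Prime.coprime_iff_not_dvd (hQ q hq).1).mpr (hkQ q hq)
  · exact unit_pow_eq_one Q (fun q hq => (hQ q hq).1) e (fun q hq => (hQ q hq).2.2.2.2) L hL
  · push_cast
    refine lt_of_le_of_lt ?_ hfloor
    gcongr
  · push_cast
    have hf := Nat.floor_le (show 0 ≤ (e:ℝ) * (Y:ℝ) ^ (W + 1) by positivity)
    have h6 : (e:ℝ) * (Y:ℝ) ^ (W + 1) ≤ Real.exp Y * (Y:ℝ) ^ (W + 2) := by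
      exact mul_le_mul heY (pow_le_pow_right₀ hY1 (by omega)) (by positivity) (by positivity)
    have h7 : Real.exp Y * ((Y:ℝ) ^ (W + 2) + 1) ≤ Real.exp (2 * Y) := by
      rw [two_mul, Real.exp_add]; gcongr
    have h8 : 1 ≤ Real.exp Y := Real.one_le_exp (by positivity)
    linarith
  · intro p hp
    obtain ⟨p1, p2, p3, p4, p5, d, hd, hpd⟩ := hP p hp
    refine ⟨p1, F.good_of p p1 p2, ?_, Nat.le_floor p4.le, d, hd, hpd⟩
    rw [hL]
    refine Nat.Coprime.prod_right fun q hq => ?_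
    exact (Nat.coprime_primes p1 (hQ q hq).1).mpr (p5 q hq).ne'
  · refine Nat.le_floor ?_
    push_cast
    nlinarith [Real.exp_one_gt_d9]
  · have hx2pos : 0 < x2 := by linarith
    refine (Nat.floor_le (by positivity)).trans ?_
    calc Real.exp 1 * x2 ≤ Y * x2 := by
          gcongr; linarith [Real.exp_one_lt_d9]
      _ ≤ Y ^ Y * ((Y:ℝ) ^ B1) ^ (B * Y) := by
          refine mul_le_mul (le_self_pow₀ hY1 (by omega)) (hx22.trans (by gcongr)) hx2pos.le
            (by positivity)
      _ = (Y:ℝ) ^ (Y + B1 * (B * Y)) := by rw [← pow_mul, ← pow_add]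
      _ ≤ _ := pow_le_pow_right₀ hY1 (by nlinarith [Nat.zero_le (B1*B*Y)])
  · have hcl := choose_lower Q.card Y (by omega) (by
      rw [hQc]
      calc 2 * Y ≤ Y * Y := by gcongr; omega
        _ = Y ^ 2 := by ring
        _ ≤ _ := Nat.pow_le_pow_right (by omega) (by omega))
    have h6 : ((Y:ℝ) ^ 4) ^ Y ≤ ((Q.card : ℝ) / (2 * Y)) ^ Y := by
      gcongr
      rw [le_div_iff₀ (by positivity), hQcr]
      calc (Y:ℝ) ^ 4 * (2 * Y) ≤ (Y:ℝ) ^ 4 * (Y * Y) := by gcongr; linarith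
        _ = (Y:ℝ) ^ 6 := by ring
        _ ≤ (Y:ℝ) ^ W := pow_le_pow_right₀ hY1 hW6
    have h7 := (h6.trans hcl).trans hcount
    have h8 : B * 9 ^ Y * Y * Real.log x * P.card ≤ ((Y:ℝ) ^ 3) ^ Y * P.card := by
      gcongr
      calc B * 9 ^ Y * Y * Real.log x ≤ Y * (Y:ℝ) ^ Y * Y * Y := by
            gcongr <;> linarith
        _ = (Y:ℝ) ^ (Y + 3) := by ring
        _ ≤ (Y:ℝ) ^ (3 * Y) := pow_le_pow_right₀ hY1 (by omega)
        _ = _ := by rw [pow_mul]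
    have h9 : ((Y:ℝ) ^ 3) ^ Y * (Y:ℝ) ^ Y ≤ ((Y:ℝ) ^ 3) ^ Y * P.card := by
      refine le_trans (le_of_eq ?_) (h7.trans h8)
      rw [← mul_pow]; ring
    exact le_of_mul_le_mul_left h9 (by positivity)

end

section

/-- Pure counting: the choice of parameters. -/
lemma final_arith (B Y D t xx N : ℕ) (X M : ℝ) (hB : 1 ≤ B) (hY : 1 ≤ Y)
    (hxx2 : 2 ≤ xx) (hxx : (xx:ℝ) ≤ (Y:ℝ) ^ (B * Y)) (hN : (Y:ℝ) ^ Y ≤ N)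
    (hNt : (2 * (t:ℝ)) ^ 2 ≤ N) (htD : 8 * D + 8 ≤ t) (hX0 : 1 ≤ X)
    (hX : X < (xx:ℝ) ^ (t + 1)) (hM0 : 0 ≤ M)
    (hcount : (N.choose t : ℝ) ≤ M * ((N:ℝ) + 1) ^ D) :
    X ^ (1 / (8 * (B:ℝ))) ≤ M := by
  have ht1 : (1:ℝ) ≤ t := by exact_mod_cast (by omega : 1 ≤ t)
  have hN4 : (4:ℝ) ≤ N := by nlinarith
  have hN0 : (0:ℝ) < N := by linarith
  have h2t : 2 * t ≤ N := by
    have : (2 * (t:ℝ)) ≤ N := by nlinarith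
    exact_mod_cast this
  have hcl := choose_lower N t (by omega) h2t
  have hB1 : (1:ℝ) ≤ B := by exact_mod_cast hB
  -- square everything
  have h1 : (N:ℝ) ^ t ≤ (((N:ℝ) / (2 * t)) ^ t) ^ 2 := by
    rw [← pow_mul, mul_comm t 2, pow_mul]
    gcongr
    rw [div_pow, le_div_iff₀ (by positivity), sq (N:ℝ)]
    gcongr
  have h2 : ((N:ℝ) + 1) ^ D ≤ (N:ℝ) ^ (2 * D) := by
    rw [pow_mul]
    gcongr
    nlinarith
  have h3 : (N:ℝ) ^ t ≤ (M * (N:ℝ) ^ (2 * D)) ^ 2 := by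
    refine h1.trans ?_
    gcongr
    refine (hcl.trans hcount).trans ?_
    gcongr
  have h4 : (N:ℝ) ^ (t + 1) ≤ (M ^ 2) ^ 2 := by
    have : (N:ℝ) ^ (4 * D) * (N:ℝ) ^ (t - 4 * D) ≤ (N:ℝ) ^ (4 * D) * M ^ 2 := by
      rw [← pow_add]
      calc (N:ℝ) ^ (4 * D + (t - 4 * D)) = (N:ℝ) ^ t := by congr 1; omega
        _ ≤ _ := h3
        _ = _ := by ring
    have h5 := le_of_mul_le_mul_left this (by positivity)
    calc (N:ℝ) ^ (t + 1) ≤ (N:ℝ) ^ ((t - 4 * D) * 2) :=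
          pow_le_pow_right₀ (by linarith) (by omega)
      _ = ((N:ℝ) ^ (t - 4 * D)) ^ 2 := by rw [pow_mul]
      _ ≤ _ := by gcongr
  have h5 : X ≤ M ^ (4 * B) := by
    refine hX.le.trans ?_
    calc (xx:ℝ) ^ (t + 1) ≤ ((Y:ℝ) ^ (B * Y)) ^ (t + 1) := by gcongr
      _ = (((Y:ℝ) ^ Y) ^ (t + 1)) ^ B := by
          rw [← pow_mul, ← pow_mul, ← pow_mul]; congr 1; ring
      _ ≤ ((N:ℝ) ^ (t + 1)) ^ B := by gcongr
      _ ≤ ((M ^ 2) ^ 2) ^ B := by gcongr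
      _ = M ^ (4 * B) := by rw [← pow_mul, ← pow_mul]; congr 1; ring
  calc X ^ (1 / (8 * (B:ℝ))) ≤ X ^ (1 / (4 * (B:ℝ))) := by
        apply Real.rpow_le_rpow_of_exponent_le hX0
        gcongr; norm_num
    _ ≤ (M ^ (4 * B)) ^ (1 / (4 * (B:ℝ))) := by gcongr
    _ = M := by
        have : (1 / (4 * (B:ℝ))) = (((4 * B : ℕ) : ℝ))⁻¹ := by push_cast; rw [one_div]
        rw [this, Real.pow_rpow_inv_natCast hM0 (by omega)]

set_option maxHeartbeats 1000000 in
theorem final_count {n : ℕ} {r mu La : ArithmeticFunction ℝ} {good : ℕ → Prop}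
    {C1 Δ0 κ c0 : ℝ} (F : FieldData n r mu La good C1 Δ0 κ c0) :
    ∃ c : ℝ, 0 < c ∧ ∀ᶠ X : ℝ in Filter.atTop,
      X ^ c ≤
        ({n : ℕ | (n : ℝ) ≤ X ∧ IsCarmichael n ∧
          ∀ p : ℕ, p.Prime → p ∣ n → good p}.ncard : ℝ) := by
  obtain ⟨B, hB, hev⟩ := step_two F
  have hB1 : (1:ℝ) ≤ B := by exact_mod_cast hB
  refine ⟨1 / (8 * (B:ℝ)), by positivity, ?_⟩
  -- eventual conditions on Y
  have hc1 : ∀ᶠ Y : ℕ in Filter.atTop, (17 * B : ℝ) * (Y:ℝ) ^ 2 ≤ Real.exp Y := by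
    have h1 := (tendsto_natCast_atTop_atTop (R := ℝ)).eventually
      ((Real.isLittleO_pow_exp_atTop (n := 2)).bound (c := (17 * B : ℝ)⁻¹) (by positivity))
    filter_upwards [h1] with Y hY
    rw [Real.norm_of_nonneg (by positivity), Real.norm_of_nonneg (by positivity)] at hY
    rwa [inv_mul_eq_div, le_div_iff₀' (by positivity)] at hY
  have hc2 : ∀ᶠ Y : ℕ in Filter.atTop, Real.exp 14 ≤ Y :=
    (tendsto_natCast_atTop_atTop (R := ℝ)).eventually_ge_atTop _
  have hall := ((hev.and hc1).and hc2).and (Filter.eventually_ge_atTop 12)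
  have hYX : Filter.Tendsto (fun X : ℝ => ⌊Real.log (Real.log X) / 5⌋₊) Filter.atTop Filter.atTop :=
    tendsto_nat_floor_atTop.comp
      ((Real.tendsto_log_atTop.comp Real.tendsto_log_atTop).atTop_div_const (by norm_num))
  filter_upwards [hYX.eventually hall, Filter.eventually_ge_atTop (Real.exp (Real.exp 5))]
    with X hX hXbig
  obtain ⟨⟨⟨⟨k, L, e, D, xx, P, hL, hkL, he, hexp, hD, hDY, hP, hxx2, hxxY, hPc⟩, h1⟩, h2⟩, h12⟩ := hX
  set Y := ⌊Real.log (Real.log X) / 5⌋₊ with hYdef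
  have hX0 : 0 < X := lt_of_lt_of_le (Real.exp_pos _) hXbig
  have hlogX : Real.exp 5 ≤ Real.log X := by
    rwa [Real.le_log_iff_exp_le hX0]
  have hlogX0 : 0 < Real.log X := lt_of_lt_of_le (Real.exp_pos _) hlogX
  have hloglog : 5 ≤ Real.log (Real.log X) := by
    rwa [Real.le_log_iff_exp_le hlogX0]
  have hlow : Real.exp (5 * Y) ≤ Real.log X := by
    rw [← Real.le_log_iff_exp_le hlogX0]
    have := Nat.floor_le (show 0 ≤ Real.log (Real.log X) / 5 by positivity)
    rw [← hYdef] at this; linarith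
  have hup : Real.log X ≤ Real.exp (5 * Y + 5) := by
    rw [← Real.log_le_iff_le_exp hlogX0]
    have := Nat.lt_floor_add_one (Real.log (Real.log X) / 5)
    rw [← hYdef] at this; linarith
  have hYr : (12:ℝ) ≤ Y := by exact_mod_cast h12
  have hxx0 : (0:ℝ) < xx := by exact_mod_cast (by omega : 0 < xx)
  have hxx2' : (2:ℝ) ≤ xx := by exact_mod_cast hxx2
  have hlxx : 0 < Real.log xx := Real.log_pos (by linarith)
  have hl2 : Real.log 2 ≤ Real.log xx := Real.log_le_log (by norm_num) hxx2'
  have hlxxup : Real.log xx ≤ B * (Y:ℝ) ^ 2 := by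
    have h := Real.log_le_log hxx0 hxxY
    rw [Real.log_pow] at h
    push_cast at h
    have h' := Real.log_le_self (show (0:ℝ) ≤ Y by positivity)
    refine h.trans ?_
    rw [sq, ← mul_assoc]
    gcongr
  set t := ⌊Real.log X / Real.log xx⌋₊ with ht
  have htle : (t:ℝ) * Real.log xx ≤ Real.log X := by
    have := Nat.floor_le (show 0 ≤ Real.log X / Real.log xx by positivity)
    rwa [← ht, le_div_iff₀ hlxx] at this
  have htlt : Real.log X < ((t:ℝ) + 1) * Real.log xx := by
    have := Nat.lt_floor_add_one (Real.log X / Real.log xx)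
    rwa [← ht, div_lt_iff₀ hlxx] at this
  have hxt : (xx:ℝ) ^ t ≤ X := by
    rw [← Real.log_le_log_iff (by positivity) hX0, Real.log_pow]; exact htle
  have hxt1 : X < (xx:ℝ) ^ (t + 1) := by
    rw [← Real.log_lt_log_iff hX0 (by positivity), Real.log_pow]; push_cast; exact htlt
  have hE1 : (1:ℝ) ≤ Real.exp (2 * Y) := Real.one_le_exp (by positivity)
  have htD : 8 * D + 8 ≤ t := by
    have h3 : Real.exp (5 * Y) ≤ ((t:ℝ) + 1) * Real.exp Y := by
      refine hlow.trans (htlt.le.trans ?_)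
      gcongr
      refine hlxxup.trans (le_trans ?_ h1)
      gcongr; linarith
    have h4 : Real.exp (4 * Y) ≤ (t:ℝ) + 1 := by
      have : Real.exp (5 * Y) = Real.exp (4 * Y) * Real.exp Y := by
        rw [← Real.exp_add]; ring_nf
      rw [this] at h3
      exact le_of_mul_le_mul_right h3 (Real.exp_pos _)
    have h5 : Real.exp (4 * Y) = Real.exp (2 * Y) * Real.exp (2 * Y) := by
      rw [← Real.exp_add]; ring_nf
    have h6 : 17 ≤ Real.exp (2 * Y) := by
      have := Real.add_one_le_exp (2 * (Y:ℝ)); linarith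
    have : (8 * (D:ℝ) + 8) ≤ t := by nlinarith
    exact_mod_cast this
  have hNt : (2 * (t:ℝ)) ^ 2 ≤ P.card := by
    refine le_trans ?_ hPc
    have h3 : 2 * (t:ℝ) ≤ Real.exp (5 * Y + 5 + 2) := by
      have hl : (1:ℝ)/2 ≤ Real.log xx := by
        have := Real.log_two_gt_d9; linarith
      have h4 : (t:ℝ) * (1/2) ≤ Real.exp (5 * Y + 5) := by
        refine le_trans ?_ (htle.trans hup)
        gcongr
      have h5 : (4:ℝ) ≤ Real.exp 2 := by
        have : Real.exp 2 = Real.exp 1 * Real.exp 1 := by rw [← Real.exp_add]; norm_num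
        rw [this]; nlinarith [Real.exp_one_gt_d9]
      rw [Real.exp_add]
      nlinarith [Real.exp_pos (5 * (Y:ℝ) + 5)]
    calc (2 * (t:ℝ)) ^ 2 ≤ (Real.exp (5 * Y + 5 + 2)) ^ 2 := by gcongr
      _ = Real.exp (10 * Y + 14) := by rw [← Real.exp_nat_mul]; push_cast; ring_nf
      _ ≤ Real.exp (Y * 14) := by gcongr; linarith
      _ = (Real.exp 14) ^ Y := by rw [Real.exp_nat_mul]
      _ ≤ _ := by gcongr
  have hcount := agp_count good k L e D t xx hL hkL he hexp hD P hP (by omega)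
  have hmono : {n : ℕ | n ≤ xx ^ t ∧ IsCarmichael n ∧
      ∀ p : ℕ, p.Prime → p ∣ n → good p}.ncard ≤ {n : ℕ | (n : ℝ) ≤ X ∧ IsCarmichael n ∧
          ∀ p : ℕ, p.Prime → p ∣ n → good p}.ncard := by
    apply Set.ncard_le_ncard
    · rintro m ⟨hm1, hm2⟩
      refine ⟨le_trans ?_ hxt, hm2⟩
      exact_mod_cast hm1
    · refine (Set.finite_Iic ⌊X⌋₊).subset ?_
      rintro m ⟨hm1, hm2⟩
      exact Nat.le_floor hm1
  refine final_arith B Y D t xx P.card X _ hB (by omega) hxx2 hxxY hPc hNt htD ?_ hxt1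
    (Nat.cast_nonneg _) ?_
  · refine le_trans (Real.one_le_exp (Real.exp_pos _).le) hXbig
  · have := hcount.trans (Nat.mul_le_mul_right _ hmono)
    exact_mod_cast this

end

section

open NumberField Ideal

/-- Ideals of norm `l`. -/
noncomputable def idSet (K : Type*) [Field K] [NumberField K] (l : ℕ) : Finset (Ideal (𝓞 K)) :=
  (Ideal.finite_setOfPred_absNorm_eq l).toFinset

lemma mem_idSet {K : Type*} [Field K] [NumberField K] {l : ℕ} {I : Ideal (𝓞 K)} :
    I ∈ idSet K l ↔ absNorm I = l := by
  simp [idSet]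

/-- Sum of `g` over ideals of given norm. -/
noncomputable def pushI {K : Type*} [Field K] [NumberField K] (g : Ideal (𝓞 K) → ℝ) :
    ArithmeticFunction ℝ :=
  ⟨fun l => if l = 0 then 0 else ∑ I ∈ idSet K l, g I, by simp⟩

lemma pushI_apply {K : Type*} [Field K] [NumberField K] (g : Ideal (𝓞 K) → ℝ) {l : ℕ}
    (hl : l ≠ 0) : pushI g l = ∑ I ∈ idSet K l, g I := by
  change (if l = 0 then 0 else ∑ I ∈ idSet K l, g I) = _
  rw [if_neg hl]

open Classical in
/-- Divisors of an ideal. -/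
noncomputable def idDiv {K : Type*} [Field K] [NumberField K] (I : Ideal (𝓞 K)) :
    Finset (Ideal (𝓞 K)) :=
  ((absNorm I).divisors.biUnion (idSet K)).filter (· ∣ I)

lemma mem_idDiv {K : Type*} [Field K] [NumberField K] {I A : Ideal (𝓞 K)} (hI : I ≠ ⊥) :
    A ∈ idDiv I ↔ A ∣ I := by
  have h0 : absNorm I ≠ 0 := by rwa [Ne, absNorm_eq_zero_iff]
  simp only [idDiv, Finset.mem_filter, Finset.mem_biUnion, Nat.mem_divisors, mem_idSet]
  constructor
  · exact fun h => h.2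
  · exact fun h => ⟨⟨absNorm A, ⟨map_dvd absNorm h, h0⟩, rfl⟩, h⟩

lemma pushI_mul_one {K : Type*} [Field K] [NumberField K] (g : Ideal (𝓞 K) → ℝ) {l : ℕ}
    (hl : l ≠ 0) :
    (pushI g * pushI (K := K) fun _ => 1) l = ∑ I ∈ idSet K l, ∑ A ∈ idDiv I, g A := by
  classical
  rw [ArithmeticFunction.mul_apply]
  trans ∑ p ∈ l.divisorsAntidiagonal, ∑ A ∈ idSet K p.1, ∑ B ∈ idSet K p.2, g A
  · refine Finset.sum_congr rfl fun p hp => ?_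
    rw [Nat.mem_divisorsAntidiagonal] at hp
    have h1 : p.1 ≠ 0 := fun h => hp.2 (by rw [← hp.1, h, zero_mul])
    have h2 : p.2 ≠ 0 := fun h => hp.2 (by rw [← hp.1, h, mul_zero])
    rw [pushI_apply _ h1, pushI_apply _ h2, Finset.sum_mul_sum]
    simp
  · simp_rw [← Finset.sum_product']
    rw [Finset.sum_sigma', Finset.sum_sigma']
    refine Finset.sum_bij (fun x _ => ⟨x.2.1 * x.2.2, x.2.1⟩) ?_ ?_ ?_ ?_
    · rintro ⟨⟨a, b⟩, A, B⟩ h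
      simp only [Finset.mem_sigma, Nat.mem_divisorsAntidiagonal, Finset.mem_product,
        mem_idSet] at h ⊢
      obtain ⟨⟨rfl, _⟩, rfl, rfl⟩ := h
      refine ⟨map_mul _ _ _, ?_⟩
      rw [mem_idDiv]
      · exact dvd_mul_right _ _
      · rw [Ne, ← absNorm_eq_zero_iff, map_mul]; exact hl
    · rintro ⟨⟨a, b⟩, A, B⟩ h ⟨⟨a', b'⟩, A', B'⟩ h' heq
      simp only [Finset.mem_sigma, Nat.mem_divisorsAntidiagonal, Finset.mem_product,
        mem_idSet] at h h'
      obtain ⟨⟨rfl, _⟩, rfl, rfl⟩ := h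
      obtain ⟨_, rfl, rfl⟩ := h'
      simp only [Sigma.mk.injEq, heq_eq_eq] at heq
      obtain ⟨h1, rfl⟩ := heq
      have hA : A ≠ 0 := by
        rintro rfl
        apply hl
        simp
      have := mul_left_cancel₀ hA h1
      subst this
      rfl
    · rintro ⟨I, A⟩ h
      simp only [Finset.mem_sigma, mem_idSet] at h
      have hI : I ≠ ⊥ := by rw [Ne, ← absNorm_eq_zero_iff, h.1]; exact hl
      rw [mem_idDiv hI] at h
      obtain ⟨h1, B, rfl⟩ := h
      refine ⟨⟨(absNorm A, absNorm B), (A, B)⟩, ?_, rfl⟩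
      simp only [Finset.mem_sigma, Nat.mem_divisorsAntidiagonal, Finset.mem_product, mem_idSet]
      exact ⟨⟨by rw [← map_mul]; exact h1, hl⟩, trivial, trivial⟩
    · rintro ⟨⟨a, b⟩, A, B⟩ h
      rfl

open Classical in
/-- Moebius function on ideals. -/
noncomputable def muI {K : Type*} [Field K] [NumberField K] (I : Ideal (𝓞 K)) : ℝ :=
  if Squarefree I then (-1) ^ (Multiset.card (UniqueFactorizationMonoid.normalizedFactors I)) else 0

lemma muI_abs_le {K : Type*} [Field K] [NumberField K] (I : Ideal (𝓞 K)) : |muI I| ≤ 1 := by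
  unfold muI
  split_ifs <;> simp

lemma muI_prime_mul {K : Type*} [Field K] [NumberField K] (P B : Ideal (𝓞 K)) (hP : Prime P)
    (hB : B ≠ 0) (h : ¬ P ∣ B) : muI (P * B) = - muI B := by
  unfold muI
  have hsq : Squarefree (P * B) ↔ Squarefree B := by
    have hrel : IsRelPrime P B := by
      intro d hd1 hd2
      rcases hP.irreducible.dvd_iff.mp hd1 with h1 | h1
      · exact h1
      · exact absurd (h1.dvd.trans hd2) h
    rw [squarefree_mul_iff]
    exact ⟨fun h => h.2.2, fun h => ⟨hrel, hP.irreducible.squarefree, h⟩⟩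
  by_cases hs : Squarefree B
  · rw [if_pos hs, if_pos (hsq.mpr hs),
      UniqueFactorizationMonoid.normalizedFactors_mul hP.ne_zero hB,
      UniqueFactorizationMonoid.normalizedFactors_irreducible hP.irreducible]
    simp [pow_add]
  · rw [if_neg hs, if_neg (hsq.not.mpr hs), neg_zero]

lemma sum_muI {K : Type*} [Field K] [NumberField K] (I : Ideal (𝓞 K)) (hI : I ≠ ⊥) (h1 : I ≠ ⊤) :
    ∑ A ∈ idDiv I, muI A = 0 := by
  classical
  obtain ⟨P, hPI, hP⟩ : ∃ P, Irreducible P ∧ P ∣ I :=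
    WfDvdMonoid.exists_irreducible_factor (by rwa [Ideal.isUnit_iff]) hI
  have hPp : Prime P := hPI.prime
  rw [← Finset.sum_filter_add_sum_filter_not _ (fun A => P ∣ A)]
  have hnz : ∀ A, A ∣ I → A ≠ 0 := fun A hA h => hI (by rw [h] at hA; exact zero_dvd_iff.mp hA)
  have key : ∑ A ∈ (idDiv I).filter (fun A => P ∣ A), muI A =
      ∑ B ∈ (idDiv I).filter (fun A => ¬ P ∣ A), muI (P * B) := by
    rw [← Finset.sum_subset (s₁ := ((idDiv I).filter (fun A => ¬ P ∣ A)).image (fun B => P * B))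
      (s₂ := (idDiv I).filter (fun A => P ∣ A))]
    · rw [Finset.sum_image]
      intro a _ b _ hab
      exact mul_left_cancel₀ hPp.ne_zero hab
    · intro A hA
      rw [Finset.mem_image] at hA
      obtain ⟨B, hB, rfl⟩ := hA
      rw [Finset.mem_filter, mem_idDiv hI] at hB ⊢
      refine ⟨?_, dvd_mul_right _ _⟩
      refine IsRelPrime.mul_dvd ?_ hP hB.1
      intro d hd1 hd2
      rcases hPI.dvd_iff.mp hd1 with h1 | h1
      · exact h1
      · exact absurd (h1.dvd.trans hd2) hB.2
    · intro A hA hA'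
      rw [Finset.mem_filter, mem_idDiv hI] at hA
      obtain ⟨hA1, B, rfl⟩ := hA
      rw [muI, if_neg]
      intro hsq
      apply hA'
      rw [Finset.mem_image]
      refine ⟨B, ?_, rfl⟩
      rw [Finset.mem_filter, mem_idDiv hI]
      refine ⟨(dvd_mul_left _ _).trans hA1, fun h => ?_⟩
      exact hPI.not_isUnit (hsq P (mul_dvd_mul_left P h))
  rw [key, ← Finset.sum_add_distrib]
  refine Finset.sum_eq_zero fun B hB => ?_
  rw [Finset.mem_filter, mem_idDiv hI] at hB
  rw [muI_prime_mul P B hPp (hnz B hB.1) hB.2]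
  ring

open Classical in
/-- von Mangoldt function on ideals. -/
noncomputable def laI {K : Type*} [Field K] [NumberField K] (I : Ideal (𝓞 K)) : ℝ :=
  if h : IsPrimePow I then Real.log (absNorm h.choose) else 0

lemma laI_pow {K : Type*} [Field K] [NumberField K] (P : Ideal (𝓞 K)) (hP : Prime P) {k : ℕ}
    (hk : k ≠ 0) : laI (P ^ k) = Real.log (absNorm P) := by
  have h : IsPrimePow (P ^ k) := hP.isPrimePow.pow hk
  rw [laI, dif_pos h]
  obtain ⟨m, h1, h2, h3⟩ := h.choose_spec
  have h4 : h.choose = P := by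
    have : h.choose ∣ P := h1.dvd_of_dvd_pow (h3 ▸ dvd_pow_self _ h2.ne')
    exact associated_iff_eq.mp (h1.associated_of_dvd hP this)
  rw [h4]

lemma laI_nonneg {K : Type*} [Field K] [NumberField K] (I : Ideal (𝓞 K)) : 0 ≤ laI I := by
  unfold laI
  split_ifs
  · exact Real.log_natCast_nonneg _
  · exact le_rfl

lemma sum_laI {K : Type*} [Field K] [NumberField K] (I : Ideal (𝓞 K)) (hI : I ≠ 0) :
    ∑ A ∈ idDiv I, laI A = Real.log (absNorm I) := by
  classical
  induction I using UniqueFactorizationMonoid.induction_on_prime with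
  | h₁ => exact absurd rfl hI
  | h₂ U hU =>
    have hU' : U = 1 := by simpa using hU
    subst hU'
    rw [map_one, Nat.cast_one, Real.log_one]
    refine Finset.sum_eq_zero fun A hA => ?_
    rw [mem_idDiv hI] at hA
    have : A = 1 := by simpa using isUnit_of_dvd_one hA
    rw [this, laI, dif_neg]
    exact not_isPrimePow_one
  | h₃ J P hJ hP ih =>
    have hPJ : P * J ≠ ⊥ := mul_ne_zero hP.ne_zero hJ
    have hfin : FiniteMultiplicity P J := FiniteMultiplicity.of_not_isUnit hP.not_isUnit hJ
    set v := multiplicity P J with hv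
    have hd1 : P ^ v ∣ J := pow_multiplicity_dvd P J
    have hd2 : ¬ P ^ (v + 1) ∣ J := hfin.not_pow_dvd_of_multiplicity_lt (Nat.lt_succ_self _)
    have hsub : insert (P ^ (v + 1)) (idDiv J) ⊆ idDiv (P * J) := by
      intro A hA
      rw [Finset.mem_insert, mem_idDiv hJ] at hA
      rw [mem_idDiv hPJ]
      rcases hA with rfl | hA
      · rw [pow_succ, mul_comm]; exact mul_dvd_mul_left _ hd1
      · exact hA.trans (dvd_mul_left _ _)
    rw [← Finset.sum_subset hsub, Finset.sum_insert (by rwa [mem_idDiv hJ]), ih hJ,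
      laI_pow P hP (by omega), map_mul, Nat.cast_mul, Real.log_mul]
    · rw [Nat.cast_ne_zero]; exact absNorm_eq_zero_iff.not.mpr hP.ne_zero
    · rw [Nat.cast_ne_zero]; exact absNorm_eq_zero_iff.not.mpr hJ
    · intro A hA hA'
      rw [Finset.mem_insert, mem_idDiv hJ] at hA'
      push Not at hA'
      rw [mem_idDiv hPJ] at hA
      rw [laI, dif_neg]
      rintro ⟨Q, k, hQ, hk, rfl⟩
      by_cases hQP : Q = P
      · subst hQP
        have hk1 : ¬ k ≤ v := fun h => hA'.2 ((pow_dvd_pow _ h).trans hd1)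
        have hk2 : v + 2 ≤ k := by
          have : k ≠ v + 1 := fun h => hA'.1 (by rw [h])
          omega
        have h3 : Q * Q ^ (v + 1) ∣ Q * J := by
          rw [← pow_succ']; exact (pow_dvd_pow _ hk2).trans hA
        exact hd2 ((mul_dvd_mul_iff_left hP.ne_zero).mp h3)
      · apply hA'.2
        refine IsRelPrime.dvd_of_dvd_mul_left ?_ hA
        refine IsRelPrime.pow_left ?_
        intro d hd1 hd2
        rcases hQ.irreducible.dvd_iff.mp hd1 with h1 | h1
        · exact h1
        · exact absurd (associated_iff_eq.mp (hQ.associated_of_dvd hP (h1.dvd.trans hd2))) hQP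

end

section

open NumberField Ideal

lemma absNorm_span_nat {K : Type*} [Field K] [NumberField K] (p : ℕ) :
    absNorm (span {(p : 𝓞 K)}) = p ^ Module.finrank ℚ K := by
  rw [← RingOfIntegers.rank K]
  exact absNorm_span_natCast p

lemma span_nat_ne_bot {K : Type*} [Field K] [NumberField K] {p : ℕ} (hp : p ≠ 0) :
    span {(p : 𝓞 K)} ≠ ⊥ := by
  rw [Ne, span_singleton_eq_bot]
  exact_mod_cast hp

open Classical in
/-- Primes above `p`. -/
noncomputable def prAb (K : Type*) [Field K] [NumberField K] (p : ℕ) : Finset (Ideal (𝓞 K)) :=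
  (idDiv (span {(p : 𝓞 K)})).filter Prime

lemma mem_prAb {K : Type*} [Field K] [NumberField K] {p : ℕ} (hp : p ≠ 0) {P : Ideal (𝓞 K)} :
    P ∈ prAb K p ↔ P ∣ span {(p : 𝓞 K)} ∧ Prime P := by
  classical
  rw [prAb, Finset.mem_filter, mem_idDiv (span_nat_ne_bot hp)]

lemma dvd_norm_of_prAb {K : Type*} [Field K] [NumberField K] {p : ℕ} (hp : p.Prime)
    {P : Ideal (𝓞 K)} (hP : P ∈ prAb K p) : p ∣ absNorm P := by
  rw [mem_prAb hp.ne_zero] at hP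
  have h1 : absNorm P ∣ p ^ Module.finrank ℚ K := by
    rw [← absNorm_span_nat]; exact map_dvd absNorm hP.1
  rw [Nat.dvd_prime_pow hp] at h1
  obtain ⟨k, _, hk⟩ := h1
  rw [hk]
  refine dvd_pow_self _ ?_
  rintro rfl
  rw [pow_zero, absNorm_eq_one_iff] at hk
  exact hP.2.not_isUnit (Ideal.isUnit_iff.mpr hk)

lemma card_prAb_le {K : Type*} [Field K] [NumberField K] {p : ℕ} (hp : p.Prime) :
    (prAb K p).card ≤ Module.finrank ℚ K := by
  classical
  have h1 : ∏ P ∈ prAb K p, P ∣ span {(p : 𝓞 K)} :=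
    Finset.prod_primes_dvd _ (fun P hP => ((mem_prAb hp.ne_zero).mp hP).2)
      (fun P hP => ((mem_prAb hp.ne_zero).mp hP).1)
  have h2 := map_dvd absNorm h1
  rw [absNorm_span_nat, map_prod] at h2
  have h3 : p ^ (prAb K p).card ∣ ∏ P ∈ prAb K p, absNorm P := by
    rw [← Finset.prod_const]
    exact Finset.prod_dvd_prod_of_dvd _ _ fun P hP => dvd_norm_of_prAb hp hP
  exact (Nat.pow_dvd_pow_iff_le_right hp.one_lt).mp (h3.trans h2)

lemma exists_prAb_of_dvd {K : Type*} [Field K] [NumberField K] {l : ℕ} (hl : l ≠ 0)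
    {P I : Ideal (𝓞 K)} (hP : Prime P) (hPI : P ∣ I) (hI : absNorm I = l) :
    ∃ p ∈ l.primeFactors, P ∈ prAb K p := by
  have h1 : P ∣ span {(l : 𝓞 K)} := by
    refine hPI.trans ?_
    rw [Ideal.dvd_span_singleton, ← hI]
    exact absNorm_mem I
  rw [Ideal.dvd_span_singleton, ← Nat.prod_factorization_pow_eq_self hl, Finsupp.prod] at h1
  push_cast at h1
  have := isPrime_of_prime hP
  rw [Ideal.IsPrime.prod_mem_iff] at h1
  obtain ⟨p, hp, hpm⟩ := h1
  have hp' : p ∈ l.primeFactors := by simpa using hp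
  refine ⟨p, hp', ?_⟩
  rw [mem_prAb (Nat.prime_of_mem_primeFactors hp').ne_zero, Ideal.dvd_span_singleton]
  exact ⟨IsPrime.mem_of_pow_mem inferInstance _ hpm, hP⟩

lemma card_idSet_le {K : Type*} [Field K] [NumberField K] {l : ℕ} (hl : l ≠ 0) :
    (idSet K l).card ≤ l.divisors.card ^ Module.finrank ℚ K := by
  classical
  set S : Finset (Σ _ : ℕ, Ideal (𝓞 K)) := l.primeFactors.sigma (fun p => prAb K p) with hS
  have hcard : (S.pi (fun x => Finset.range (l.factorization x.1 + 1))).card ≤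
      l.divisors.card ^ Module.finrank ℚ K := by
    rw [Finset.card_pi, hS, Finset.prod_sigma, Nat.card_divisors hl, ← Finset.prod_pow]
    refine Finset.prod_le_prod' fun p hp => ?_
    simp only [Finset.card_range, Finset.prod_const]
    exact Nat.pow_le_pow_right (by omega) (card_prAb_le (Nat.prime_of_mem_primeFactors hp))
  refine le_trans (Finset.card_le_card_of_injOn (fun I x _ => multiplicity x.2 I) ?_ ?_) hcard
  · intro I hI
    have hI' : absNorm I = l := mem_idSet.mp hI
    rw [Finset.mem_coe, Finset.mem_pi]
    rintro ⟨p, P⟩ hx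
    rw [hS, Finset.mem_sigma] at hx
    rw [Finset.mem_range, Nat.lt_succ_iff]
    have hp := Nat.prime_of_mem_primeFactors hx.1
    rw [← hp.pow_dvd_iff_le_factorization hl]
    refine (pow_dvd_pow_of_dvd (dvd_norm_of_prAb hp hx.2) _).trans ?_
    rw [← map_pow, ← hI']
    exact map_dvd absNorm (pow_multiplicity_dvd _ _)
  · have key : ∀ I J : Ideal (𝓞 K), absNorm I = l → absNorm J = l →
        ((fun (x : Σ _ : ℕ, Ideal (𝓞 K)) (_ : x ∈ S) => multiplicity x.2 I) =
         (fun (x : Σ _ : ℕ, Ideal (𝓞 K)) (_ : x ∈ S) => multiplicity x.2 J)) → I ∣ J := by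
      intro I J hI hJ h
      have hI0 : I ≠ 0 := by
        rintro rfl; apply hl; rw [← hI]; simp
      have hJ0 : J ≠ 0 := by
        rintro rfl; apply hl; rw [← hJ]; simp
      rw [UniqueFactorizationMonoid.dvd_iff_emultiplicity_le hI0]
      intro P hP
      by_cases hPI : P ∣ I
      · obtain ⟨p, hp, hpP⟩ := exists_prAb_of_dvd hl hP hPI hI
        have := congr_fun (congr_fun h ⟨p, P⟩) (by rw [hS, Finset.mem_sigma]; exact ⟨hp, hpP⟩)
        simp only at this
        have f1 : FiniteMultiplicity P I := FiniteMultiplicity.of_not_isUnit hP.not_isUnit hI0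
        have f2 : FiniteMultiplicity P J := FiniteMultiplicity.of_not_isUnit hP.not_isUnit hJ0
        rw [f1.emultiplicity_eq_multiplicity, f2.emultiplicity_eq_multiplicity, this]
      · rw [emultiplicity_eq_zero.mpr hPI]
        exact zero_le
    intro I hI J hJ h
    rw [Finset.mem_coe, mem_idSet] at hI hJ
    exact dvd_antisymm (key I J hI hJ h) (key J I hJ hI h.symm)

theorem arithData_of_field (K : Type*) [Field K] [NumberField K] :
    ArithData (Module.finrank ℚ K) (pushI (K := K) fun _ => 1) (pushI (K := K) muI)
      (pushI (K := K) laI) where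
  r_le l := by
    by_cases hl : l = 0
    · subst hl
      have : 0 < Module.finrank ℚ K := Module.finrank_pos
      simp
    · rw [pushI_apply _ hl]
      simp only [Finset.sum_const, nsmul_eq_mul, mul_one]
      exact_mod_cast card_idSet_le hl
  mu_le l := by
    by_cases hl : l = 0
    · subst hl; simp
    · rw [pushI_apply _ hl, pushI_apply _ hl]
      exact (Finset.abs_sum_le_sum_abs _ _).trans (Finset.sum_le_sum fun I _ => muI_abs_le I)
  r_one := by
    rw [pushI_apply _ one_ne_zero]
    have : idSet K 1 = {⊤} := by
      ext I; rw [mem_idSet, absNorm_eq_one_iff, Finset.mem_singleton]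
    rw [this]; simp
  mu_mul := by
    ext l
    by_cases hl : l = 0
    · subst hl; simp
    rw [pushI_mul_one _ hl, ArithmeticFunction.one_apply]
    split_ifs with h1
    · subst h1
      have : idSet K 1 = {1} := by
        ext I; rw [mem_idSet, absNorm_eq_one_iff, Finset.mem_singleton, one_eq_top]
      have h2 : idDiv (1 : Ideal (𝓞 K)) = {1} := by
        ext A; rw [mem_idDiv one_ne_zero, Finset.mem_singleton, ← isUnit_iff_dvd_one]
        simp
      rw [this, Finset.sum_singleton, h2, Finset.sum_singleton, muI, if_pos squarefree_one,
        UniqueFactorizationMonoid.normalizedFactors_one]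
      simp
    · refine Finset.sum_eq_zero fun I hI => ?_
      rw [mem_idSet] at hI
      refine sum_muI I ?_ ?_
      · rintro rfl; apply hl; rw [← hI]; simp
      · rintro rfl; apply h1; rw [← hI]; simp
  r_mul l := by
    by_cases hl : l = 0
    · subst hl; simp
    rw [mul_comm, pushI_mul_one _ hl, pushI_apply _ hl, Finset.sum_mul]
    refine Finset.sum_congr rfl fun I hI => ?_
    rw [mem_idSet] at hI
    rw [sum_laI, hI, one_mul]
    rintro rfl; apply hl; rw [← hI]; simp
  La_nonneg l := by
    by_cases hl : l = 0
    · subst hl; simp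
    · rw [pushI_apply _ hl]
      exact Finset.sum_nonneg fun I _ => laI_nonneg I
  La_pp l h := by
    by_cases hl : l = 0
    · subst hl; simp at h
    rw [pushI_apply _ hl] at h
    obtain ⟨I, hI, hI2⟩ := Finset.exists_ne_zero_of_sum_ne_zero h
    rw [mem_idSet] at hI
    have hpp : IsPrimePow I := by
      by_contra hc; exact hI2 (by rw [laI, dif_neg hc])
    obtain ⟨P, k, hP, hk, rfl⟩ := hpp
    have hP0 : absNorm P ≠ 0 := absNorm_eq_zero_iff.not.mpr hP.ne_zero
    obtain ⟨p, hp, hpP⟩ := exists_prAb_of_dvd hP0 hP dvd_rfl rfl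
    have hpp := Nat.prime_of_mem_primeFactors hp
    rw [mem_prAb hpp.ne_zero] at hpP
    have h1 : absNorm P ∣ p ^ Module.finrank ℚ K := by
      rw [← absNorm_span_nat]; exact map_dvd absNorm hpP.1
    obtain ⟨j, _, hj⟩ := (Nat.dvd_prime_pow hpp).mp h1
    have hj0 : j ≠ 0 := by
      rintro rfl
      rw [pow_zero, absNorm_eq_one_iff] at hj
      exact hP.not_isUnit (Ideal.isUnit_iff.mpr hj)
    rw [← hI, map_pow, hj, ← pow_mul]
    exact hpp.isPrimePow.pow (mul_ne_zero hj0 hk.ne')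

end

section

lemma sum_r_log {n : ℕ} {r mu La : ArithmeticFunction ℝ} (ad : ArithData n r mu La) (N : ℕ) :
    ∑ l ∈ Finset.Icc 1 N, r l * Real.log l =
      ∑ k ∈ Finset.Icc 1 N, La k * ∑ a ∈ Finset.Icc 1 (N / k), r a := by
  simp_rw [← ad.r_mul, ArithmeticFunction.mul_apply]
  rw [sum_divisorsAntidiagonal_Icc (fun a b => r a * La b) N, Finset.sum_comm]
  refine Finset.sum_congr rfl fun k hk => ?_
  rw [Finset.mem_Icc] at hk
  rw [← Finset.sum_filter, Finset.mul_sum]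
  refine Finset.sum_congr ?_ fun a _ => mul_comm _ _
  ext a
  rw [Finset.mem_filter, Finset.mem_Icc, Finset.mem_Icc, Nat.le_div_iff_mul_le (by omega)]
  constructor
  · rintro ⟨⟨h1, h2⟩, h3⟩; exact ⟨h1, h3⟩
  · rintro ⟨h1, h2⟩
    exact ⟨⟨h1, (Nat.le_mul_of_pos_right a (by omega)).trans h2⟩, h2⟩

lemma mertens_up {n : ℕ} {r mu La : ArithmeticFunction ℝ} (ad : ArithData n r mu La)
    {c1 c2 : ℝ} {N0 : ℕ} (hc1 : 0 < c1) (hN0 : 1 ≤ N0)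
    (hlow : ∀ N : ℕ, N0 ≤ N → c1 * N ≤ ∑ l ∈ Finset.Icc 1 N, r l)
    (hup : ∀ N : ℕ, ∑ l ∈ Finset.Icc 1 N, r l ≤ c2 * N) (m : ℕ) (hm : 1 ≤ m) :
    ∑ k ∈ Finset.Icc 1 m, La k / k ≤ 2 * c2 / c1 * (Real.log m + Real.log N0) := by
  have hr : ∀ l, 0 ≤ r l := fun l => (abs_nonneg _).trans (ad.mu_le l)
  set N := m * N0 with hN
  have hNpos : 0 < N := Nat.mul_pos hm hN0
  have hNr : (0:ℝ) < N := by exact_mod_cast hNpos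
  have h1 : ∑ l ∈ Finset.Icc 1 N, r l * Real.log l ≤ c2 * N * Real.log N := by
    calc ∑ l ∈ Finset.Icc 1 N, r l * Real.log l ≤ ∑ l ∈ Finset.Icc 1 N, r l * Real.log N := by
          refine Finset.sum_le_sum fun l hl => ?_
          rw [Finset.mem_Icc] at hl
          refine mul_le_mul_of_nonneg_left ?_ (hr l)
          exact Real.log_le_log (by exact_mod_cast hl.1) (by exact_mod_cast hl.2)
      _ = (∑ l ∈ Finset.Icc 1 N, r l) * Real.log N := by rw [Finset.sum_mul]
      _ ≤ _ := mul_le_mul_of_nonneg_right (hup N) (Real.log_natCast_nonneg _)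
  rw [sum_r_log ad] at h1
  have h2 : c1 / 2 * N * ∑ k ∈ Finset.Icc 1 m, La k / k ≤
      ∑ k ∈ Finset.Icc 1 N, La k * ∑ a ∈ Finset.Icc 1 (N / k), r a := by
    rw [Finset.mul_sum]
    refine le_trans (Finset.sum_le_sum (g := fun k => La k * ∑ a ∈ Finset.Icc 1 (N / k), r a)
      fun k hk => ?_) (Finset.sum_le_sum_of_subset_of_nonneg
        (Finset.Icc_subset_Icc_right (Nat.le_mul_of_pos_right m hN0)) fun k _ _ =>
          mul_nonneg (ad.La_nonneg k) (Finset.sum_nonneg fun a _ => hr a))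
    rw [Finset.mem_Icc] at hk
    have hk0 : (0:ℝ) < k := by exact_mod_cast hk.1
    have hq : N0 ≤ N / k := by
      rw [Nat.le_div_iff_mul_le (by omega), mul_comm]
      exact Nat.mul_le_mul_right _ hk.2
    have hq2 : (N:ℝ) / k ≤ 2 * ((N / k : ℕ) : ℝ) := by
      rw [div_le_iff₀ hk0]
      have h3 := Nat.div_add_mod N k
      have h4 := Nat.mod_lt N (show 0 < k by omega)
      have h5 : k ≤ k * (N / k) := Nat.le_mul_of_pos_right k (by omega)
      have : N ≤ 2 * (N / k) * k := by nlinarith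
      exact_mod_cast this
    calc c1 / 2 * N * (La k / k) = La k * (c1 / 2 * (N / k)) := by ring
      _ ≤ La k * (c1 * ((N / k : ℕ) : ℝ)) := by
          refine mul_le_mul_of_nonneg_left ?_ (ad.La_nonneg k)
          nlinarith
      _ ≤ _ := mul_le_mul_of_nonneg_left (hlow _ hq) (ad.La_nonneg k)
  have h3 := h2.trans h1
  have h4 : c1 / 2 * ∑ k ∈ Finset.Icc 1 m, La k / k ≤ c2 * Real.log N := by
    refine le_of_mul_le_mul_left ?_ hNr
    linarith
  have h5 : Real.log N = Real.log m + Real.log N0 := by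
    rw [hN]; push_cast
    rw [Real.log_mul (by exact_mod_cast (by omega : m ≠ 0)) (by exact_mod_cast (by omega : N0 ≠ 0))]
  rw [h5] at h4
  rw [div_mul_eq_mul_div, le_div_iff₀ hc1]
  linarith

lemma mertens_low {n : ℕ} {r mu La : ArithmeticFunction ℝ} (ad : ArithData n r mu La)
    {c1 c2 : ℝ} {N0 : ℕ} (hc1 : 0 < c1) (hc2 : 0 < c2)
    (hlow : ∀ N : ℕ, N0 ≤ N → c1 * N ≤ ∑ l ∈ Finset.Icc 1 N, r l)
    (hup : ∀ N : ℕ, ∑ l ∈ Finset.Icc 1 N, r l ≤ c2 * N) :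
    ∃ N1 : ℕ, ∀ N ≥ N1, c1 / (4 * c2) * Real.log N ≤ ∑ k ∈ Finset.Icc 1 N, La k / k := by
  have hr : ∀ l, 0 ≤ r l := fun l => (abs_nonneg _).trans (ad.mu_le l)
  refine ⟨max (max N0 1) ⌈(2 * c2 / c1) ^ 2⌉₊, fun N hN => ?_⟩
  have hN0 : N0 ≤ N := (le_max_left _ _).trans ((le_max_left _ _).trans hN)
  have hN1 : 1 ≤ N := (le_max_right _ _).trans ((le_max_left _ _).trans hN)
  have hN2 : (2 * c2 / c1) ^ 2 ≤ N := Nat.ceil_le.mp ((le_max_right _ _).trans hN)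
  have hNr : (0:ℝ) < N := by exact_mod_cast hN1
  set s := Nat.sqrt N with hs
  have hs1 : (s:ℝ) ^ 2 ≤ N := by exact_mod_cast Nat.sqrt_le' N
  have hs2 : (N:ℝ) < (s + 1) ^ 2 := by exact_mod_cast Nat.lt_succ_sqrt' N
  have hsN : s ≤ N := Nat.sqrt_le_self N
  have hcs : c2 * s ≤ c1 / 2 * N := by
    have h1 : 2 * c2 / c1 * s ≤ N := by
      have hsq : (2 * c2 / c1 * s) ^ 2 ≤ (N:ℝ) ^ 2 := by
        rw [mul_pow, sq (N:ℝ)]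
        exact mul_le_mul hN2 hs1 (by positivity) hNr.le
      exact (sq_le_sq₀ (by positivity) hNr.le).mp hsq
    rw [div_mul_eq_mul_div, div_le_iff₀ hc1] at h1
    linarith
  have h1 : Real.log N / 2 * (∑ l ∈ Finset.Icc 1 N, r l - ∑ l ∈ Finset.Icc 1 s, r l) ≤
      ∑ l ∈ Finset.Icc 1 N, r l * Real.log l := by
    have hsub : Finset.Icc 1 s ⊆ Finset.Icc 1 N := Finset.Icc_subset_Icc_right hsN
    rw [← Finset.sum_sdiff hsub, add_sub_cancel_right, Finset.mul_sum]
    refine le_trans (Finset.sum_le_sum (g := fun l : ℕ => r l * Real.log l) fun l hl => ?_)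
      (Finset.sum_le_sum_of_subset_of_nonneg Finset.sdiff_subset fun l _ _ =>
          mul_nonneg (hr l) (Real.log_natCast_nonneg l))
    rw [Finset.mem_sdiff, Finset.mem_Icc, Finset.mem_Icc] at hl
    have hl2 : s + 1 ≤ l := by omega
    rw [mul_comm]
    refine mul_le_mul_of_nonneg_left ?_ (hr l)
    have h3 : (N:ℝ) ≤ (l:ℝ) ^ 2 := by
      refine hs2.le.trans ?_
      gcongr
      exact_mod_cast hl2
    have := Real.log_le_log hNr h3
    rw [Real.log_pow] at this
    push_cast at this
    linarith
  rw [sum_r_log ad] at h1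
  have h2 : ∑ k ∈ Finset.Icc 1 N, La k * ∑ a ∈ Finset.Icc 1 (N / k), r a ≤
      c2 * N * ∑ k ∈ Finset.Icc 1 N, La k / k := by
    rw [Finset.mul_sum]
    refine Finset.sum_le_sum fun k hk => ?_
    calc La k * ∑ a ∈ Finset.Icc 1 (N / k), r a ≤ La k * (c2 * ((N / k : ℕ) : ℝ)) :=
          mul_le_mul_of_nonneg_left (hup _) (ad.La_nonneg k)
      _ ≤ La k * (c2 * ((N:ℝ) / k)) := by
          refine mul_le_mul_of_nonneg_left ?_ (ad.La_nonneg k)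
          gcongr
          exact Nat.cast_div_le
      _ = _ := by ring
  have hlN : 0 ≤ Real.log N := Real.log_natCast_nonneg N
  have h3 : Real.log N / 2 * (c1 / 2 * N) ≤ c2 * N * ∑ k ∈ Finset.Icc 1 N, La k / k := by
    refine le_trans (mul_le_mul_of_nonneg_left ?_ (by positivity)) (h1.trans h2)
    have := hlow N hN0
    have := hup s
    linarith
  rw [div_mul_eq_mul_div, div_le_iff₀ (by positivity)]
  have h4 : N * (c1 * Real.log N) ≤ N * ((∑ k ∈ Finset.Icc 1 N, La k / k) * (4 * c2)) := by
    nlinarith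
  exact le_of_mul_le_mul_left h4 hNr

set_option maxHeartbeats 1000000 in
theorem scale_of {n : ℕ} {r mu La : ArithmeticFunction ℝ} (ad : ArithData n r mu La)
    {c1 c2 : ℝ} {N0 : ℕ} (hc1 : 0 < c1) (hc2 : 0 < c2) (hN0 : 1 ≤ N0)
    (hlow : ∀ N : ℕ, N0 ≤ N → c1 * N ≤ ∑ l ∈ Finset.Icc 1 N, r l)
    (hup : ∀ N : ℕ, ∑ l ∈ Finset.Icc 1 N, r l ≤ c2 * N) :
    ∃ κ c0 : ℝ, 0 < κ ∧ κ ≤ 1 ∧ 0 < c0 ∧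
      ∃ T0 : ℝ, ∀ T ≥ T0, ∃ x : ℝ, T ^ κ ≤ x ∧ x ≤ T ∧ ∀ N : ℕ, Real.exp 1 * x ≤ N →
        c0 * x ≤ ∑ l ∈ Finset.Icc 1 N, La l * tent (Real.log (l / x)) := by
  obtain ⟨N1, hML⟩ := mertens_low ad hc1 hc2 hlow hup
  have hMU := mertens_up ad hc1 hN0 hlow hup
  set a := c1 / (4 * c2) with ha
  set b := 2 * c2 / c1 with hb
  have ha0 : 0 < a := by positivity
  have hb0 : 0 < b := by positivity
  set κ := min 1 (a / (4 * b)) with hκ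
  have hκ0 : 0 < κ := lt_min one_pos (by positivity)
  have hκ1 : κ ≤ 1 := min_le_left _ _
  have hκ2 : b * (2 * κ) ≤ a / 2 := by
    have : κ ≤ a / (4 * b) := min_le_right _ _
    rw [le_div_iff₀ (by positivity)] at this
    linarith
  refine ⟨κ, a / 48, hκ0, hκ1, by positivity, ?_⟩
  have hev : ∀ᶠ T : ℝ in Filter.atTop, (N1:ℝ) + 1 ≤ T ∧ Real.exp 1 ≤ T ∧ 2 ≤ T ^ κ ∧
      (a * Real.log 2 + b * Real.log N0) ≤ a / 4 * Real.log T := by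
    refine (Filter.eventually_ge_atTop _).and ((Filter.eventually_ge_atTop _).and
      (((tendsto_rpow_atTop hκ0).eventually_ge_atTop _).and ?_))
    exact (Real.tendsto_log_atTop.const_mul_atTop (by positivity : 0 < a / 4)).eventually_ge_atTop _
  obtain ⟨T0, hT0⟩ := Filter.eventually_atTop.mp hev
  refine ⟨T0, fun T hT => ?_⟩
  obtain ⟨hT1, hTe, hTκ, hTlog⟩ := hT0 T hT
  have hT2 : 2 ≤ T := by linarith [Real.exp_one_gt_d9]
  have hTpos : 0 < T := by linarith
  have hlT1 : 1 ≤ Real.log T := by rwa [Real.le_log_iff_exp_le hTpos]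
  by_contra hcon
  push Not at hcon
  set N := ⌊T⌋₊ with hN
  set m := ⌊T ^ (2 * κ)⌋₊ with hm
  have hNT : (N:ℝ) ≤ T := Nat.floor_le hTpos.le
  have hNT2 : T < N + 1 := Nat.lt_floor_add_one T
  have hTκ2 : T ^ (2 * κ) = T ^ κ * T ^ κ := by
    rw [← Real.rpow_add hTpos]; ring_nf
  have hm1 : 1 ≤ m := by
    rw [hm, Nat.one_le_floor_iff, hTκ2]; nlinarith
  have hmT : (m:ℝ) ≤ T ^ (2 * κ) := Nat.floor_le (by positivity)
  have hmT2 : T ^ (2 * κ) < m + 1 := Nat.lt_floor_add_one _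
  have hL := hML N (by
    have : (N1:ℝ) ≤ N := by linarith
    exact_mod_cast this)
  have hU := hMU m hm1
  have hlm : Real.log m ≤ 2 * κ * Real.log T := by
    have := Real.log_le_log (by exact_mod_cast hm1) hmT
    rwa [Real.log_rpow hTpos] at this
  have hlN : Real.log T - Real.log 2 ≤ Real.log N := by
    rw [← Real.log_div hTpos.ne' (by norm_num)]
    exact Real.log_le_log (by positivity) (by linarith)
  have hdiff : a / 4 * Real.log T ≤
      ∑ k ∈ Finset.Icc 1 N, La k / k - ∑ k ∈ Finset.Icc 1 m, La k / k := by
    have h1 : a * (Real.log T - Real.log 2) ≤ a * Real.log N := by gcongr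
    have h2 : b * (Real.log m + Real.log N0) ≤ b * (2 * κ * Real.log T + Real.log N0) := by gcongr
    have h3 : b * (2 * κ) * Real.log T ≤ a / 2 * Real.log T := by gcongr
    linarith
  set J := ⌊2 * Real.log T⌋₊ + 1 with hJ
  have hJle : (J:ℝ) ≤ 3 * Real.log T := by
    rw [hJ]; push_cast
    have := Nat.floor_le (show 0 ≤ 2 * Real.log T by positivity)
    linarith
  have hfib : ∀ j ∈ Finset.range J, ∑ k ∈ (Finset.Ioc m N).filter
      (fun k : ℕ => ⌊2 * Real.log (k:ℝ)⌋₊ = j), La k / k ≤ 2 * (a / 48) := by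
    intro j _
    by_cases hne : ((Finset.Ioc m N).filter (fun k : ℕ => ⌊2 * Real.log (k:ℝ)⌋₊ = j)).Nonempty
    swap
    · rw [Finset.not_nonempty_iff_eq_empty] at hne
      rw [hne, Finset.sum_empty]; positivity
    set x := Real.exp (j / 2) with hx
    have hx0 : 0 < x := Real.exp_pos _
    have hk : ∀ k ∈ (Finset.Ioc m N).filter (fun k : ℕ => ⌊2 * Real.log (k:ℝ)⌋₊ = j),
        T ^ (2 * κ) < k ∧ (k:ℝ) ≤ T ∧ x ≤ k ∧ (k:ℝ) ≤ 2 * x ∧ 1/2 ≤ tent (Real.log (k / x)) ∧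
          1 ≤ k := by
      intro k hk
      rw [Finset.mem_filter, Finset.mem_Ioc] at hk
      obtain ⟨⟨hk1, hk2⟩, hk3⟩ := hk
      have hk1' : (m:ℝ) + 1 ≤ k := by exact_mod_cast hk1
      have hk2' : (k:ℝ) ≤ N := by exact_mod_cast hk2
      have hk0 : (0:ℝ) < k := by linarith [(Nat.cast_nonneg m : (0:ℝ) ≤ m)]
      have hlk : 0 ≤ Real.log k := Real.log_natCast_nonneg k
      have f1 := Nat.floor_le (show 0 ≤ 2 * Real.log k by positivity)
      have f2 := Nat.lt_floor_add_one (2 * Real.log k)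
      rw [hk3] at f1 f2
      have hl : Real.log (k / x) = Real.log k - j / 2 := by
        rw [Real.log_div hk0.ne' hx0.ne', hx, Real.log_exp]
      refine ⟨by linarith, by linarith, ?_, ?_, ?_, by omega⟩
      · rw [← Real.log_le_log_iff hx0 hk0, hx, Real.log_exp]; linarith
      · rw [← Real.log_le_log_iff hk0 (by positivity), Real.log_mul (by norm_num) hx0.ne', hx,
          Real.log_exp]
        linarith [Real.log_two_gt_d9]
      · rw [hl, tent]
        refine le_max_of_le_right ?_
        rw [abs_of_nonneg (by linarith)]; linarith
    obtain ⟨k0, hk0⟩ := hne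
    obtain ⟨a1, a2, a3, a4, a5, a6⟩ := hk k0 hk0
    obtain ⟨N', hN', hlt⟩ := hcon x (by nlinarith) (by linarith)
    have h1 : ∑ k ∈ (Finset.Ioc m N).filter (fun k : ℕ => ⌊2 * Real.log (k:ℝ)⌋₊ = j), La k / k ≤
        ∑ k ∈ (Finset.Ioc m N).filter (fun k : ℕ => ⌊2 * Real.log (k:ℝ)⌋₊ = j),
          2 / x * (La k * tent (Real.log (k / x))) := by
      refine Finset.sum_le_sum fun k hk' => ?_
      obtain ⟨b1, b2, b3, b4, b5, b6⟩ := hk k hk'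
      have hkp : (0:ℝ) < k := by linarith
      have hLa := ad.La_nonneg k
      calc La k / k ≤ La k / x := by gcongr
        _ = 2 / x * (La k * (1/2)) := by ring
        _ ≤ _ := by gcongr
    refine h1.trans ?_
    rw [← Finset.mul_sum]
    have htn : ∀ t, 0 ≤ tent t := fun t => le_max_left _ _
    have h2 : ∑ k ∈ (Finset.Ioc m N).filter (fun k : ℕ => ⌊2 * Real.log (k:ℝ)⌋₊ = j),
        La k * tent (Real.log (k / x)) ≤
        ∑ l ∈ Finset.Icc 1 N', La l * tent (Real.log (l / x)) := by
      refine Finset.sum_le_sum_of_subset_of_nonneg ?_ fun l _ _ =>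
        mul_nonneg (ad.La_nonneg l) (htn _)
      intro k hk'
      obtain ⟨b1, b2, b3, b4, b5, b6⟩ := hk k hk'
      rw [Finset.mem_Icc]
      refine ⟨b6, ?_⟩
      have : (k:ℝ) ≤ N' := by nlinarith [Real.exp_one_gt_d9]
      exact_mod_cast this
    calc 2 / x * _ ≤ 2 / x * (a / 48 * x) := by
          gcongr
          exact h2.trans hlt.le
      _ = 2 * (a / 48) := by field_simp
  have hsum : ∑ k ∈ Finset.Ioc m N, La k / k ≤ J * (2 * (a / 48)) := by
    rw [← Finset.sum_fiberwise_of_maps_to (s := Finset.Ioc m N) (t := Finset.range J)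
      (g := fun k : ℕ => ⌊2 * Real.log k⌋₊)]
    · refine (Finset.sum_le_sum hfib).trans ?_
      rw [Finset.sum_const, Finset.card_range, nsmul_eq_mul]
    · intro k hk
      rw [Finset.mem_Ioc] at hk
      rw [Finset.mem_range, hJ, Nat.lt_succ_iff]
      refine Nat.floor_mono ?_
      have hk2 : (k:ℝ) ≤ N := by exact_mod_cast hk.2
      have : Real.log k ≤ Real.log T :=
        Real.log_le_log (by exact_mod_cast (by omega : 0 < k)) (by linarith)
      linarith
  have hsplit : ∑ k ∈ Finset.Icc 1 N, La k / k - ∑ k ∈ Finset.Icc 1 m, La k / k ≤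
      ∑ k ∈ Finset.Ioc m N, La k / k := by
    rw [sub_le_iff_le_add', ← Finset.sum_union]
    · refine Finset.sum_le_sum_of_subset_of_nonneg ?_ fun l _ _ =>
        div_nonneg (ad.La_nonneg l) (Nat.cast_nonneg _)
      intro k hk
      rw [Finset.mem_union, Finset.mem_Icc, Finset.mem_Ioc]
      rw [Finset.mem_Icc] at hk
      omega
    · rw [Finset.disjoint_left]
      intro k h1 h2
      rw [Finset.mem_Icc] at h1
      rw [Finset.mem_Ioc] at h2
      omega
  nlinarith

end

section

open NumberField Ideal

open scoped nonZeroDivisors in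
lemma sum_r_eq (K : Type*) [Field K] [NumberField K] (N : ℕ) :
    ∑ l ∈ Finset.Icc 1 N, (pushI (K := K) fun _ => 1) l =
      (Nat.card {I : (Ideal (𝓞 K))⁰ // (absNorm (I : Ideal (𝓞 K)) : ℝ) ≤ (N : ℝ)} : ℝ) := by
  classical
  have h1 : ∑ l ∈ Finset.Icc 1 N, (pushI (K := K) fun _ => 1) l =
      (((Finset.Icc 1 N).biUnion (idSet K)).card : ℝ) := by
    rw [Finset.card_biUnion]
    · push_cast
      refine Finset.sum_congr rfl fun l hl => ?_
      rw [pushI_apply _ (by rw [Finset.mem_Icc] at hl; omega)]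
      simp
    · intro a _ b _ hab
      rw [Function.onFun, Finset.disjoint_left]
      intro I hI hI'
      rw [mem_idSet] at hI hI'
      exact hab (hI.symm.trans hI')
  rw [h1, ← Nat.card_eq_finsetCard]
  congr 1
  refine Nat.card_congr ?_
  refine ⟨fun I => ⟨⟨I.1, ?_⟩, ?_⟩, fun I => ⟨I.1.1, ?_⟩, fun I => rfl, fun I => rfl⟩
  · have := I.2
    rw [Finset.mem_biUnion] at this
    obtain ⟨l, hl, h⟩ := this
    rw [mem_idSet] at h
    rw [Finset.mem_Icc] at hl
    rw [mem_nonZeroDivisors_iff_ne_zero]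
    intro h0
    have h0' : absNorm I.1 = 0 := by rw [h0]; simp
    omega
  · have := I.2
    rw [Finset.mem_biUnion] at this
    obtain ⟨l, hl, h⟩ := this
    rw [mem_idSet] at h
    rw [Finset.mem_Icc] at hl
    simp only
    rw [h]
    exact_mod_cast hl.2
  · rw [Finset.mem_biUnion]
    refine ⟨absNorm I.1.1, ?_, mem_idSet.mpr rfl⟩
    rw [Finset.mem_Icc]
    refine ⟨?_, by exact_mod_cast I.2⟩
    have := mem_nonZeroDivisors_iff_ne_zero.mp I.1.2
    rw [Nat.one_le_iff_ne_zero, Ne, absNorm_eq_zero_iff]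
    exact this

lemma r_bounds (K : Type*) [Field K] [NumberField K] :
    ∃ c1 c2 : ℝ, ∃ N0 : ℕ, 0 < c1 ∧ 0 < c2 ∧ 1 ≤ N0 ∧
      (∀ N : ℕ, N0 ≤ N → c1 * N ≤ ∑ l ∈ Finset.Icc 1 N, (pushI (K := K) fun _ => 1) l) ∧
      (∀ N : ℕ, ∑ l ∈ Finset.Icc 1 N, (pushI (K := K) fun _ => 1) l ≤ c2 * N) := by
  have h := (NumberField.Ideal.tendsto_norm_le_div_atTop₀ K).comp tendsto_natCast_atTop_atTop
  have hpos := NumberField.dedekindZeta_residue_pos K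
  rw [NumberField.dedekindZeta_residue_def] at hpos
  set ρ := (2 ^ InfinitePlace.nrRealPlaces K * (2 * Real.pi) ^ InfinitePlace.nrComplexPlaces K * Units.regulator K * classNumber K / (Units.torsionOrder K * √|(discr K : ℤ)|) : ℝ) with hρ
  have e1 := h.eventually (eventually_gt_nhds (show ρ / 2 < ρ by linarith))
  have hb := h.bddAbove_range
  obtain ⟨B, hB⟩ := hb
  rw [Filter.eventually_atTop] at e1
  obtain ⟨N0, hN0⟩ := e1
  refine ⟨ρ / 2, max B 1, max N0 1, by linarith, by positivity, le_max_right _ _, ?_, ?_⟩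
  · intro N hN
    have h1 := hN0 N (le_trans (le_max_left _ _) hN)
    have hN1 : (0:ℝ) < N := by exact_mod_cast lt_of_lt_of_le one_pos (le_trans (le_max_right _ _) hN)
    rw [sum_r_eq]
    simp only [Function.comp] at h1
    rw [lt_div_iff₀ hN1] at h1
    exact h1.le
  · intro N
    rcases Nat.eq_zero_or_pos N with rfl | hN
    · simp
    · have hN1 : (0:ℝ) < N := by exact_mod_cast hN
      have := hB (Set.mem_range_self N)
      simp only [Function.comp] at this
      rw [sum_r_eq]
      rw [div_le_iff₀ hN1] at this
      exact this.trans (by gcongr; exact le_max_left _ _)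

lemma scale_of_field (K : Type*) [Field K] [NumberField K] :
    ∃ κ c0 : ℝ, 0 < κ ∧ κ ≤ 1 ∧ 0 < c0 ∧ ∃ T0 : ℝ, ∀ T ≥ T0, ∃ x : ℝ, T ^ κ ≤ x ∧ x ≤ T ∧
      ∀ N : ℕ, Real.exp 1 * x ≤ N → c0 * x ≤
        ∑ l ∈ Finset.Icc 1 N, (pushI (K := K) laI) l * tent (Real.log (l / x)) := by
  obtain ⟨c1, c2, N0, h1, h2, h3, h4, h5⟩ := r_bounds K
  exact scale_of (arithData_of_field K) h1 h2 h3 h4 h5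

end

section

open NumberField NumberField.Units NumberField.mixedEmbedding

open Classical NumberField.Units.dirichletUnitTheorem in
/-- Coordinates of the logarithmic map in the basis of fundamental units. -/
noncomputable def lamU {K : Type*} [Field K] [NumberField K] (g : 𝓞 K) (i : Fin (rank K)) : ℝ :=
  ((basisUnitLattice K).ofZLatticeBasis ℝ (unitLattice K)).repr
    (logMap (mixedEmbedding K (g : K))) i

noncomputable def etaU {K : Type*} [Field K] [NumberField K] (g : 𝓞 K) : ℝ :=
  ∏ i, tent (lamU g i)

lemma etaU_nonneg {K : Type*} [Field K] [NumberField K] (g : 𝓞 K) : 0 ≤ etaU g :=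
  Finset.prod_nonneg fun _ _ => tent_nonneg _

lemma tent_sum_two (t : ℝ) :
    ∑ k ∈ ({-⌊t⌋, -⌊t⌋ - 1} : Finset ℤ), tent (t + k) = 1 := by
  have h0 := Int.fract_nonneg t
  have h1 := Int.fract_lt_one t
  rw [Finset.sum_pair (by omega)]
  have e1 : t + ((-⌊t⌋ : ℤ) : ℝ) = Int.fract t := by
    push_cast; unfold Int.fract; ring
  have e2 : t + ((-⌊t⌋ - 1 : ℤ) : ℝ) = Int.fract t - 1 := by
    push_cast; unfold Int.fract; ring
  rw [e1, e2]
  unfold tent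
  rw [abs_of_nonneg h0, abs_of_nonpos (by linarith), max_eq_right (by linarith),
    max_eq_right (by linarith)]
  ring

lemma tent_zero_off (t : ℝ) (k : ℤ) (hk : k ∉ ({-⌊t⌋, -⌊t⌋ - 1} : Finset ℤ)) :
    tent (t + k) = 0 := by
  by_contra h
  have h1 := tent_pos h
  rw [abs_lt] at h1
  apply hk
  have h2 : -k - 1 ≤ ⌊t⌋ := by
    rw [Int.le_floor]; push_cast; linarith
  have h3 : ⌊t⌋ < -k + 1 := by
    rw [Int.floor_lt]; push_cast; linarith
  simp only [Finset.mem_insert, Finset.mem_singleton]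
  omega

/-- Decomposition of units. -/
noncomputable def unitEquiv (K : Type*) [Field K] [NumberField K] :
    (torsion K × (Fin (rank K) → ℤ)) ≃ (𝓞 K)ˣ :=
  Equiv.ofBijective (fun z => (z.1 : (𝓞 K)ˣ) * ∏ i, (fundSystem K i) ^ (z.2 i)) (by
    rw [Function.bijective_iff_existsUnique]
    intro x
    obtain ⟨z, hz, hz'⟩ := exist_unique_eq_mul_prod K x
    exact ⟨z, hz.symm, fun y hy => hz' y hy.symm⟩)

open Classical in
lemma lamU_unit_mul {K : Type*} [Field K] [NumberField K] (g : 𝓞 K) (hg : g ≠ 0)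
    (z : torsion K × (Fin (rank K) → ℤ)) (i : Fin (rank K)) :
    lamU (((unitEquiv K z : (𝓞 K)ˣ) : 𝓞 K) * g) i = lamU g i + z.2 i := by
  have hne : ∀ x : 𝓞 K, x ≠ 0 → mixedEmbedding.norm (mixedEmbedding K (x : K)) ≠ 0 := by
    intro x hx h
    rw [norm_eq_zero_iff' ⟨_, rfl⟩] at h
    rw [map_eq_zero] at h
    exact hx (by exact_mod_cast h)
  have h1 : logMap (mixedEmbedding K ((((unitEquiv K z : (𝓞 K)ˣ) : 𝓞 K) * g : 𝓞 K) : K)) =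
      logEmbedding K (Additive.ofMul (unitEquiv K z)) + logMap (mixedEmbedding K (g : K)) := by
    rw [← logMap_unit_smul _ (hne g hg), unitSMul_smul]
    simp
  have h2 : logEmbedding K (Additive.ofMul (unitEquiv K z)) =
      ∑ j, (z.2 j : ℝ) • ((basisUnitLattice K).ofZLatticeBasis ℝ (unitLattice K)) j := by
    change logEmbedding K (Additive.ofMul ((z.1 : (𝓞 K)ˣ) * ∏ i, (fundSystem K i) ^ (z.2 i))) = _
    rw [ofMul_mul, map_add, ofMul_prod, map_sum]
    rw [dirichletUnitTheorem.logEmbedding_eq_zero_iff.mpr z.1.2, zero_add]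
    refine Finset.sum_congr rfl fun j _ => ?_
    rw [ofMul_zpow, map_zsmul, logEmbedding_fundSystem, Module.Basis.ofZLatticeBasis_apply, Int.cast_smul_eq_zsmul]
  unfold lamU
  rw [h1, h2, map_add, Finsupp.add_apply, Module.Basis.repr_sum_self]
  ring

lemma etaU_hasSum {K : Type*} [Field K] [NumberField K] (g : 𝓞 K) (hg : g ≠ 0) :
    HasSum (fun u : (𝓞 K)ˣ => etaU ((u : 𝓞 K) * g)) (torsionOrder K : ℝ) := by
  classical
  have : Fintype (torsion K) := Fintype.ofFinite _
  rw [← (unitEquiv K).hasSum_iff]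
  let S : Fin (rank K) → Finset ℤ := fun i => {-⌊lamU g i⌋, -⌊lamU g i⌋ - 1}
  have hs : ∀ z ∉ (Finset.univ : Finset (torsion K)) ×ˢ Fintype.piFinset S,
      ((fun u : (𝓞 K)ˣ => etaU ((u : 𝓞 K) * g)) ∘ (unitEquiv K)) z = 0 := by
    intro z hz
    rw [Finset.mem_product, Fintype.mem_piFinset] at hz
    push Not at hz
    obtain ⟨i, hi⟩ := hz (Finset.mem_univ _)
    simp only [Function.comp, etaU]
    apply Finset.prod_eq_zero (Finset.mem_univ i)
    rw [lamU_unit_mul g hg]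
    exact tent_zero_off _ _ hi
  have := hasSum_sum_of_ne_finset_zero (L := SummationFilter.unconditional _) hs
  convert this using 1
  rw [Finset.sum_product]
  have : ∀ x ∈ (Finset.univ : Finset (torsion K)), ∑ y ∈ Fintype.piFinset S,
      ((fun u : (𝓞 K)ˣ => etaU ((u : 𝓞 K) * g)) ∘ (unitEquiv K)) (x, y) = 1 := by
    intro x _
    simp only [Function.comp, etaU, lamU_unit_mul g hg]
    rw [← Finset.prod_univ_sum S (fun i k => tent (lamU g i + (k:ℝ)))]
    exact Finset.prod_eq_one fun i _ => tent_sum_two _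
  rw [Finset.sum_congr rfl this]
  simp [torsionOrder]

end

section

open NumberField NumberField.Units NumberField.mixedEmbedding

lemma coord_bound (K : Type*) [Field K] [NumberField K] :
    ∃ C : ℝ, 0 < C ∧ ∀ (g : 𝓞 K) (B : ℝ), (∀ w : InfinitePlace K, w (g : K) ≤ B) →
      ∀ i, |((RingOfIntegers.basis K).repr g i : ℝ)| ≤ C * B := by
  classical
  let F : Module.Free.ChooseBasisIndex ℤ (𝓞 K) → (mixedSpace K →L[ℝ] ℝ) := fun i =>
    LinearMap.toContinuousLinearMap ((latticeBasis K).coord i)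
  refine ⟨∑ i, ‖F i‖ + 1, by positivity, fun g B hB i => ?_⟩
  have hB0 : 0 ≤ B := le_trans (apply_nonneg _ _) (hB (Classical.arbitrary _))
  have h1 : ((RingOfIntegers.basis K).repr g i : ℝ) = F i (mixedEmbedding K (g : K)) := by
    change _ = (latticeBasis K).repr (mixedEmbedding K (g : K)) i
    rw [latticeBasis_repr_apply]
    have := NumberField.integralBasis_repr_apply K g i
    rw [this]
    simp
  have h2 : ‖mixedEmbedding K (g : K)‖ ≤ B := by
    rw [norm_eq_sup'_normAtPlace]
    refine Finset.sup'_le _ _ fun w _ => ?_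
    rw [normAtPlace_apply]
    exact hB w
  rw [h1, ← Real.norm_eq_abs]
  refine ((F i).le_opNorm _).trans ?_
  gcongr
  have := Finset.single_le_sum (f := fun i => ‖F i‖) (fun i _ => norm_nonneg _) (Finset.mem_univ i)
  linarith

lemma box_red (K : Type*) [Field K] [NumberField K] :
    ∃ C : ℝ, 0 < C ∧ ∀ (g : 𝓞 K) (D : ℕ), 0 < D → ∃ x : 𝓞 K,
      ∀ w : InfinitePlace K, w ((g + D * x : 𝓞 K) : K) ≤ C * D := by
  classical
  let b := RingOfIntegers.basis K
  refine ⟨∑ w : InfinitePlace K, ∑ i, w (b i : K) + 1, by positivity, fun g D hD => ?_⟩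
  refine ⟨∑ i, ((-(b.repr g i / (D:ℤ)) : ℤ) : 𝓞 K) * b i, fun w => ?_⟩
  have h1 : (g + D * ∑ i, ((-(b.repr g i / (D:ℤ)) : ℤ) : 𝓞 K) * b i : 𝓞 K) =
      ∑ i, ((b.repr g i % (D:ℤ) : ℤ) : 𝓞 K) * b i := by
    conv_lhs => rw [← b.sum_repr g]
    rw [Finset.mul_sum, ← Finset.sum_add_distrib]
    refine Finset.sum_congr rfl fun i _ => ?_
    rw [b.sum_repr g, zsmul_eq_mul, Int.emod_def]
    push_cast
    ring
  rw [h1]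
  have h2 : ((∑ i, ((b.repr g i % (D:ℤ) : ℤ) : 𝓞 K) * b i : 𝓞 K) : K) =
      ∑ i, ((b.repr g i % (D:ℤ) : ℤ) : K) * (b i : K) := by
    simp [map_sum]
  rw [h2]
  have h3 : w (∑ i, ((b.repr g i % (D:ℤ) : ℤ) : K) * (b i : K)) ≤ ∑ i, D * w (b i : K) := by
    rw [← InfinitePlace.norm_embedding_eq, map_sum]
    refine (norm_sum_le _ _).trans (Finset.sum_le_sum fun i _ => ?_)
    rw [map_mul, norm_mul, map_intCast, Complex.norm_intCast, InfinitePlace.norm_embedding_eq]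
    gcongr
    have hp := Int.emod_nonneg (b.repr g i) (show (D:ℤ) ≠ 0 by exact_mod_cast hD.ne')
    have hl := Int.emod_lt_of_pos (b.repr g i) (show (0:ℤ) < D by exact_mod_cast hD)
    rw [abs_of_nonneg (by exact_mod_cast hp)]
    exact_mod_cast hl.le
  refine h3.trans ?_
  rw [← Finset.mul_sum, mul_comm]
  gcongr
  have := Finset.single_le_sum (f := fun w : InfinitePlace K => ∑ i, w (b i : K))
    (fun i _ => Finset.sum_nonneg fun _ _ => apply_nonneg _ _) (Finset.mem_univ w)
  linarith

lemma count_box (K : Type*) [Field K] [NumberField K] :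
    ∃ C : ℝ, 0 < C ∧ ∀ B : ℝ, 1 ≤ B → ∃ T : Finset (𝓞 K),
      (∀ g : 𝓞 K, (∀ w : InfinitePlace K, w (g : K) ≤ B) → g ∈ T) ∧
      (T.card : ℝ) ≤ C * B ^ (Module.finrank ℚ K) := by
  classical
  obtain ⟨C, hC, h⟩ := coord_bound K
  let b := RingOfIntegers.basis K
  refine ⟨(2 * C + 1) ^ (Module.finrank ℚ K), by positivity, fun B hB => ?_⟩
  let S : Finset ((i : Module.Free.ChooseBasisIndex ℤ (𝓞 K)) → ℤ) :=
    Fintype.piFinset fun _ => Finset.Icc (-⌊C * B⌋) ⌊C * B⌋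
  refine ⟨S.image fun a => ∑ i, a i • b i, fun g hg => ?_, ?_⟩
  · rw [Finset.mem_image]
    refine ⟨fun i => b.repr g i, ?_, b.sum_repr g⟩
    rw [Fintype.mem_piFinset]
    intro i
    have := abs_le.mp (h g B hg i)
    rw [Finset.mem_Icc]
    constructor
    · rw [neg_le, Int.le_floor]
      push_cast
      linarith [this.1]
    · rw [Int.le_floor]
      exact this.2
  · have h1 : (S.image fun a => ∑ i, a i • b i).card ≤ S.card := Finset.card_image_le
    have h2 : S.card = (2 * ⌊C * B⌋ + 1).toNat ^ (Module.finrank ℚ K) := by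
      rw [Fintype.card_piFinset]
      simp only [Int.card_Icc, Finset.prod_const, Finset.card_univ]
      rw [← Module.finrank_eq_card_chooseBasisIndex, RingOfIntegers.rank]
      congr 2
      ring
    have hfl : 0 ≤ ⌊C * B⌋ := Int.floor_nonneg.mpr (by positivity)
    have h3 : (((2 * ⌊C * B⌋ + 1).toNat : ℕ) : ℝ) ≤ (2 * C + 1) * B := by
      have e : (((2 * ⌊C * B⌋ + 1).toNat : ℕ) : ℝ) = 2 * (⌊C * B⌋ : ℝ) + 1 := by
        have : (((2 * ⌊C * B⌋ + 1).toNat : ℤ)) = 2 * ⌊C * B⌋ + 1 := Int.toNat_of_nonneg (by omega)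
        exact_mod_cast this
      rw [e]
      have := Int.floor_le (C * B)
      nlinarith
    calc ((S.image fun a => ∑ i, a i • b i).card : ℝ) ≤ (S.card : ℝ) := by exact_mod_cast h1
      _ = (((2 * ⌊C * B⌋ + 1).toNat : ℕ) : ℝ) ^ (Module.finrank ℚ K) := by rw [h2]; push_cast; rfl
      _ ≤ ((2 * C + 1) * B) ^ (Module.finrank ℚ K) := by gcongr
      _ = _ := mul_pow _ _ _

/-- Absolute norm of an algebraic integer. -/
noncomputable def nrm {K : Type*} [Field K] [NumberField K] (g : 𝓞 K) : ℕ :=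
  (Algebra.norm ℤ g).natAbs

lemma nrm_cast {K : Type*} [Field K] [NumberField K] (g : 𝓞 K) :
    (nrm g : ℝ) = ∏ w : InfinitePlace K, w (g : K) ^ w.mult := by
  rw [InfinitePlace.prod_eq_abs_norm, ← Algebra.coe_norm_int]
  unfold nrm
  push_cast
  rw [Nat.cast_natAbs]
  push_cast
  rfl

lemma place_pos {K : Type*} [Field K] [NumberField K] {g : 𝓞 K} (hg : g ≠ 0)
    (w : InfinitePlace K) : 0 < w (g : K) := by
  rw [InfinitePlace.pos_iff]
  exact_mod_cast hg

lemma nrm_pos {K : Type*} [Field K] [NumberField K] {g : 𝓞 K} (hg : g ≠ 0) :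
    (0:ℝ) < nrm g := by
  rw [nrm_cast]
  exact Finset.prod_pos fun w _ => pow_pos (place_pos hg w) _

lemma log_nrm {K : Type*} [Field K] [NumberField K] {g : 𝓞 K} (hg : g ≠ 0) :
    Real.log (nrm g) = ∑ w : InfinitePlace K, w.mult * Real.log (w (g : K)) := by
  rw [nrm_cast, Real.log_prod (fun w _ => (pow_pos (place_pos hg w) _).ne')]
  simp [Real.log_pow]

lemma logMap_eq {K : Type*} [Field K] [NumberField K] (g : 𝓞 K)
    (w : {w : InfinitePlace K // w ≠ dirichletUnitTheorem.w₀}) :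
    logMap (mixedEmbedding K (g : K)) w = w.1.mult *
      (Real.log (w.1 (g : K)) - Real.log (nrm g) * (Module.finrank ℚ K : ℝ)⁻¹) := by
  rw [logMap_apply, normAtPlace_apply]
  congr 3
  rw [mixedEmbedding.norm_apply, nrm_cast]
  simp_rw [normAtPlace_apply]

end

section

open NumberField NumberField.Units NumberField.mixedEmbedding

open Classical in
lemma supp_bound (K : Type*) [Field K] [NumberField K] :
    ∃ B : ℝ, 0 ≤ B ∧ ∀ g : 𝓞 K, g ≠ 0 → etaU g ≠ 0 → ∀ w : InfinitePlace K,
      |Real.log (w (g : K)) - Real.log (nrm g) * (Module.finrank ℚ K : ℝ)⁻¹| ≤ B := by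
  let b := (basisUnitLattice K).ofZLatticeBasis ℝ (unitLattice K)
  refine ⟨∑ w : {w : InfinitePlace K // w ≠ dirichletUnitTheorem.w₀}, ∑ i, |b i w|,
    Finset.sum_nonneg fun _ _ => Finset.sum_nonneg fun _ _ => abs_nonneg _, fun g hg he => ?_⟩
  set a := Real.log (nrm g) * (Module.finrank ℚ K : ℝ)⁻¹ with ha
  have hlam : ∀ i, |lamU g i| ≤ 1 := fun i => by
    have := (Finset.prod_ne_zero_iff.mp he) i (Finset.mem_univ i)
    exact (tent_pos this).le
  have h1 : ∀ w : {w : InfinitePlace K // w ≠ dirichletUnitTheorem.w₀},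
      |w.1.mult * (Real.log (w.1 (g : K)) - a)| ≤ ∑ i, |b i w| := by
    intro w
    rw [ha, ← logMap_eq g w]
    have : logMap (mixedEmbedding K (g : K)) = ∑ i, lamU g i • b i := (b.sum_repr _).symm
    rw [this, Finset.sum_apply]
    refine (Finset.abs_sum_le_sum_abs _ _).trans (Finset.sum_le_sum fun i _ => ?_)
    rw [Pi.smul_apply, smul_eq_mul, abs_mul]
    exact mul_le_of_le_one_left (abs_nonneg _) (hlam i)
  have hm : ∀ w : InfinitePlace K, ∀ x : ℝ, |x| ≤ |w.mult * x| := by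
    intro w x
    rw [abs_mul]
    refine le_mul_of_one_le_left (abs_nonneg _) ?_
    rw [abs_of_nonneg (by positivity)]
    exact_mod_cast InfinitePlace.one_le_mult
  intro w
  refine (hm w _).trans ?_
  by_cases hw : w = dirichletUnitTheorem.w₀
  · have h0 : ∑ w : InfinitePlace K, w.mult * (Real.log (w (g : K)) - a) = 0 := by
      simp_rw [mul_sub]
      rw [Finset.sum_sub_distrib, ← log_nrm hg, ← Finset.sum_mul]
      have : ∑ w : InfinitePlace K, (w.mult : ℝ) = Module.finrank ℚ K := by
        exact_mod_cast InfinitePlace.sum_mult_eq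
      rw [this, ha]
      have hn : (Module.finrank ℚ K : ℝ) ≠ 0 := by
        exact_mod_cast (Module.finrank_pos (R := ℚ) (M := K)).ne'
      field_simp
      ring
    rw [← Fintype.sum_subtype_add_sum_subtype (fun w => w ≠ dirichletUnitTheorem.w₀)] at h0
    have h2 : ∑ i : {w : InfinitePlace K // ¬ w ≠ dirichletUnitTheorem.w₀},
        ((i.1.mult : ℝ) * (Real.log (i.1 (g : K)) - a)) = w.mult * (Real.log (w (g : K)) - a) := by
      have hu : ∀ i : {w : InfinitePlace K // ¬ w ≠ dirichletUnitTheorem.w₀}, i.1 = w := fun i => by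
        rw [hw]; exact not_not.mp i.2
      rw [Fintype.sum_eq_single ⟨w, not_not.mpr hw⟩]
      intro x hx
      exact absurd (Subtype.ext (hu x)) hx
    rw [h2] at h0
    have : w.mult * (Real.log (w (g : K)) - a) = - ∑ i : {w : InfinitePlace K // w ≠ dirichletUnitTheorem.w₀},
        ((i.1.mult : ℝ) * (Real.log (i.1 (g : K)) - a)) := by linarith
    rw [this, abs_neg]
    exact (Finset.abs_sum_le_sum_abs _ _).trans (Finset.sum_le_sum fun i _ => h1 i)
  · refine (h1 ⟨w, hw⟩).trans ?_
    exact Finset.single_le_sum (f := fun w : {w : InfinitePlace K // w ≠ dirichletUnitTheorem.w₀} => ∑ i, |b i w|)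
      (fun i _ => Finset.sum_nonneg fun _ _ => abs_nonneg _) (Finset.mem_univ (⟨w, hw⟩ : {w : InfinitePlace K // w ≠ dirichletUnitTheorem.w₀}))

lemma log_nrm_lip {K : Type*} [Field K] [NumberField K] {g g' : 𝓞 K} (hg : g ≠ 0) (hg' : g' ≠ 0)
    {e : ℝ} (h : ∀ w : InfinitePlace K, |Real.log (w (g : K)) - Real.log (w (g' : K))| ≤ e) :
    |Real.log (nrm g) - Real.log (nrm g')| ≤ Module.finrank ℚ K * e := by
  rw [log_nrm hg, log_nrm hg', ← Finset.sum_sub_distrib]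
  refine (Finset.abs_sum_le_sum_abs _ _).trans ?_
  have : ∑ w : InfinitePlace K, (w.mult : ℝ) = Module.finrank ℚ K := by
    exact_mod_cast InfinitePlace.sum_mult_eq
  rw [← this, Finset.sum_mul]
  refine Finset.sum_le_sum fun w _ => ?_
  rw [← mul_sub, abs_mul, abs_of_nonneg (by positivity)]
  exact mul_le_mul_of_nonneg_left (h w) (by positivity)

open Classical in
lemma lamU_lip (K : Type*) [Field K] [NumberField K] :
    ∃ C : ℝ, 0 ≤ C ∧ ∀ g g' : 𝓞 K, g ≠ 0 → g' ≠ 0 → ∀ e : ℝ,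
      (∀ w : InfinitePlace K, |Real.log (w (g : K)) - Real.log (w (g' : K))| ≤ e) →
      ∀ i, |lamU g i - lamU g' i| ≤ C * e := by
  let b := (basisUnitLattice K).ofZLatticeBasis ℝ (unitLattice K)
  let F : Fin (rank K) → (dirichletUnitTheorem.logSpace K →L[ℝ] ℝ) := fun i =>
    LinearMap.toContinuousLinearMap (b.coord i)
  refine ⟨(∑ i, ‖F i‖) * 4, by positivity, fun g g' hg hg' e h i => ?_⟩
  have he : 0 ≤ e := (abs_nonneg _).trans (h (Classical.arbitrary _))
  have h1 : lamU g i - lamU g' i =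
      F i (logMap (mixedEmbedding K (g : K)) - logMap (mixedEmbedding K (g' : K))) := by
    rw [map_sub]; rfl
  have h2 : ‖logMap (mixedEmbedding K (g : K)) - logMap (mixedEmbedding K (g' : K))‖ ≤ 4 * e := by
    rw [pi_norm_le_iff_of_nonneg (by positivity)]
    intro w
    rw [Pi.sub_apply, logMap_eq, logMap_eq, Real.norm_eq_abs]
    have hn : (0:ℝ) < Module.finrank ℚ K := by
      exact_mod_cast (Module.finrank_pos (R := ℚ) (M := K))
    have h3 := log_nrm_lip hg hg' h
    have h4 := h w.1
    have e1 : (w.1.mult : ℝ) * (Real.log (w.1 (g : K)) - Real.log (nrm g) * (Module.finrank ℚ K : ℝ)⁻¹) -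
      w.1.mult * (Real.log (w.1 (g' : K)) - Real.log (nrm g') * (Module.finrank ℚ K : ℝ)⁻¹) =
      w.1.mult * ((Real.log (w.1 (g : K)) - Real.log (w.1 (g' : K))) -
        (Real.log (nrm g) - Real.log (nrm g')) * (Module.finrank ℚ K : ℝ)⁻¹) := by ring
    rw [e1, abs_mul]
    have h5 : |(w.1.mult : ℝ)| ≤ 2 := by
      rw [abs_of_nonneg (by positivity)]
      unfold InfinitePlace.mult
      split_ifs <;> norm_num
    have h6 : |(Real.log (nrm g) - Real.log (nrm g')) * (Module.finrank ℚ K : ℝ)⁻¹| ≤ e := by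
      rw [abs_mul, abs_of_nonneg (inv_nonneg.mpr hn.le), ← div_eq_mul_inv, div_le_iff₀ hn]
      linarith
    calc _ ≤ 2 * (e + e) := by
          gcongr
          exact (abs_sub _ _).trans (add_le_add h4 h6)
      _ = 4 * e := by ring
  rw [h1, ← Real.norm_eq_abs]
  refine ((F i).le_opNorm _).trans ?_
  rw [mul_assoc]
  have := Finset.single_le_sum (f := fun i => ‖F i‖) (fun i _ => norm_nonneg _) (Finset.mem_univ i)
  exact mul_le_mul this h2 (norm_nonneg _) (by positivity)

open Classical in
/-- The smooth weight. -/
noncomputable def phiU {K : Type*} [Field K] [NumberField K] (G : ℝ → ℝ) (Y : ℝ) (g : 𝓞 K) : ℝ :=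
  if g = 0 then 0 else etaU g * G (Real.log (nrm g / Y))

lemma phiU_supp (K : Type*) [Field K] [NumberField K] :
    ∃ B : ℝ, 0 ≤ B ∧ ∀ G : ℝ → ℝ, NiceG G → ∀ Y : ℝ, 0 < Y → ∀ g : 𝓞 K, phiU G Y g ≠ 0 →
      g ≠ 0 ∧ ∀ w : InfinitePlace K,
      Real.exp (-B) * Y ^ (1 / (Module.finrank ℚ K : ℝ)) ≤ w (g : K) ∧
      w (g : K) ≤ Real.exp B * Y ^ (1 / (Module.finrank ℚ K : ℝ)) := by
  obtain ⟨B, hB, h⟩ := supp_bound K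
  refine ⟨B + 1, by linarith, fun G hG Y hY g hg => ?_⟩
  unfold phiU at hg
  split_ifs at hg with h0
  · exact absurd rfl hg
  refine ⟨h0, fun w => ?_⟩
  have h1 : etaU g ≠ 0 := left_ne_zero_of_mul hg
  have h2 : |Real.log (nrm g / Y)| ≤ 1 := by
    by_contra hc
    push Not at hc
    exact right_ne_zero_of_mul hg (hG.2.2 _ hc.le)
  have h3 := h g h0 h1 w
  have hn : (1:ℝ) ≤ Module.finrank ℚ K := by
    exact_mod_cast (Module.finrank_pos (R := ℚ) (M := K))
  rw [Real.log_div (nrm_pos h0).ne' hY.ne'] at h2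
  have h4 : |Real.log (w (g : K)) - Real.log Y * (Module.finrank ℚ K : ℝ)⁻¹| ≤ B + 1 := by
    have e : Real.log (w (g : K)) - Real.log Y * (Module.finrank ℚ K : ℝ)⁻¹ =
      (Real.log (w (g : K)) - Real.log (nrm g) * (Module.finrank ℚ K : ℝ)⁻¹) +
        (Real.log (nrm g) - Real.log Y) * (Module.finrank ℚ K : ℝ)⁻¹ := by ring
    rw [e]
    refine (abs_add_le _ _).trans (add_le_add h3 ?_)
    rw [abs_mul, abs_of_nonneg (a := (Module.finrank ℚ K : ℝ)⁻¹) (by positivity)]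
    exact mul_le_one₀ h2 (by positivity) (inv_le_one_of_one_le₀ hn)
  have h5 := abs_le.mp h4
  have hw := place_pos h0 w
  rw [Real.rpow_def_of_pos hY, ← Real.exp_add, ← Real.exp_add, one_div]
  constructor
  · rw [← Real.le_log_iff_exp_le hw]; linarith [h5.1]
  · rw [← Real.log_le_iff_le_exp hw]; linarith [h5.2]

lemma prod_lip {ι : Type*} (s : Finset ι) (a b : ι → ℝ) (ha : ∀ i, |a i| ≤ 1) (hb : ∀ i, |b i| ≤ 1) :
    |∏ i ∈ s, a i - ∏ i ∈ s, b i| ≤ ∑ i ∈ s, |a i - b i| := by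
  classical
  induction s using Finset.induction_on with
  | empty => simp
  | insert i s hi ih =>
    rw [Finset.prod_insert hi, Finset.prod_insert hi, Finset.sum_insert hi]
    have e : a i * ∏ i ∈ s, a i - b i * ∏ i ∈ s, b i =
      (a i - b i) * ∏ i ∈ s, a i + b i * (∏ i ∈ s, a i - ∏ i ∈ s, b i) := by ring
    rw [e]
    refine (abs_add_le _ _).trans ?_
    rw [abs_mul, abs_mul]
    have h1 : |∏ i ∈ s, a i| ≤ 1 := by
      rw [Finset.abs_prod]
      exact Finset.prod_le_one (fun _ _ => abs_nonneg _) fun i _ => ha i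
    refine add_le_add (mul_le_of_le_one_right (abs_nonneg _) h1) ?_
    exact (mul_le_of_le_one_left (abs_nonneg _) (hb i)).trans ih

lemma etaU_le_one {K : Type*} [Field K] [NumberField K] (g : 𝓞 K) : etaU g ≤ 1 :=
  Finset.prod_le_one (fun _ _ => tent_nonneg _) fun _ _ => tent_le_one _

lemma phiU_abs_le {K : Type*} [Field K] [NumberField K] {G : ℝ → ℝ} (hG : NiceG G) (Y : ℝ)
    (g : 𝓞 K) : |phiU G Y g| ≤ 1 := by
  unfold phiU
  split_ifs
  · simp
  · rw [abs_mul, abs_of_nonneg (etaU_nonneg g)]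
    exact mul_le_one₀ (etaU_le_one g) (abs_nonneg _) (hG.1 _)

lemma phiU_lip_aux (K : Type*) [Field K] [NumberField K] :
    ∃ C : ℝ, 0 ≤ C ∧ ∀ G : ℝ → ℝ, NiceG G → ∀ Y : ℝ, 0 < Y → ∀ g g' : 𝓞 K, g ≠ 0 → g' ≠ 0 →
      ∀ e : ℝ, (∀ w : InfinitePlace K, |Real.log (w (g : K)) - Real.log (w (g' : K))| ≤ e) →
      |phiU G Y g - phiU G Y g'| ≤ C * e := by
  obtain ⟨C, hC, h⟩ := lamU_lip K
  refine ⟨rank K * C + Module.finrank ℚ K, by positivity, fun G hG Y hY g g' hg hg' e he => ?_⟩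
  unfold phiU
  rw [if_neg hg, if_neg hg']
  have h1 : |etaU g - etaU g'| ≤ rank K * C * e := by
    unfold etaU
    refine (prod_lip _ _ _ (fun i => ?_) fun i => ?_).trans ?_
    · rw [abs_of_nonneg (tent_nonneg _)]; exact tent_le_one _
    · rw [abs_of_nonneg (tent_nonneg _)]; exact tent_le_one _
    · have : ∀ i ∈ (Finset.univ : Finset (Fin (rank K))), |tent (lamU g i) - tent (lamU g' i)| ≤ C * e :=
        fun i _ => (tent_lip _ _).trans (h g g' hg hg' e he i)
      refine (Finset.sum_le_card_nsmul _ _ _ this).trans ?_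
      simp [mul_assoc]
  have h2 : |G (Real.log (nrm g / Y)) - G (Real.log (nrm g' / Y))| ≤ Module.finrank ℚ K * e := by
    refine (hG.2.1 _ _).trans ?_
    rw [Real.log_div (nrm_pos hg).ne' hY.ne', Real.log_div (nrm_pos hg').ne' hY.ne']
    have := log_nrm_lip hg hg' he
    rwa [sub_sub_sub_cancel_right]
  have e1 : etaU g * G (Real.log (nrm g / Y)) - etaU g' * G (Real.log (nrm g' / Y)) =
    (etaU g - etaU g') * G (Real.log (nrm g / Y)) +
      etaU g' * (G (Real.log (nrm g / Y)) - G (Real.log (nrm g' / Y))) := by ring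
  rw [e1]
  refine (abs_add_le _ _).trans ?_
  rw [abs_mul, abs_mul, abs_of_nonneg (etaU_nonneg g'), add_mul]
  refine add_le_add ?_ ?_
  · exact (mul_le_of_le_one_right (abs_nonneg _) (hG.1 _)).trans h1
  · exact (mul_le_of_le_one_left (abs_nonneg _) (etaU_le_one _)).trans h2

lemma log_diff {a b : ℝ} (ha : 0 < a) (h : |b - a| ≤ a / 2) :
    |Real.log b - Real.log a| ≤ 2 * |b - a| / a := by
  have h1 := abs_le.mp h
  have hb : 0 < b := by linarith
  rw [← Real.log_div hb.ne' ha.ne']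
  have u1 := Real.log_le_sub_one_of_pos (div_pos hb ha)
  have u2 := Real.log_le_sub_one_of_pos (div_pos ha hb)
  have e1 : Real.log (a / b) = - Real.log (b / a) := by
    rw [← Real.log_inv, inv_div]
  rw [e1] at u2
  rw [abs_le]
  have k1 : b / a - 1 ≤ |b - a| / a := by
    rw [div_sub_one ha.ne']; gcongr; exact le_abs_self _
  have k2 : a / b - 1 ≤ 2 * |b - a| / a := by
    rw [div_sub_one hb.ne', div_le_div_iff₀ hb ha]
    have := neg_abs_le (b - a)
    have := abs_nonneg (b - a)
    nlinarith
  have k3 : |b - a| / a ≤ 2 * |b - a| / a := by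
    gcongr; linarith [abs_nonneg (b - a)]
  constructor <;> linarith

lemma phiU_lip (K : Type*) [Field K] [NumberField K] :
    ∃ C : ℝ, 0 ≤ C ∧ ∀ G : ℝ → ℝ, NiceG G → ∀ Y : ℝ, 0 < Y → ∀ g s : 𝓞 K, ∀ M : ℝ,
      (∀ w : InfinitePlace K, w (s : K) ≤ M) →
      |phiU G Y (g + s) - phiU G Y g| ≤ C * (M / Y ^ (1 / (Module.finrank ℚ K : ℝ))) := by
  obtain ⟨B, hB, hs⟩ := phiU_supp K
  obtain ⟨C, hC, hl⟩ := phiU_lip_aux K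
  refine ⟨(4 + 2 * C) * Real.exp B, by positivity, fun G hG Y hY => ?_⟩
  set R := Y ^ (1 / (Module.finrank ℚ K : ℝ)) with hR
  have hR0 : 0 < R := by positivity
  have key : ∀ g s : 𝓞 K, ∀ M : ℝ, (∀ w : InfinitePlace K, w (s : K) ≤ M) → phiU G Y g ≠ 0 →
      |phiU G Y (g + s) - phiU G Y g| ≤ (4 + 2 * C) * Real.exp B * (M / R) := by
    intro g s M hM hg
    have hM0 : 0 ≤ M := (apply_nonneg _ _).trans (hM (Classical.arbitrary _))
    obtain ⟨h0, hw⟩ := hs G hG Y hY g hg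
    by_cases hc : Real.exp (-B) * R ≤ 2 * M
    · have h1 := phiU_abs_le hG Y (g + s)
      have h2 := phiU_abs_le hG Y g
      have h3 : |phiU G Y (g + s) - phiU G Y g| ≤ 2 := (abs_sub _ _).trans (by linarith)
      have h4 : 1 ≤ 2 * Real.exp B * (M / R) := by
        rw [mul_div_assoc', le_div_iff₀ hR0]
        rw [Real.exp_neg] at hc
        have := mul_le_mul_of_nonneg_left hc (Real.exp_pos B).le
        rw [← mul_assoc, mul_inv_cancel₀ (Real.exp_pos B).ne'] at this
        linarith
      have h5 : 0 ≤ 2 * C * Real.exp B * (M / R) := by positivity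
      nlinarith
    · push Not at hc
      have hsub : ∀ w : InfinitePlace K, |w ((g + s : 𝓞 K) : K) - w (g : K)| ≤ M := by
        intro w
        refine le_trans ?_ (hM w)
        rw [← InfinitePlace.norm_embedding_eq, ← InfinitePlace.norm_embedding_eq w (g : K),
          ← InfinitePlace.norm_embedding_eq w (s : K)]
        refine (abs_norm_sub_norm_le _ _).trans ?_
        rw [← map_sub]
        simp
      have hlog : ∀ w : InfinitePlace K,
          |Real.log (w ((g + s : 𝓞 K) : K)) - Real.log (w (g : K))| ≤ 2 * Real.exp B * (M / R) := by
        intro w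
        have hpos := place_pos h0 w
        have hlo := (hw w).1
        refine (log_diff hpos ((hsub w).trans (by linarith))).trans ?_
        rw [div_le_iff₀ hpos]
        calc 2 * |w ((g + s : 𝓞 K) : K) - w (g : K)| ≤ 2 * M := by linarith [hsub w]
          _ = 2 * Real.exp B * (M / R) * (Real.exp (-B) * R) := by
            rw [Real.exp_neg]; field_simp
          _ ≤ _ := by gcongr
      have hne : g + s ≠ 0 := by
        intro h
        have w : InfinitePlace K := Classical.arbitrary _
        have h1 := hsub w
        rw [h] at h1
        have hpos := place_pos h0 w
        have hlo := (hw w).1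
        simp only [map_zero, zero_sub, abs_neg] at h1
        rw [abs_of_pos hpos] at h1
        linarith
      refine (hl G hG Y hY _ _ hne h0 _ hlog).trans ?_
      have : 0 ≤ Real.exp B * (M / R) := by positivity
      nlinarith
  intro g s M hM
  have hM0 : 0 ≤ M := (apply_nonneg _ _).trans (hM (Classical.arbitrary _))
  by_cases h1 : phiU G Y g = 0
  · by_cases h2 : phiU G Y (g + s) = 0
    · rw [h1, h2, sub_zero, abs_zero]; positivity
    · have := key (g + s) (-s) M (fun w => by
        have e : (((-s : 𝓞 K)) : K) = - (s : K) := by simp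
        rw [e, ← InfinitePlace.norm_embedding_eq, map_neg, norm_neg, InfinitePlace.norm_embedding_eq]
        exact hM w) h2
      rw [add_neg_cancel_right, abs_sub_comm] at this
      exact this
  · exact key g s M hM h1

end

section

open NumberField

lemma cancel_sum {Γ ι : Type*} [AddCommGroup Γ] [Fintype ι] [Nonempty ι] (h : Γ → ℂ) (φ : Γ → ℝ)
    (hh : ∀ g, ‖h g‖ ≤ 1) (T : Finset Γ) (hT : ∀ g, φ g ≠ 0 → g ∈ T) (s : ι → Γ)
    (hs : ∀ g, ∑ t, h (g + s t) = 0) (e : ℝ) (he : ∀ t g, |φ (g + s t) - φ g| ≤ e) :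
    ‖∑ g ∈ T, h g * (φ g : ℂ)‖ ≤ 2 * T.card * e := by
  classical
  have he0 : 0 ≤ e := (abs_nonneg _).trans (he (Classical.arbitrary ι) 0)
  set S := ∑ g ∈ T, h g * (φ g : ℂ) with hS
  let A : ι → ℂ := fun t => ∑ g ∈ T, h (g + s t) * (φ g : ℂ)
  have hA : ∑ t, A t = 0 := by
    simp only [A]
    rw [Finset.sum_comm]
    refine Finset.sum_eq_zero fun g _ => ?_
    rw [← Finset.sum_mul, hs, zero_mul]
  have h1 : ∀ t, ‖S - A t‖ ≤ 2 * T.card * e := by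
    intro t
    let U := T ∪ T.image (fun g => g - s t)
    have e1 : A t = ∑ g ∈ U, h (g + s t) * (φ g : ℂ) := by
      refine Finset.sum_subset Finset.subset_union_left fun g _ hg => ?_
      have : φ g = 0 := by by_contra hc; exact hg (hT g hc)
      simp [this]
    have e2 : S = ∑ g ∈ U, h (g + s t) * (φ (g + s t) : ℂ) := by
      have : ∑ g ∈ U, h (g + s t) * (φ (g + s t) : ℂ) =
          ∑ g ∈ U.image (fun g => g + s t), h g * (φ g : ℂ) := by
        rw [Finset.sum_image]
        intro a _ b _ hab
        exact add_right_cancel hab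
      rw [this]
      refine Finset.sum_subset ?_ fun g _ hg => ?_
      · intro g hg
        rw [Finset.mem_image]
        refine ⟨g - s t, Finset.mem_union_right _ (Finset.mem_image_of_mem _ hg), ?_⟩
        exact sub_add_cancel _ _
      · have : φ g = 0 := by by_contra hc; exact hg (hT g hc)
        simp [this]
    rw [e1, e2, ← Finset.sum_sub_distrib]
    have hU : (U.card : ℝ) ≤ 2 * T.card := by
      have a1 : U.card ≤ T.card + (T.image (fun g => g - s t)).card := Finset.card_union_le _ _
      have a2 : (T.image (fun g => g - s t)).card ≤ T.card := Finset.card_image_le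
      have : U.card ≤ 2 * T.card := by omega
      exact_mod_cast this
    refine (norm_sum_le_of_le (f := fun g => h (g + s t) * (φ (g + s t) : ℂ) - h (g + s t) * (φ g : ℂ))
      U (n := fun _ => e) fun g _ => ?_).trans ?_
    · rw [← mul_sub, norm_mul, ← Complex.ofReal_sub, Complex.norm_real, Real.norm_eq_abs]
      exact (mul_le_of_le_one_left (abs_nonneg _) (hh _)).trans (he t g)
    · rw [Finset.sum_const, nsmul_eq_mul]
      gcongr
  have h2 : (Fintype.card ι : ℂ) * S = ∑ t, (S - A t) := by
    rw [Finset.sum_sub_distrib, hA]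
    simp
  have h3 : (Fintype.card ι : ℝ) * ‖S‖ ≤ Fintype.card ι * (2 * T.card * e) := by
    calc (Fintype.card ι : ℝ) * ‖S‖ = ‖(Fintype.card ι : ℂ) * S‖ := by rw [norm_mul]; simp
      _ = ‖∑ t, (S - A t)‖ := by rw [h2]
      _ ≤ ∑ t : ι, 2 * T.card * e := norm_sum_le_of_le _ fun t _ => h1 t
      _ = _ := by simp
  exact le_of_mul_le_mul_left h3 (by exact_mod_cast Fintype.card_pos)

/-- Action of the Galois group on integers. -/
noncomputable def galO {K : Type*} [Field K] [NumberField K] (σ : K ≃ₐ[ℚ] K) : 𝓞 K →+* 𝓞 K :=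
  ((galRestrict ℤ ℚ K (𝓞 K) σ : 𝓞 K ≃ₐ[ℤ] 𝓞 K) : 𝓞 K →+* 𝓞 K)

lemma galO_coe {K : Type*} [Field K] [NumberField K] (σ : K ≃ₐ[ℚ] K) (x : 𝓞 K) :
    ((galO σ x : 𝓞 K) : K) = σ (x : K) :=
  algebraMap_galRestrict_apply ℤ σ x

lemma norm_eq_prod_galO {K : Type*} [Field K] [NumberField K] [IsGalois ℚ K] (x : 𝓞 K) :
    ((Algebra.norm ℤ x : ℤ) : 𝓞 K) = ∏ σ : K ≃ₐ[ℚ] K, galO σ x := by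
  apply RingOfIntegers.coe_injective
  simp only [map_prod]
  have : ∀ σ : K ≃ₐ[ℚ] K, algebraMap (𝓞 K) K (galO σ x) = σ (x : K) := fun σ => galO_coe σ x
  simp_rw [this]
  rw [← Algebra.norm_eq_prod_automorphisms, ← Algebra.coe_norm_int]
  simp

lemma norm_mod {K : Type*} [Field K] [NumberField K] [IsGalois ℚ K] {q : ℕ}
    (π : 𝓞 K →+* ZMod q) (x : 𝓞 K) :
    ((Algebra.norm ℤ x : ℤ) : ZMod q) = ∏ σ : K ≃ₐ[ℚ] K, π (galO σ x) := by
  rw [← map_prod, ← norm_eq_prod_galO]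
  simp

lemma norm_nonneg_of_I {K : Type*} [Field K] [NumberField K] (hI : ∃ i : K, i ^ 2 = -1)
    (x : 𝓞 K) : 0 ≤ Algebra.norm ℤ x := by
  classical
  obtain ⟨i, hi⟩ := hI
  have hc : ∀ φ : K →+* ℂ, ¬ ComplexEmbedding.IsReal φ := by
    intro φ hφ
    have h1 : (φ i) ^ 2 = -1 := by rw [← map_pow, hi]; simp
    have h2 : (starRingEnd ℂ) (φ i) = φ i := RingHom.congr_fun hφ i
    obtain ⟨r, hr⟩ := Complex.conj_eq_iff_real.mp h2
    rw [hr] at h1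
    have : r ^ 2 = -1 := by exact_mod_cast h1
    nlinarith [sq_nonneg r]
  have h1 : ((Algebra.norm ℚ (x : K) : ℚ) : ℂ) = ∏ φ : K →+* ℂ, φ (x : K) := by
    have := Algebra.norm_eq_prod_embeddings ℚ ℂ (x : K)
    rw [eq_ratCast] at this
    rw [this]
    exact Fintype.prod_equiv (RingHom.equivRatAlgHom K ℂ).symm _ _ fun _ => rfl
  have h2 : ∏ φ : K →+* ℂ, φ (x : K) =
      ∏ w : InfinitePlace K, ∏ φ : K →+* ℂ with InfinitePlace.mk φ = w, φ (x : K) :=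
    (Finset.prod_fiberwise _ _ _).symm
  have h3 : ∀ w : InfinitePlace K, ∏ φ : K →+* ℂ with InfinitePlace.mk φ = w, φ (x : K) =
      ((‖w.embedding (x : K)‖ ^ 2 : ℝ) : ℂ) := by
    intro w
    have : (Finset.univ.filter fun φ : K →+* ℂ => InfinitePlace.mk φ = w) =
        {w.embedding, ComplexEmbedding.conjugate w.embedding} := by
      ext φ
      simp only [Finset.mem_filter, Finset.mem_univ, true_and, Finset.mem_insert,
        Finset.mem_singleton]
      conv_lhs => rw [← InfinitePlace.mk_embedding w, InfinitePlace.mk_eq_iff]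
      constructor
      · rintro (h | h)
        · exact Or.inl h
        · right
          rw [← h]; simp
      · rintro (h | h)
        · exact Or.inl h
        · right
          rw [h]; simp
    rw [this, Finset.prod_pair (fun h => hc w.embedding (by
      rw [ComplexEmbedding.isReal_iff]; exact h.symm))]
    rw [ComplexEmbedding.conjugate_coe_eq, Complex.mul_conj, Complex.normSq_eq_norm_sq]
  rw [h2] at h1
  simp_rw [h3] at h1
  rw [← Complex.ofReal_prod] at h1
  have h4 : ((Algebra.norm ℚ (x : K) : ℚ) : ℝ) =
      ∏ w : InfinitePlace K, ‖w.embedding (x : K)‖ ^ 2 := by exact_mod_cast h1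
  have h5 : (0:ℝ) ≤ ((Algebra.norm ℚ (x : K) : ℚ) : ℝ) := by
    rw [h4]; positivity
  rw [← Algebra.coe_norm_int] at h5
  exact_mod_cast h5

end

section

open NumberField

open Classical in
noncomputable def hU {K : Type*} [Field K] [NumberField K] (J : Ideal (𝓞 K)) {ι : Type*} [Fintype ι]
    (q : ι → ℕ) (ψ : (i : ι) → DirichletCharacter ℂ (q i)) (g : 𝓞 K) : ℂ :=
  if g ∈ J then chi q ψ (nrm g) else 0

lemma hU_norm_le {K : Type*} [Field K] [NumberField K] (J : Ideal (𝓞 K)) {ι : Type*} [Fintype ι]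
    (q : ι → ℕ) (ψ : (i : ι) → DirichletCharacter ℂ (q i)) (g : 𝓞 K) : ‖hU J q ψ g‖ ≤ 1 := by
  unfold hU chi
  split_ifs
  · rw [norm_prod]
    refine Finset.prod_le_one (fun _ _ => norm_nonneg _) fun i _ => ?_
    split_ifs
    · simp
    · exact DirichletCharacter.norm_le_one _ _
  · simp

open Classical in
lemma chi_nrm {K : Type*} [Field K] [NumberField K] [IsGalois ℚ K]
    (hN : ∀ x : 𝓞 K, 0 ≤ Algebra.norm ℤ x) {ι : Type*} [Fintype ι]
    (q : ι → ℕ) (ψ : (i : ι) → DirichletCharacter ℂ (q i)) (π : (i : ι) → 𝓞 K →+* ZMod (q i))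
    (g : 𝓞 K) :
    chi q ψ (nrm g) = ∏ i, if ψ i = 1 then 1 else ψ i (∏ σ : K ≃ₐ[ℚ] K, π i (galO σ g)) := by
  unfold chi
  refine Finset.prod_congr rfl fun i _ => ?_
  split_ifs
  · rfl
  · rw [← norm_mod]
    congr 1
    unfold nrm
    have : (((Algebra.norm ℤ g).natAbs : ℕ) : ℤ) = Algebra.norm ℤ g := Int.natAbs_of_nonneg (hN g)
    conv_rhs => rw [← this]
    rw [Int.cast_natCast]

lemma galO_one {K : Type*} [Field K] [NumberField K] (x : 𝓞 K) : galO (1 : K ≃ₐ[ℚ] K) x = x := by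
  apply RingOfIntegers.coe_injective
  exact galO_coe 1 x

open Classical in
/-- An element detecting the identity automorphism modulo `q`. -/
lemma exists_beta {K : Type*} [Field K] [NumberField K] [IsGalois ℚ K] {q : ℕ} [Fact q.Prime]
    (π : 𝓞 K →+* ZMod q) (α : 𝓞 K)
    (hα : ∀ σ : K ≃ₐ[ℚ] K, σ ≠ 1 → ¬ (q : ℤ) ∣ Algebra.norm ℤ (α - galO σ α)) :
    ∃ β : 𝓞 K, π β ≠ 0 ∧ ∀ σ : K ≃ₐ[ℚ] K, σ ≠ 1 → π (galO σ β) = 0 := by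
  let m : (K ≃ₐ[ℚ] K) → ℕ := fun σ => (π (galO σ α)).val
  have hm : ∀ σ, ((m σ : ℕ) : ZMod q) = π (galO σ α) := fun σ => ZMod.natCast_zmod_val _
  refine ⟨∏ σ ∈ Finset.univ.erase (1 : K ≃ₐ[ℚ] K), (α - (m σ : 𝓞 K)), ?_, fun τ hτ => ?_⟩
  · rw [map_prod, Finset.prod_ne_zero_iff]
    intro σ hσ
    rw [map_sub, map_natCast, hm, ← map_sub]
    intro h0
    apply hα σ (Finset.ne_of_mem_erase hσ)
    rw [← ZMod.intCast_zmod_eq_zero_iff_dvd, norm_mod π]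
    refine Finset.prod_eq_zero (Finset.mem_univ (1 : K ≃ₐ[ℚ] K)) ?_
    rw [galO_one, h0]
  · rw [map_prod, map_prod]
    refine Finset.prod_eq_zero (Finset.mem_erase.mpr ⟨hτ, Finset.mem_univ _⟩) ?_
    rw [map_sub, map_natCast, map_sub, map_natCast, hm, sub_self]

open Classical in
set_option maxHeartbeats 1000000 in
lemma hU_cancel {K : Type*} [Field K] [NumberField K] [IsGalois ℚ K]
    (hN : ∀ x : 𝓞 K, 0 ≤ Algebra.norm ℤ x) (J : Ideal (𝓞 K)) {NJ : ℕ} (hNJ : (NJ : 𝓞 K) ∈ J)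
    {ι : Type*} [Fintype ι] (q : ι → ℕ) [∀ i, Fact (q i).Prime] (hq : Function.Injective q)
    (ψ : (i : ι) → DirichletCharacter ℂ (q i)) (hψ : ψ ≠ 1)
    (π : (i : ι) → 𝓞 K →+* ZMod (q i)) (α : 𝓞 K)
    (hα : ∀ i, ∀ σ : K ≃ₐ[ℚ] K, σ ≠ 1 → ¬ (q i : ℤ) ∣ Algebra.norm ℤ (α - galO σ α))
    (hqJ : ∀ i, ¬ q i ∣ NJ) :
    ∃ i0 : ι, ∃ e : 𝓞 K, ∀ g : 𝓞 K, ∀ x : ZMod (q i0) → 𝓞 K,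
      ∑ t : ZMod (q i0), hU J q ψ (g + ((t.val : 𝓞 K) * e + ((condu q ψ * NJ : ℕ) : 𝓞 K) * x t)) = 0 := by
  obtain ⟨i0, hi0⟩ : ∃ i, ψ i ≠ 1 := by
    by_contra h
    push Not at h
    exact hψ (funext h)
  obtain ⟨β, hβ, hβ'⟩ := exists_beta (π i0) α (hα i0)
  let P : ℕ := NJ * ∏ i ∈ Finset.univ.erase i0, (if ψ i = 1 then 1 else q i)
  have hP : (P : ZMod (q i0)) ≠ 0 := by
    rw [Ne, ZMod.natCast_eq_zero_iff]
    intro h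
    rcases (Nat.Prime.dvd_mul (Fact.out : (q i0).Prime)).mp h with h | h
    · exact hqJ i0 h
    · rw [Prime.dvd_finsetProd_iff (Nat.Prime.prime Fact.out)] at h
      obtain ⟨i, hi, h⟩ := h
      split_ifs at h
      · exact (Fact.out : (q i0).Prime).one_lt.ne' (Nat.dvd_one.mp h)
      · have := (Nat.prime_dvd_prime_iff_eq Fact.out Fact.out).mp h
        exact Finset.ne_of_mem_erase hi (hq this.symm)
  let v : ℕ := (((P : ZMod (q i0)) * π i0 β)⁻¹).val
  let e : 𝓞 K := (v : 𝓞 K) * ((P : 𝓞 K) * β)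
  have he1 : π i0 e = 1 := by
    simp only [e, map_mul, map_natCast, v, ZMod.natCast_zmod_val]
    exact inv_mul_cancel₀ (mul_ne_zero hP hβ)
  have he2 : ∀ σ : K ≃ₐ[ℚ] K, σ ≠ 1 → π i0 (galO σ e) = 0 := by
    intro σ hσ
    simp only [e, map_mul, hβ' σ hσ, mul_zero]
  have he3 : ∀ i, i ≠ i0 → ψ i ≠ 1 → ∀ σ : K ≃ₐ[ℚ] K, π i (galO σ e) = 0 := by
    intro i hi hi' σ
    have : (P : ZMod (q i)) = 0 := by
      rw [ZMod.natCast_eq_zero_iff]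
      refine Dvd.dvd.mul_left ?_ _
      have := Finset.dvd_prod_of_mem (fun i => if ψ i = 1 then 1 else q i)
        (Finset.mem_erase.mpr ⟨hi, Finset.mem_univ i⟩)
      simpa [hi'] using this
    simp only [e, map_mul, map_natCast, this, zero_mul, mul_zero]
  have heJ : e ∈ J := by
    simp only [e, P]
    push_cast
    refine J.mul_mem_left _ (J.mul_mem_right _ (J.mul_mem_right _ hNJ))
  have hD : ∀ i, ψ i ≠ 1 → ((condu q ψ * NJ : ℕ) : ZMod (q i)) = 0 := by
    intro i hi
    rw [ZMod.natCast_eq_zero_iff]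
    refine Dvd.dvd.mul_right ?_ _
    unfold condu
    refine dvd_trans ?_ (Finset.dvd_prod_of_mem _ (Finset.mem_univ i))
    rw [if_neg hi]
  clear_value e
  refine ⟨i0, e, fun g x => ?_⟩
  have hmem : ∀ t, (g + ((t.val : 𝓞 K) * e + ((condu q ψ * NJ : ℕ) : 𝓞 K) * x t)) ∈ J ↔ g ∈ J := by
    intro t
    refine J.add_mem_iff_left ?_
    refine J.add_mem (J.mul_mem_left _ heJ) (J.mul_mem_right _ ?_)
    push_cast
    exact J.mul_mem_left _ hNJ
  by_cases hg : g ∈ J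
  · have key : ∀ t : ZMod (q i0),
        hU J q ψ (g + ((t.val : 𝓞 K) * e + ((condu q ψ * NJ : ℕ) : 𝓞 K) * x t)) =
        ψ i0 (t + π i0 g) *
          (ψ i0 (∏ σ ∈ Finset.univ.erase (1 : K ≃ₐ[ℚ] K), π i0 (galO σ g)) *
            ∏ i ∈ Finset.univ.erase i0,
              if ψ i = 1 then 1 else ψ i (∏ σ : K ≃ₐ[ℚ] K, π i (galO σ g))) := by
      intro t
      unfold hU
      rw [if_pos ((hmem t).mpr hg), chi_nrm hN q ψ π,
        ← Finset.mul_prod_erase _ _ (Finset.mem_univ i0), ← mul_assoc]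
      congr 1
      · rw [if_neg hi0, ← Finset.mul_prod_erase _ _ (Finset.mem_univ (1 : K ≃ₐ[ℚ] K)), map_mul]
        congr 2
        · simp only [galO_one, map_add, map_mul, map_natCast, he1, ZMod.natCast_zmod_val, hD i0 hi0]
          ring
        · refine Finset.prod_congr rfl fun σ hσ => ?_
          simp only [map_add, map_mul, map_natCast, he2 σ (Finset.ne_of_mem_erase hσ), hD i0 hi0]
          ring
      · refine Finset.prod_congr rfl fun i hi => ?_
        split_ifs with h1
        · rfl
        · congr 1
          refine Finset.prod_congr rfl fun σ hσ => ?_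
          simp only [map_add, map_mul, map_natCast, he3 i (Finset.ne_of_mem_erase hi) h1, hD i h1]
          ring
    rw [Finset.sum_congr rfl fun t _ => key t, ← Finset.sum_mul]
    have : ∑ t : ZMod (q i0), ψ i0 (t + π i0 g) = 0 := by
      rw [Fintype.sum_equiv (Equiv.addRight (π i0 g)) (fun t => ψ i0 (t + π i0 g)) (fun t => ψ i0 t)
        (fun _ => rfl)]
      exact MulChar.sum_eq_zero_of_ne_one hi0
    rw [this, zero_mul]
  · refine Finset.sum_eq_zero fun t _ => ?_
    unfold hU
    rw [if_neg (fun h => hg ((hmem t).mp h))]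

end

section

open NumberField

set_option maxHeartbeats 1000000 in
lemma class_bound (K : Type*) [Field K] [NumberField K] [IsGalois ℚ K]
    (hN : ∀ x : 𝓞 K, 0 ≤ Algebra.norm ℤ x) (α : 𝓞 K) (J : Ideal (𝓞 K)) (hJ0 : J ≠ ⊥) :
    ∃ C : ℝ, 0 ≤ C ∧ ∀ (ι : Type) [Fintype ι] (q : ι → ℕ) [∀ i, Fact (q i).Prime]
      (_ : Function.Injective q) (ψ : (i : ι) → DirichletCharacter ℂ (q i)) (_ : ψ ≠ 1)
      (_ : (i : ι) → 𝓞 K →+* ZMod (q i))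
      (_ : ∀ i, ∀ σ : K ≃ₐ[ℚ] K, σ ≠ 1 → ¬ (q i : ℤ) ∣ Algebra.norm ℤ (α - galO σ α))
      (_ : ∀ i, ¬ q i ∣ Ideal.absNorm J) (G : ℝ → ℝ) (_ : NiceG G) (X : ℝ) (_ : 1 ≤ X),
      ∃ T : Finset (𝓞 K), (∀ g, phiU G (X * Ideal.absNorm J) g ≠ 0 → g ∈ T) ∧
        ‖∑ g ∈ T, hU J q ψ g * (phiU G (X * Ideal.absNorm J) g : ℂ)‖ ≤
          C * condu q ψ * X ^ (1 - 1 / (Module.finrank ℚ K : ℝ)) := by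
  obtain ⟨B, hB, hsupp⟩ := phiU_supp K
  obtain ⟨C2, hC2, hcount⟩ := count_box K
  obtain ⟨C3, hC3, hlip⟩ := phiU_lip K
  obtain ⟨C4, hC4, hred⟩ := box_red K
  set NJ := Ideal.absNorm J with hNJ
  set n := Module.finrank ℚ K with hn
  have hn1 : (1:ℝ) ≤ n := by exact_mod_cast (Module.finrank_pos (R := ℚ) (M := K))
  have hNJ0 : NJ ≠ 0 := by rw [Ne, hNJ, Ideal.absNorm_eq_zero_iff]; exact hJ0
  have hNJ1 : (1:ℝ) ≤ NJ := by exact_mod_cast Nat.one_le_iff_ne_zero.mpr hNJ0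
  refine ⟨2 * (C2 * Real.exp B ^ n) * C3 * C4 * NJ * NJ, by positivity, ?_⟩
  intro ι _ q _ hq ψ hψ π hα hqJ G hG X hX
  set Y := X * NJ with hY
  have hY1 : 1 ≤ Y := by nlinarith
  have hY0 : 0 < Y := by linarith
  set R := Y ^ (1 / (n:ℝ)) with hR
  have hR1 : 1 ≤ R := Real.one_le_rpow hY1 (by positivity)
  have hRn : R ^ n = Y := by
    rw [hR, ← Real.rpow_natCast, ← Real.rpow_mul hY0.le, one_div, inv_mul_cancel₀ (by linarith), Real.rpow_one]
  obtain ⟨T, hT, hTc⟩ := hcount (Real.exp B * R) (by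
    have := Real.one_le_exp hB
    nlinarith)
  have hTs : ∀ g, phiU G Y g ≠ 0 → g ∈ T := fun g hg =>
    hT g fun w => ((hsupp G hG Y hY0 g hg).2 w).2
  obtain ⟨i0, e, hcan⟩ := hU_cancel hN J (NJ := NJ) (Ideal.absNorm_mem J) q hq ψ hψ π α hα hqJ
  have hD : 0 < condu q ψ * NJ := by
    refine Nat.mul_pos ?_ (Nat.pos_of_ne_zero hNJ0)
    unfold condu
    refine Finset.prod_pos fun i _ => ?_
    split_ifs
    · exact one_pos
    · exact (Fact.out : (q i).Prime).pos
  have hx : ∀ t : ZMod (q i0), ∃ x : 𝓞 K, ∀ w : InfinitePlace K,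
      w (((t.val : 𝓞 K) * e + ((condu q ψ * NJ : ℕ) : 𝓞 K) * x : 𝓞 K) : K) ≤
        C4 * ((condu q ψ * NJ : ℕ) : ℝ) := fun t => hred _ _ hD
  choose x hx using hx
  refine ⟨T, hTs, ?_⟩
  have h1 := cancel_sum (hU J q ψ) (phiU G Y) (hU_norm_le J q ψ) T hTs
    (fun t : ZMod (q i0) => (t.val : 𝓞 K) * e + ((condu q ψ * NJ : ℕ) : 𝓞 K) * x t)
    (fun g => hcan g x) (C3 * (C4 * ((condu q ψ * NJ : ℕ) : ℝ) / R))
    (fun t g => hlip G hG Y hY0 g _ _ (hx t))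
  refine h1.trans ?_
  have h2 : Y / R ≤ NJ * X ^ (1 - 1 / (n:ℝ)) := by
    have e1 : Y / R = Y ^ (1 - 1 / (n:ℝ)) := by
      rw [Real.rpow_sub hY0, Real.rpow_one]
    rw [e1, hY, Real.mul_rpow (by linarith) (by linarith), mul_comm]
    gcongr
    have h3 : (0:ℝ) ≤ 1 / n := by positivity
    calc (NJ:ℝ) ^ (1 - 1 / (n:ℝ)) ≤ (NJ:ℝ) ^ (1:ℝ) :=
          Real.rpow_le_rpow_of_exponent_le hNJ1 (by linarith)
      _ = NJ := Real.rpow_one _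
  calc 2 * (T.card : ℝ) * (C3 * (C4 * ((condu q ψ * NJ : ℕ) : ℝ) / R))
      ≤ 2 * (C2 * (Real.exp B * R) ^ n) * (C3 * (C4 * ((condu q ψ * NJ : ℕ) : ℝ) / R)) := by
        gcongr
    _ = 2 * (C2 * Real.exp B ^ n) * C3 * C4 * condu q ψ * NJ * (Y / R) := by
        rw [mul_pow, hRn]; push_cast; ring
    _ ≤ 2 * (C2 * Real.exp B ^ n) * C3 * C4 * condu q ψ * NJ * (NJ * X ^ (1 - 1 / (n:ℝ))) := by
        gcongr
    _ = _ := by ring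

end

section

open NumberField NumberField.Units

lemma nrm_eq_absNorm {K : Type*} [Field K] [NumberField K] (g : 𝓞 K) :
    nrm g = Ideal.absNorm (Ideal.span {g}) := by
  rw [Ideal.absNorm_span_singleton]; rfl

lemma span_unit_mul {K : Type*} [Field K] [NumberField K] (u : (𝓞 K)ˣ) (g : 𝓞 K) :
    Ideal.span {(u : 𝓞 K) * g} = Ideal.span {g} := by
  rw [Ideal.span_singleton_eq_span_singleton]
  exact associated_unit_mul_left g (u : 𝓞 K) u.isUnit

open Classical in
lemma unit_sum {K : Type*} [Field K] [NumberField K] (G : ℝ → ℝ) (Y : ℝ) (γ : 𝓞 K) (hγ : γ ≠ 0)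
    (T : Finset (𝓞 K)) (hT : ∀ g, phiU G Y g ≠ 0 → g ∈ T) :
    ∑ g ∈ T with Ideal.span {g} = Ideal.span {γ}, phiU G Y g =
      torsionOrder K * G (Real.log (nrm γ / Y)) := by
  set f : 𝓞 K → ℝ := fun g => if Ideal.span {g} = Ideal.span {γ} then phiU G Y g else 0 with hf
  have h1 : HasSum (fun u : (𝓞 K)ˣ => etaU ((u : 𝓞 K) * γ) * G (Real.log (nrm γ / Y)))
      (torsionOrder K * G (Real.log (nrm γ / Y))) := (etaU_hasSum γ hγ).mul_right _
  have h2 : (fun u : (𝓞 K)ˣ => etaU ((u : 𝓞 K) * γ) * G (Real.log (nrm γ / Y))) =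
      f ∘ fun u : (𝓞 K)ˣ => (u : 𝓞 K) * γ := by
    funext u
    have h0 : (u : 𝓞 K) * γ ≠ 0 := mul_ne_zero u.ne_zero hγ
    simp only [hf, Function.comp, if_pos (span_unit_mul u γ), phiU, if_neg h0]
    rw [nrm_eq_absNorm γ, nrm_eq_absNorm, span_unit_mul]
  rw [h2, Function.Injective.hasSum_iff] at h1
  · have h3 : HasSum f (∑ g ∈ T, f g) := by
      refine hasSum_sum_of_ne_finset_zero (L := SummationFilter.unconditional _) fun g hg => ?_
      simp only [hf]
      split_ifs
      · by_contra h; exact hg (hT g h)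
      · rfl
    rw [Finset.sum_filter]
    exact h3.unique h1
  · intro u v h
    exact Units.ext (mul_right_cancel₀ hγ h)
  · intro x hx
    simp only [hf]
    rw [if_neg]
    intro h
    rw [Ideal.span_singleton_eq_span_singleton] at h
    obtain ⟨u, hu⟩ := h.symm
    exact hx ⟨u, by simp only; rw [mul_comm]; exact hu⟩

open Classical in
/-- Nonzero ideals of norm at most `N`. -/
noncomputable def idLe (K : Type*) [Field K] [NumberField K] (N : ℕ) : Finset (Ideal (𝓞 K)) :=
  (Finset.Icc 1 N).biUnion (idSet K)

lemma mem_idLe {K : Type*} [Field K] [NumberField K] {N : ℕ} {I : Ideal (𝓞 K)} :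
    I ∈ idLe K N ↔ I ≠ ⊥ ∧ Ideal.absNorm I ≤ N := by
  classical
  simp only [idLe, Finset.mem_biUnion, mem_idSet, Finset.mem_Icc]
  rw [Ne, ← Ideal.absNorm_eq_zero_iff]
  constructor
  · rintro ⟨l, ⟨h1, h2⟩, rfl⟩; exact ⟨by omega, h2⟩
  · rintro ⟨h1, h2⟩; exact ⟨_, ⟨by omega, h2⟩, rfl⟩

open Classical in
set_option maxHeartbeats 1000000 in
lemma class_sum {K : Type*} [Field K] [NumberField K] {ι : Type*} [Fintype ι]
    (q : ι → ℕ) (ψ : (i : ι) → DirichletCharacter ℂ (q i)) (J : Ideal (𝓞 K)) (hJ : J ≠ ⊥)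
    {G : ℝ → ℝ} (hG : NiceG G) {X : ℝ} (hX : 1 ≤ X) {N : ℕ} (hN : Real.exp 1 * X ≤ N)
    (T : Finset (𝓞 K)) (hT : ∀ g, phiU G (X * Ideal.absNorm J) g ≠ 0 → g ∈ T) :
    ∑ g ∈ T, hU J q ψ g * (phiU G (X * Ideal.absNorm J) g : ℂ) =
      ∑ I ∈ idLe K N with (I * J).IsPrincipal,
        chi q ψ (Ideal.absNorm I * Ideal.absNorm J) *
          ((torsionOrder K * G (Real.log (Ideal.absNorm I / X)) : ℝ) : ℂ) := by
  have hNJ : Ideal.absNorm J ≠ 0 := by rwa [Ne, Ideal.absNorm_eq_zero_iff]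
  have hNJ' : (Ideal.absNorm J : ℝ) ≠ 0 := by exact_mod_cast hNJ
  have hX0 : 0 < X := by linarith
  have hquot : ∀ a : ℝ, a * Ideal.absNorm J / (X * Ideal.absNorm J) = a / X := fun a => by
    field_simp
  have e1 : ∀ I ∈ (idLe K N).filter (fun I => (I * J).IsPrincipal),
      chi q ψ (Ideal.absNorm I * Ideal.absNorm J) *
          ((torsionOrder K * G (Real.log (Ideal.absNorm I / X)) : ℝ) : ℂ) =
      ∑ g ∈ T, if Ideal.span {g} = I * J then
        chi q ψ (Ideal.absNorm I * Ideal.absNorm J) * (phiU G (X * Ideal.absNorm J) g : ℂ) else 0 := by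
    intro I hI
    rw [Finset.mem_filter, mem_idLe] at hI
    obtain ⟨⟨hI0, hIN⟩, ⟨γ, hγ⟩⟩ := hI
    have hγ' : I * J = Ideal.span {γ} := hγ
    have hγ0 : γ ≠ 0 := by
      rintro rfl
      rw [Ideal.span_singleton_zero] at hγ'
      exact (mul_ne_zero hI0 hJ) hγ'
    have := unit_sum G (X * Ideal.absNorm J) γ hγ0 T hT
    rw [nrm_eq_absNorm γ, ← hγ', map_mul, Nat.cast_mul, hquot] at this
    rw [← this, ← Finset.sum_filter, Complex.ofReal_sum, Finset.mul_sum]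
  rw [Finset.sum_congr rfl e1, Finset.sum_comm]
  refine Finset.sum_congr rfl fun g _ => ?_
  by_cases hp : phiU G (X * Ideal.absNorm J) g = 0
  · simp [hp]
  have hg0 : g ≠ 0 := by
    rintro rfl; exact hp (by simp [phiU])
  have hG0 : G (Real.log (nrm g / (X * Ideal.absNorm J))) ≠ 0 := by
    intro h; exact hp (by simp [phiU, h])
  by_cases hgJ : g ∈ J
  · have hd : J ∣ Ideal.span {g} := by
      rw [Ideal.dvd_span_singleton]; exact hgJ
    obtain ⟨I, hI⟩ := hd
    rw [mul_comm] at hI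
    have hnr : nrm g = Ideal.absNorm I * Ideal.absNorm J := by
      rw [nrm_eq_absNorm, hI, map_mul]
    have hI0 : I ≠ ⊥ := by
      rintro rfl
      rw [Ideal.bot_mul, Ideal.span_singleton_eq_bot] at hI
      exact hg0 hI
    have hNI : Ideal.absNorm I ≠ 0 := by rwa [Ne, Ideal.absNorm_eq_zero_iff]
    have hIS : I ∈ (idLe K N).filter (fun I => (I * J).IsPrincipal) := by
      rw [Finset.mem_filter, mem_idLe]
      refine ⟨⟨hI0, ?_⟩, ⟨g, hI.symm⟩⟩
      rw [hnr, Nat.cast_mul, hquot] at hG0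
      have h1 : |Real.log (Ideal.absNorm I / X)| < 1 := by
        by_contra h
        push Not at h
        exact hG0 (hG.2.2 _ h)
      have hpos : (0:ℝ) < Ideal.absNorm I / X := by
        have : (0:ℝ) < Ideal.absNorm I := by exact_mod_cast Nat.pos_of_ne_zero hNI
        positivity
      have h2 := (Real.log_lt_iff_lt_exp hpos).mp (abs_lt.mp h1).2
      rw [div_lt_iff₀ hX0] at h2
      exact_mod_cast (h2.trans_le hN).le
    rw [Finset.sum_eq_single_of_mem I hIS, if_pos hI, hU, if_pos hgJ, hnr]
    intro I' _ hne
    rw [if_neg]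
    intro h
    exact hne (mul_right_cancel₀ hJ (h.symm.trans hI))
  · rw [hU, if_neg hgJ, zero_mul]
    symm
    refine Finset.sum_eq_zero fun I _ => ?_
    rw [if_neg]
    intro h
    refine hgJ (Ideal.mul_le_right (I := I) (J := J) ?_)
    rw [← h]; exact Ideal.mem_span_singleton_self g

end

section

open NumberField NumberField.Units

lemma exists_class_reps (K : Type*) [Field K] [NumberField K] :
    ∃ J : ClassGroup (𝓞 K) → Ideal (𝓞 K), (∀ c, J c ≠ ⊥) ∧
      ∀ I : Ideal (𝓞 K), I ≠ ⊥ → ∃! c, (I * J c).IsPrincipal := by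
  have h : ∀ c : ClassGroup (𝓞 K), ∃ J : nonZeroDivisors (Ideal (𝓞 K)), ClassGroup.mk0 J = c⁻¹ :=
    fun c => ClassGroup.mk0_surjective c⁻¹
  choose J hJ using h
  refine ⟨fun c => J c, fun c => nonZeroDivisors.coe_ne_zero (J c), fun I hI => ?_⟩
  have hmem : I ∈ nonZeroDivisors (Ideal (𝓞 K)) := mem_nonZeroDivisors_iff_ne_zero.mpr hI
  have key : ∀ c, (I * (J c : Ideal (𝓞 K))).IsPrincipal ↔ ClassGroup.mk0 ⟨I, hmem⟩ = c := by
    intro c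
    have := ClassGroup.mk0_eq_one_iff (R := 𝓞 K) (I := I * (J c : Ideal (𝓞 K)))
      (mul_mem hmem (J c).2)
    rw [← this]
    have e : (⟨I * (J c : Ideal (𝓞 K)), mul_mem hmem (J c).2⟩ : nonZeroDivisors (Ideal (𝓞 K))) =
      ⟨I, hmem⟩ * J c := rfl
    rw [e, map_mul, hJ, mul_inv_eq_one]
  refine ⟨ClassGroup.mk0 ⟨I, hmem⟩, (key _).mpr rfl, fun c hc => ((key c).mp hc).symm⟩

lemma exists_alpha (K : Type*) [Field K] [NumberField K] :
    ∃ α : 𝓞 K, ∀ σ : K ≃ₐ[ℚ] K, σ ≠ 1 → α - galO σ α ≠ 0 := by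
  obtain ⟨θ, hθ⟩ := Field.exists_primitive_element ℚ K
  obtain ⟨m, hm0, hm⟩ := IsAlgebraic.exists_integral_multiple
    ((IsFractionRing.isAlgebraic_iff ℤ ℚ K).mpr (IsAlgebraic.of_finite ℚ θ))
  refine ⟨⟨m • θ, hm⟩, fun σ hσ h => hσ ?_⟩
  have h1 : (m : K) * θ = σ ((m : K) * θ) := by
    have h2 := (congrArg (algebraMap (𝓞 K) K) (sub_eq_zero.mp h)).trans (galO_coe σ _)
    rw [← zsmul_eq_mul]
    exact h2
  rw [map_mul, map_intCast] at h1
  have h3 : σ θ = θ := (mul_left_cancel₀ (by exact_mod_cast hm0) h1).symm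
  have h4 : (σ : K →ₐ[ℚ] K) = AlgHom.id ℚ K := by
    have htop : Algebra.adjoin ℚ {θ} = ⊤ := by
      rw [← IntermediateField.adjoin_simple_toSubalgebra_of_isAlgebraic
        (IsAlgebraic.of_finite ℚ θ), hθ]
      rfl
    refine AlgHom.ext_of_adjoin_eq_top htop ?_
    intro x hx
    rw [Set.mem_singleton_iff] at hx
    subst hx
    simpa using h3
  ext x
  exact DFunLike.congr_fun h4 x

lemma exists_res {K : Type*} [Field K] [NumberField K] {p : ℕ} (hp : p.Prime)
    (h : pushI (K := K) laI p ≠ 0) : Nonempty (𝓞 K →+* ZMod p) := by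
  rw [pushI_apply _ hp.ne_zero] at h
  obtain ⟨A, hA, _⟩ := Finset.exists_ne_zero_of_sum_ne_zero h
  rw [mem_idSet] at hA
  have hc : Nat.card (𝓞 K ⧸ A) = p := by rw [← hA]; rfl
  have hfin : Finite (𝓞 K ⧸ A) := Nat.finite_of_card_ne_zero (by rw [hc]; exact hp.ne_zero)
  have hft := Fintype.ofFinite (𝓞 K ⧸ A)
  have e : ZMod p ≃+* (𝓞 K ⧸ A) := ZMod.ringEquivOfPrime _ hp (by rw [← Nat.card_eq_fintype_card, hc])
  exact ⟨(e.symm : (𝓞 K ⧸ A) →+* ZMod p).comp (Ideal.Quotient.mk A)⟩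

lemma chi_norm_one {ι : Type*} [Fintype ι] (q : ι → ℕ) [∀ i, Fact (q i).Prime]
    (ψ : (i : ι) → DirichletCharacter ℂ (q i)) {m : ℕ} (h : ∀ i, ¬ q i ∣ m) :
    ‖chi q ψ m‖ = 1 := by
  unfold chi
  rw [norm_prod]
  refine Finset.prod_eq_one fun i _ => ?_
  split_ifs
  · simp
  · have hu : IsUnit ((m : ℕ) : ZMod (q i)) := by
      rw [ZMod.isUnit_iff_coprime, Nat.coprime_comm, Nat.Prime.coprime_iff_not_dvd Fact.out]
      exact h i
    obtain ⟨u, hu⟩ := hu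
    rw [← hu]
    exact DirichletCharacter.unit_norm_eq_one _ u

open Classical in
lemma sum_split {K : Type*} [Field K] [NumberField K] (J : ClassGroup (𝓞 K) → Ideal (𝓞 K))
    (hJ : ∀ I : Ideal (𝓞 K), I ≠ ⊥ → ∃! c, (I * J c).IsPrincipal) (N : ℕ) (F : ℕ → ℝ) (c : ℕ → ℂ) :
    ∑ l ∈ Finset.Icc 1 N, ((pushI (K := K) (fun _ => 1) l * F l : ℝ) : ℂ) * c l =
      ∑ k, ∑ I ∈ idLe K N with (I * J k).IsPrincipal,
        (F (Ideal.absNorm I) : ℂ) * c (Ideal.absNorm I) := by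
  have e1 : ∑ l ∈ Finset.Icc 1 N, ((pushI (K := K) (fun _ => 1) l * F l : ℝ) : ℂ) * c l =
      ∑ I ∈ idLe K N, (F (Ideal.absNorm I) : ℂ) * c (Ideal.absNorm I) := by
    rw [idLe, Finset.sum_biUnion]
    · refine Finset.sum_congr rfl fun l hl => ?_
      rw [pushI_apply _ (by rw [Finset.mem_Icc] at hl; omega)]
      rw [Finset.sum_congr rfl (g := fun _ => (F l : ℂ) * c l)
        (fun I hI => by rw [mem_idSet.mp hI])]
      simp [mul_assoc]
    · intro a _ b _ hab
      rw [Function.onFun, Finset.disjoint_left]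
      intro I h1 h2
      rw [mem_idSet] at h1 h2
      exact hab (h1.symm.trans h2)
  rw [e1]
  simp_rw [Finset.sum_filter]
  rw [Finset.sum_comm]
  refine Finset.sum_congr rfl fun I hI => ?_
  obtain ⟨k, hk, huniq⟩ := hJ I (mem_idLe.mp hI).1
  rw [Finset.sum_eq_single_of_mem k (Finset.mem_univ _), if_pos hk]
  intro k' _ hne
  rw [if_neg]
  exact fun h => hne (huniq k' h)

open Classical in
set_option maxHeartbeats 1000000 in
theorem typeI_of_field (K : Type*) [Field K] [NumberField K] [IsGalois ℚ K]
    (hN : ∀ x : 𝓞 K, 0 ≤ Algebra.norm ℤ x) :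
    ∃ C1 Δ0 : ℝ, 0 ≤ C1 ∧ ∀ Q : Finset ℕ,
      (∀ q ∈ Q, q.Prime ∧ pushI (K := K) laI q ≠ 0 ∧ Δ0 < q) →
      FamTypeI (fun i : Q => (i : ℕ)) (Module.finrank ℚ K) (pushI (K := K) fun _ => 1) C1 := by
  obtain ⟨J, hJ0, hJ⟩ := exists_class_reps K
  obtain ⟨α, hα⟩ := exists_alpha K
  have hcb := fun k => class_bound K hN α (J k) (hJ0 k)
  choose C hC0 hC using hcb
  refine ⟨∑ k, C k, ∑ k, (Ideal.absNorm (J k) : ℝ) + ∑ σ : K ≃ₐ[ℚ] K,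
    ((Algebra.norm ℤ (α - galO σ α)).natAbs : ℝ), Finset.sum_nonneg fun k _ => hC0 k, ?_⟩
  intro Q hQ ψ hψ G hG X hX N hXN
  have hfact : ∀ i : Q, Fact (i : ℕ).Prime := fun i => ⟨(hQ i i.2).1⟩
  have hres : ∀ i : Q, Nonempty (𝓞 K →+* ZMod (i : ℕ)) := fun i =>
    exists_res (hQ i i.2).1 (hQ i i.2).2.1
  have hqJ : ∀ k, ∀ i : Q, ¬ (i : ℕ) ∣ Ideal.absNorm (J k) := by
    intro k i hd
    have h1 : Ideal.absNorm (J k) ≠ 0 := by rw [Ne, Ideal.absNorm_eq_zero_iff]; exact hJ0 k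
    have h2 := Nat.le_of_dvd (Nat.pos_of_ne_zero h1) hd
    have h3 : ((i : ℕ) : ℝ) ≤ Ideal.absNorm (J k) := by exact_mod_cast h2
    have h4 := Finset.single_le_sum (f := fun k => (Ideal.absNorm (J k) : ℝ))
      (fun k _ => by positivity) (Finset.mem_univ k)
    have h5 : (0:ℝ) ≤ ∑ σ : K ≃ₐ[ℚ] K, ((Algebra.norm ℤ (α - galO σ α)).natAbs : ℝ) := by positivity
    have h6 := (hQ i i.2).2.2
    linarith
  have hqα : ∀ i : Q, ∀ σ : K ≃ₐ[ℚ] K, σ ≠ 1 →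
      ¬ (((i : ℕ)) : ℤ) ∣ Algebra.norm ℤ (α - galO σ α) := by
    intro i σ hσ hd
    have h1 : Algebra.norm ℤ (α - galO σ α) ≠ 0 := Algebra.norm_ne_zero_iff.mpr (hα σ hσ)
    have h2 := Nat.le_of_dvd (Int.natAbs_pos.mpr h1) (Int.natCast_dvd.mp hd)
    have h3 : ((i : ℕ) : ℝ) ≤ (Algebra.norm ℤ (α - galO σ α)).natAbs := by exact_mod_cast h2
    have h4 := Finset.single_le_sum
      (f := fun σ : K ≃ₐ[ℚ] K => ((Algebra.norm ℤ (α - galO σ α)).natAbs : ℝ))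
      (fun k _ => by positivity) (Finset.mem_univ σ)
    have h5 : (0:ℝ) ≤ ∑ k, (Ideal.absNorm (J k) : ℝ) := by positivity
    have h6 := (hQ i i.2).2.2
    linarith
  rw [sum_split J hJ N (fun l => G (Real.log (l / X))) (chi (fun i : Q => (i : ℕ)) ψ),
    Finset.sum_mul, Finset.sum_mul]
  refine (norm_sum_le _ _).trans (Finset.sum_le_sum fun k _ => ?_)
  obtain ⟨T, hT, hb⟩ := hC k Q (fun i : Q => (i : ℕ)) Subtype.val_injective ψ hψ
    (fun i => (hres i).some) hqα (hqJ k) G hG X hX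
  refine le_trans ?_ hb
  rw [class_sum _ ψ (J k) (hJ0 k) hG hX hXN T hT]
  have e : ∑ I ∈ idLe K N with (I * J k).IsPrincipal,
        chi (fun i : Q => (i : ℕ)) ψ (Ideal.absNorm I * Ideal.absNorm (J k)) *
          ((torsionOrder K * G (Real.log (Ideal.absNorm I / X)) : ℝ) : ℂ) =
      ((torsionOrder K : ℂ) * chi (fun i : Q => (i : ℕ)) ψ (Ideal.absNorm (J k))) *
      ∑ I ∈ idLe K N with (I * J k).IsPrincipal,
        (G (Real.log (Ideal.absNorm I / X)) : ℂ) *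
          chi (fun i : Q => (i : ℕ)) ψ (Ideal.absNorm I) := by
    rw [Finset.mul_sum]
    refine Finset.sum_congr rfl fun I _ => ?_
    rw [chi_mul]
    push_cast
    ring
  rw [e, norm_mul, norm_mul, chi_norm_one _ ψ (hqJ k), mul_one]
  refine le_mul_of_one_le_left (norm_nonneg _) ?_
  rw [Complex.norm_natCast]
  exact_mod_cast Nat.one_le_iff_ne_zero.mpr (torsionOrder_ne_zero K)

end

section

open NumberField Polynomial

lemma splits_of_res {K : Type*} [Field K] [NumberField K] {f : Polynomial ℤ} (hm : f.Monic)
    (hs : (f.map (algebraMap ℤ K)).Splits) {p : ℕ} (π : 𝓞 K →+* ZMod p) :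
    SplitsModLinear f p := by
  classical
  have h1 : ∃ s : Multiset (𝓞 K), f.map (algebraMap ℤ (𝓞 K)) = (s.map fun a => X - C a).prod := by
    have hm' : (f.map (algebraMap ℤ K)).Monic := hm.map _
    have hr : ∀ a ∈ (f.map (algebraMap ℤ K)).roots, IsIntegral ℤ a := by
      intro a ha
      rw [mem_roots hm'.ne_zero, IsRoot.def, eval_map] at ha
      exact ⟨f, hm, ha⟩
    refine ⟨(f.map (algebraMap ℤ K)).roots.attach.map fun a =>
      (IsIntegralClosure.mk' (𝓞 K) a.1 (hr a.1 a.2) : 𝓞 K), ?_⟩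
    apply Polynomial.map_injective (algebraMap (𝓞 K) K) RingOfIntegers.coe_injective
    rw [Polynomial.map_map, ← IsScalarTower.algebraMap_eq, Polynomial.map_multiset_prod,
      Multiset.map_map, Multiset.map_map]
    refine (hs.eq_prod_roots_of_monic hm').trans ?_
    conv_lhs => rw [← Multiset.attach_map_val (f.map (algebraMap ℤ K)).roots]
    rw [Multiset.map_map]
    congr 1
    refine Multiset.map_congr rfl fun a _ => ?_
    simp [IsIntegralClosure.algebraMap_mk']
  obtain ⟨s, hs⟩ := h1
  refine ⟨s.map π, ?_⟩
  have e : Int.castRingHom (ZMod p) = π.comp (algebraMap ℤ (𝓞 K)) := RingHom.ext_int _ _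
  rw [e, ← Polynomial.map_map, hs, Polynomial.map_multiset_prod, Multiset.map_map, Multiset.map_map]
  congr 1
  refine Multiset.map_congr rfl fun a _ => ?_
  simp

theorem carm_of_field (K : Type*) [Field K] [NumberField K] [IsGalois ℚ K]
    (hI : ∃ i : K, i ^ 2 = -1) (f : Polynomial ℤ) (hm : f.Monic)
    (hs : (f.map (algebraMap ℤ K)).Splits) :
    ∃ c : ℝ, 0 < c ∧ ∀ᶠ X : ℝ in Filter.atTop,
      X ^ c ≤
        ({n : ℕ | (n : ℝ) ≤ X ∧ IsCarmichael n ∧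
          ∀ p : ℕ, p.Prime → p ∣ n → SplitsModLinear f p}.ncard : ℝ) := by
  obtain ⟨C1, Δ0, hC1, htI⟩ := typeI_of_field K (norm_nonneg_of_I hI)
  obtain ⟨κ, c0, hκ, hκ1, hc0, hsc⟩ := scale_of_field K
  have F : FieldData (Module.finrank ℚ K) (pushI (K := K) fun _ => 1) (pushI (K := K) muI)
      (pushI (K := K) laI) (SplitsModLinear f) C1 Δ0 κ c0 :=
    { hn := Module.finrank_pos
      ad := arithData_of_field K
      C1_nonneg := hC1
      typeI := htI
      κ_pos := hκ
      κ_le := hκ1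
      c0_pos := hc0
      scale := hsc
      good_of := fun p hp h => splits_of_res hm hs (exists_res hp h).some }
  exact final_count F

lemma exists_splitting (g : ℚ[X]) : ∃ (L : Type) (_ : Field L) (_ : CharZero L),
    IsSplittingField ℚ L g := by
  have hc : CharZero g.SplittingField := algebraRat.charZero _
  refine ⟨g.SplittingField, inferInstance, hc, ?_⟩
  convert (IsSplittingField.splittingField g)
  exact Subsingleton.elim _ _

theorem carm_split_aux (f : Polynomial ℤ) (hmonic : f.Monic)
    (hsq : Squarefree f) (hdeg : 0 < f.natDegree) :
    ∃ c : ℝ, 0 < c ∧ ∀ᶠ X : ℝ in Filter.atTop,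
      X ^ c ≤
        ({n : ℕ | (n : ℝ) ≤ X ∧ IsCarmichael n ∧
          ∀ p : ℕ, p.Prime → p ∣ n → SplitsModLinear f p}.ncard : ℝ) := by
  obtain ⟨g, hgd⟩ : ∃ g : ℚ[X], g = f.map (algebraMap ℤ ℚ) * (X ^ 2 + 1) := ⟨_, rfl⟩
  have hX : (X ^ 2 + 1 : ℚ[X]).Monic := by
    have := monic_X_pow_add_C (R := ℚ) (n := 2) 1 (by norm_num)
    simpa using this
  have hX2 : (X ^ 2 + 1 : ℚ[X]).natDegree = 2 := by
    have := natDegree_X_pow_add_C (R := ℚ) (n := 2) (r := 1)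
    simpa using this
  have hfm : (f.map (algebraMap ℤ ℚ)).Monic := hmonic.map _
  have hg : g ≠ 0 := hgd ▸ mul_ne_zero hfm.ne_zero hX.ne_zero
  obtain ⟨L, hF, hC, hS⟩ := exists_splitting g
  have hsplit : (g.map (algebraMap ℚ L)).Splits := IsSplittingField.splits L g
  have hnorm : Normal ℚ L := Normal.of_isSplittingField g
  have hfd : FiniteDimensional ℚ L := IsSplittingField.finiteDimensional L g
  have hNF : NumberField L := ⟨⟩
  have hgal : IsGalois ℚ L := ⟨⟩
  have hmap : g.map (algebraMap ℚ L) =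
      f.map (algebraMap ℤ L) * (X ^ 2 + 1) := by
    rw [hgd, Polynomial.map_mul, Polynomial.map_map, ← IsScalarTower.algebraMap_eq]
    simp
  have hg' : g.map (algebraMap ℚ L) ≠ 0 := Polynomial.map_ne_zero hg
  refine carm_of_field L ?_ f hmonic ?_
  · have h2 : ((X ^ 2 + 1 : (L)[X])).Splits :=
      hsplit.of_dvd hg' (by rw [hmap]; exact dvd_mul_left _ _)
    have hd : (X ^ 2 + 1 : (L)[X]).degree ≠ 0 := by
      have := degree_X_pow_add_C (R := L) (n := 2) (by norm_num) 1
      rw [map_one] at this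
      rw [this]; norm_num
    obtain ⟨i, hi⟩ := h2.exists_eval_eq_zero hd
    refine ⟨i, ?_⟩
    simp only [eval_add, eval_pow, eval_X, eval_one] at hi
    linear_combination hi
  · exact hsplit.of_dvd hg' (by rw [hmap]; exact dvd_mul_right _ _)

end

/-- There is a constant `c > 0` such that for all sufficiently large `X`, the number of
Carmichael numbers `n ≤ X` all of whose prime factors `p` are such that `f` splits into
linear factors mod `p` is at least `X ^ c`. -/
theorem infinitely_many_carmichael_split (f : Polynomial ℤ) (hmonic : f.Monic)
    (hsq : Squarefree f) (hdeg : 0 < f.natDegree) :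
    ∃ c : ℝ, 0 < c ∧ ∀ᶠ X : ℝ in Filter.atTop,
      X ^ c ≤
        ({n : ℕ | (n : ℝ) ≤ X ∧ IsCarmichael n ∧
          ∀ p : ℕ, p.Prime → p ∣ n → SplitsModLinear f p}.ncard : ℝ) := by
  exact carm_split_aux f hmonic hsq hdeg
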